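/- Let n ≥ 3, 0 ≤ a < (n-2)/2, 0 < b, a ≤ b < a+1, p = 2n/(n-2+2(b-a)), and for 1 ≤ i, j ≤ 2 let κ_{ij} > 0 and α_{ij}, β_{ij} > 1 with α_{ij} + β_{ij} = p. Assume α₁₂ = β₂₁, β₁₂ = α₂₁ and κ₁₂/κ₂₁ = α₁₂/β₁₂. Let (u₁, u₂) be a positive finite-energy solution of the 2-coupled Hénon–Sobolev system (S₂). Then there exist positive constants μ₀, c₁, c₂ such that u₁ = c₁ U_{μ₀} and u₂ = c₂ U_{μ₀} on ℝⁿ \ {0}, where κ₁₁ c₁^{p-2} + κ₁₂ c₁^{α₁₂-2} c₂^{β₁₂} = 1 and κ₂₂ c₂^{p-2} + κ₂₁ c₂^{α₂₁-2} c₁^{β₂₁} = 1. -/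

import Mathlib

open MeasureTheory Real Filter Topology

noncomputable section

/-- Coordinate Laplacian on Euclidean space. -/
def lapl {n : ℕ} (w : EuclideanSpace ℝ (Fin n) → ℝ) (x : EuclideanSpace ℝ (Fin n)) : ℝ :=
  ∑ i : Fin n, fderiv ℝ (fun y => fderiv ℝ w y (EuclideanSpace.single i 1)) x
    (EuclideanSpace.single i 1)

/-- The weighted divergence `div(|x|^(-2a) ∇w)(x) = |x|^(-2a) (Δw(x) - 2a⟨x,∇w(x)⟩/|x|²)`. -/
def wdiv {n : ℕ} (a : ℝ) (w : EuclideanSpace ℝ (Fin n) → ℝ) (x : EuclideanSpace ℝ (Fin n)) : ℝ :=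
  ‖x‖ ^ (-(2*a)) * (lapl w x - 2*a * (@inner ℝ _ _ x (gradient w x)) / ‖x‖^2)

/-- Finiteness of the weighted Dirichlet energy `∫ |x|^(-2a) |∇w|² < ∞`. -/
def finiteEnergy {n : ℕ} (a : ℝ) (w : EuclideanSpace ℝ (Fin n) → ℝ) : Prop :=
  Integrable (fun x : EuclideanSpace ℝ (Fin n) => ‖x‖ ^ (-(2*a)) * ‖gradient w x‖^2)

/-- The standard bubble `U` of the critical Hénon equation. -/
def bubble (n : ℕ) (a b : ℝ) (x : EuclideanSpace ℝ (Fin n)) : ℝ :=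
  (((n:ℝ) * ((n:ℝ) - 2 - 2*a)^2 / ((n:ℝ) - 2*(1+a-b))) ^
      (((n:ℝ) - 2*(1+a-b)) / (4*(1+a-b)))) *
  (1 + ‖x‖ ^ (2*((n:ℝ)-2-2*a)*(1+a-b) / ((n:ℝ)-2*(1+a-b)))) ^
    (-(((n:ℝ)-2*(1+a-b)) / (2*(1+a-b))))

/-- The rescaled bubble `U_μ(x) = μ^(-(n-2-2a)/2) U(x/μ)`. -/
def bubbleMu (n : ℕ) (a b μ : ℝ) (x : EuclideanSpace ℝ (Fin n)) : ℝ :=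
  μ ^ (-(((n:ℝ)-2-2*a)/2)) * bubble n a b (μ⁻¹ • x)

section

open InnerProductSpace Laplacian Gradient

section LaplacianCalculus

theorem ContDiffAt.eventually_differentiableAt {F : Type*} [NormedAddCommGroup F] [NormedSpace ℝ F]
    {f : F → ℝ} {x : F} (hf : ContDiffAt ℝ 2 f x) :
    ∀ᶠ y in 𝓝 x, DifferentiableAt ℝ f y :=
  (hf.eventually (by simp)).mono fun _ hy => hy.differentiableAt (by simp)

theorem ContDiffAt.differentiableAt_fderiv_apply {F : Type*} [NormedAddCommGroup F]
    [NormedSpace ℝ F] {f : F → ℝ} {x : F} (hf : ContDiffAt ℝ 2 f x) (e : F) :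
    DifferentiableAt ℝ (fun y => fderiv ℝ f y e) x :=
  ((hf.fderiv_right (m := 1) (by norm_num)).differentiableAt (by simp)).clm_apply
    (differentiableAt_const e)

variable {V : Type*} [NormedAddCommGroup V] [InnerProductSpace ℝ V] [FiniteDimensional ℝ V]

theorem HasFDerivAt.hasGradientAt_of_forall {f : V → ℝ} {x g : V} {f' : V →L[ℝ] ℝ}
    (h : HasFDerivAt f f' x) (hg : ∀ v, f' v = Inner.inner ℝ g v) : HasGradientAt f g x := by
  rw [hasGradientAt_iff_hasFDerivAt]
  have : f' = toDual ℝ V g := by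
    ext v; rw [hg, toDual_apply_apply]
  exact this ▸ h

/-- The function `f` is twice continuously differentiable at `x`, with gradient `g` and
Laplacian `l` there. -/
structure HasLap (f : V → ℝ) (x g : V) (l : ℝ) : Prop where
  contDiffAt : ContDiffAt ℝ 2 f x
  gradient_eq : ∇ f x = g
  laplacian_eq : Δ f x = l

theorem ContDiffAt.hasLap {f : V → ℝ} {x : V} (hf : ContDiffAt ℝ 2 f x) :
    HasLap f x (∇ f x) (Δ f x) := ⟨hf, rfl, rfl⟩

theorem ContDiffAt.laplacian_eq_sum {ι : Type*} [Fintype ι] (b : OrthonormalBasis ι ℝ V)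
    {f : V → ℝ} {x : V} (hf : ContDiffAt ℝ 2 f x) :
    Δ f x = ∑ i, fderiv ℝ (fun y => fderiv ℝ f y (b i)) x (b i) := by
  rw [laplacian_eq_iteratedFDeriv_orthonormalBasis f b]
  refine Finset.sum_congr rfl fun i _ => ?_
  rw [iteratedFDeriv_two_apply]
  have h : DifferentiableAt ℝ (fderiv ℝ f) x :=
    (hf.fderiv_right (m := 1) (by norm_num)).differentiableAt (by simp)
  rw [fderiv_clm_apply h (differentiableAt_const _)]
  simp

theorem inner_gradient_eq_sum {ι : Type*} [Fintype ι] (b : OrthonormalBasis ι ℝ V)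
    (f g : V → ℝ) (x : V) :
    inner ℝ (∇ f x) (∇ g x) = ∑ i, fderiv ℝ f x (b i) * fderiv ℝ g x (b i) := by
  rw [← b.sum_inner_mul_inner]
  refine Finset.sum_congr rfl fun i _ => ?_
  rw [inner_gradient_left, real_inner_comm, inner_gradient_left]

namespace HasLap

variable {f h : V → ℝ} {x g k : V} {l m : ℝ}

theorem hasGradientAt (hf : HasLap f x g l) : HasGradientAt f g x :=
  hf.gradient_eq ▸ (hf.contDiffAt.differentiableAt (by simp)).hasGradientAt

theorem add (hf : HasLap f x g l) (hh : HasLap h x k m) :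
    HasLap (fun y => f y + h y) x (g + k) (l + m) := by
  refine ⟨hf.contDiffAt.add hh.contDiffAt, ?_, ?_⟩
  · refine HasGradientAt.gradient ?_
    rw [hasGradientAt_iff_hasFDerivAt, map_add]
    exact hf.hasGradientAt.hasFDerivAt.add hh.hasGradientAt.hasFDerivAt
  · have := hf.contDiffAt.laplacian_add hh.contDiffAt
    rw [hf.laplacian_eq, hh.laplacian_eq] at this
    exact this

theorem mul (hf : HasLap f x g l) (hh : HasLap h x k m) :
    HasLap (fun y => f y * h y) x (f x • k + h x • g)
      (f x * m + 2 * inner ℝ g k + h x * l) := by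
  have hfh : ContDiffAt ℝ 2 (fun y => f y * h y) x := hf.contDiffAt.mul hh.contDiffAt
  refine ⟨hfh, ?_, ?_⟩
  · refine HasGradientAt.gradient ?_
    refine (hf.hasGradientAt.hasFDerivAt.mul hh.hasGradientAt.hasFDerivAt).hasGradientAt_of_forall
      fun v => ?_
    simp [inner_add_left, inner_smul_left]
  · rw [← hf.laplacian_eq, ← hh.laplacian_eq, ← hf.gradient_eq, ← hh.gradient_eq,
      hfh.laplacian_eq_sum (stdOrthonormalBasis ℝ V),
      hf.contDiffAt.laplacian_eq_sum (stdOrthonormalBasis ℝ V),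
      hh.contDiffAt.laplacian_eq_sum (stdOrthonormalBasis ℝ V),
      inner_gradient_eq_sum (stdOrthonormalBasis ℝ V)]
    rw [Finset.mul_sum, Finset.mul_sum, Finset.mul_sum, ← Finset.sum_add_distrib,
      ← Finset.sum_add_distrib]
    refine Finset.sum_congr rfl fun i _ => ?_
    set e := stdOrthonormalBasis ℝ V i
    have : (fun y => fderiv ℝ (fun y => f y * h y) y e) =ᶠ[𝓝 x]
        fun y => f y * fderiv ℝ h y e + fderiv ℝ f y e * h y := by
      filter_upwards [hf.contDiffAt.eventually_differentiableAt,
        hh.contDiffAt.eventually_differentiableAt] with y h1 h2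
      rw [fderiv_fun_mul h1 h2]
      simp [mul_comm]
    rw [this.fderiv_eq]
    have d1 := hf.contDiffAt.differentiableAt_fderiv_apply e
    have d2 := hh.contDiffAt.differentiableAt_fderiv_apply e
    have e1 := hf.contDiffAt.differentiableAt (by simp)
    have e2 := hh.contDiffAt.differentiableAt (by simp)
    have h3 := (e1.hasFDerivAt.mul d2.hasFDerivAt).add (d1.hasFDerivAt.mul e2.hasFDerivAt)
    erw [h3.fderiv]
    simp
    ring

theorem const (c : ℝ) (x : V) : HasLap (fun _ => c) x 0 0 := by
  refine ⟨contDiffAt_const, ?_, ?_⟩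
  · exact HasGradientAt.gradient (by
      rw [hasGradientAt_iff_hasFDerivAt, map_zero]; exact hasFDerivAt_const c x)
  · exact congrFun laplacian_const x

theorem congr (hf : HasLap f x g l) (hfh : h =ᶠ[𝓝 x] f) : HasLap h x g l := by
  refine ⟨hf.contDiffAt.congr_of_eventuallyEq hfh, ?_, ?_⟩
  · rw [gradient, hfh.fderiv_eq]; exact hf.gradient_eq
  · rw [(laplacian_congr_nhds hfh).eq_of_nhds]; exact hf.laplacian_eq

theorem const_mul (hf : HasLap f x g l) (c : ℝ) :
    HasLap (fun y => c * f y) x (c • g) (c * l) := by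
  have := (const c x).mul hf
  simpa using this

theorem sub (hf : HasLap f x g l) (hh : HasLap h x k m) :
    HasLap (fun y => f y - h y) x (g - k) (l - m) := by
  have := hf.add (hh.const_mul (-1))
  simpa [sub_eq_add_neg] using this

theorem comp (hf : HasLap f x g l) {φ φ' : ℝ → ℝ} {φ'' : ℝ}
    (hφ : ∀ᶠ s in 𝓝 (f x), HasDerivAt φ (φ' s) s) (hφ' : HasDerivAt φ' φ'' (f x))
    (hφc : ContDiffAt ℝ 2 φ (f x)) :
    HasLap (fun y => φ (f y)) x (φ' (f x) • g) (φ'' * ‖g‖ ^ 2 + φ' (f x) * l) := by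
  have hc : ContDiffAt ℝ 2 (fun y => φ (f y)) x := hφc.comp x hf.contDiffAt
  refine ⟨hc, ?_, ?_⟩
  · refine HasGradientAt.gradient ?_
    refine (hφ.self_of_nhds.comp_hasFDerivAt x
      hf.hasGradientAt.hasFDerivAt).hasGradientAt_of_forall fun v => ?_
    simp [inner_smul_left]
  · rw [← hf.laplacian_eq, ← hf.gradient_eq, ← real_inner_self_eq_norm_sq,
      hc.laplacian_eq_sum (stdOrthonormalBasis ℝ V),
      hf.contDiffAt.laplacian_eq_sum (stdOrthonormalBasis ℝ V),
      inner_gradient_eq_sum (stdOrthonormalBasis ℝ V)]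
    rw [Finset.mul_sum, Finset.mul_sum, ← Finset.sum_add_distrib]
    refine Finset.sum_congr rfl fun i _ => ?_
    set e := stdOrthonormalBasis ℝ V i
    have hcf := hf.contDiffAt.continuousAt
    have : (fun y => fderiv ℝ (fun y => φ (f y)) y e) =ᶠ[𝓝 x]
        fun y => φ' (f y) * fderiv ℝ f y e := by
      filter_upwards [hf.contDiffAt.eventually_differentiableAt, hcf.eventually hφ] with y h1 h2
      have := h2.comp_hasFDerivAt y h1.hasFDerivAt
      erw [this.fderiv]
      simp
    rw [this.fderiv_eq]
    have d1 := hf.contDiffAt.differentiableAt_fderiv_apply e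
    have e1 := hf.contDiffAt.differentiableAt (by simp)
    have e2 : HasFDerivAt (fun y => φ' (f y)) (φ'' • fderiv ℝ f x) x :=
      hφ'.comp_hasFDerivAt x e1.hasFDerivAt
    rw [fderiv_fun_mul e2.differentiableAt d1, e2.fderiv]
    simp
    ring

theorem comp_affine (L : V ≃ₗᵢ[ℝ] V) (r : ℝ) (c : V) (hf : HasLap f (r • L x + c) g l) :
    HasLap (fun y => f (r • L y + c)) x (r • L.symm g) (r ^ 2 * l) := by
  set A : V →L[ℝ] V := r • (L.toContinuousLinearEquiv : V →L[ℝ] V) with hA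
  have hAff : ∀ y, HasFDerivAt (fun y => r • L y + c) A y := fun y => by
    have := (A.hasFDerivAt (x := y)).add_const c
    exact this
  have hcd : ContDiff ℝ 2 (fun y : V => r • L y + c) := by
    have : ContDiff ℝ 2 (fun y : V => A y + c) := by fun_prop
    exact this
  have hc : ContDiffAt ℝ 2 (fun y => f (r • L y + c)) x := hf.contDiffAt.comp x hcd.contDiffAt
  have hcont : ContinuousAt (fun y : V => r • L y + c) x := hcd.continuous.continuousAt
  refine ⟨hc, ?_, ?_⟩
  · refine HasGradientAt.gradient ?_
    refine (hf.hasGradientAt.hasFDerivAt.comp x (hAff x)).hasGradientAt_of_forall fun v => ?_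
    have : (inner ℝ (L.symm g) v : ℝ) = inner ℝ g (L v) := by
      rw [← L.inner_map_map, L.apply_symm_apply]
    simp [hA, inner_smul_left, this]
  · rw [← hf.laplacian_eq, hc.laplacian_eq_sum (stdOrthonormalBasis ℝ V),
      hf.contDiffAt.laplacian_eq_sum ((stdOrthonormalBasis ℝ V).map L), Finset.mul_sum]
    refine Finset.sum_congr rfl fun i _ => ?_
    set e := stdOrthonormalBasis ℝ V i
    have hev : (fun y => fderiv ℝ (fun y => f (r • L y + c)) y e) =ᶠ[𝓝 x]
        fun y => r * fderiv ℝ f (r • L y + c) (L e) := by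
      filter_upwards [hcont.eventually hf.contDiffAt.eventually_differentiableAt] with y h1
      have := h1.hasFDerivAt.comp y (hAff y)
      erw [this.fderiv]
      simp [hA]
    rw [hev.fderiv_eq]
    have d1 := (hf.contDiffAt.differentiableAt_fderiv_apply (L e)).hasFDerivAt.comp x (hAff x)
    have d2 := d1.const_mul r
    erw [d2.fderiv]
    simp [hA, e]
    ring

end HasLap

theorem hasLap_inner (e x : V) : HasLap (fun y => inner ℝ y e) x e 0 := by
  have hg : ∀ y, HasFDerivAt (fun y => inner ℝ y e) (toDual ℝ V e) y := fun y => by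
    have : (fun y : V => (inner ℝ y e : ℝ)) = toDual ℝ V e := by
      ext y; rw [toDual_apply_apply, real_inner_comm]
    rw [this]
    exact ContinuousLinearMap.hasFDerivAt _
  have hc : ContDiffAt ℝ 2 (fun y : V => (inner ℝ y e : ℝ)) x :=
    contDiffAt_id.inner ℝ contDiffAt_const
  refine ⟨hc, HasGradientAt.gradient (hg x), ?_⟩
  rw [hc.laplacian_eq_sum (stdOrthonormalBasis ℝ V)]
  refine Finset.sum_eq_zero fun i _ => ?_
  have : (fun y => fderiv ℝ (fun y => inner ℝ y e) y (stdOrthonormalBasis ℝ V i)) =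
      fun _ => toDual ℝ V e (stdOrthonormalBasis ℝ V i) := by
    ext y; rw [(hg y).fderiv]
  rw [this]
  simp

theorem hasLap_norm_sq (x : V) :
    HasLap (fun y => ‖y‖ ^ 2) x ((2 : ℝ) • x) (2 * Module.finrank ℝ V) := by
  have hg : ∀ y : V, HasFDerivAt (fun y => ‖y‖ ^ 2) ((2 : ℝ) • toDual ℝ V y) y := fun y => by
    have := (hasStrictFDerivAt_norm_sq y).hasFDerivAt
    convert this using 1
    ext v; simp
  have hc : ContDiffAt ℝ 2 (fun y : V => ‖y‖ ^ 2) x := (contDiff_norm_sq ℝ).contDiffAt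
  refine ⟨hc, HasGradientAt.gradient ?_, ?_⟩
  · exact (hg x).hasGradientAt_of_forall fun v => by simp [inner_smul_left]
  · rw [hc.laplacian_eq_sum (stdOrthonormalBasis ℝ V)]
    have key : ∀ i, fderiv ℝ (fun y => fderiv ℝ (fun y : V => ‖y‖ ^ 2) y
        (stdOrthonormalBasis ℝ V i)) x (stdOrthonormalBasis ℝ V i) = 2 := fun i => by
      set e := stdOrthonormalBasis ℝ V i
      have : (fun y => fderiv ℝ (fun y : V => ‖y‖ ^ 2) y e) = fun y => 2 * inner ℝ y e := by
        ext y; rw [(hg y).fderiv]; simp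
      rw [this]
      have h2 := ((hasLap_inner e x).const_mul 2).hasGradientAt.hasFDerivAt.fderiv
      rw [h2]
      simp [e]
    rw [Finset.sum_congr rfl fun i _ => key i]
    simp [mul_comm]

theorem hasLap_norm_rpow (γ : ℝ) {x : V} (hx : x ≠ 0) :
    HasLap (fun y => ‖y‖ ^ γ) x ((γ * ‖x‖ ^ (γ - 2)) • x)
      (γ * (γ + Module.finrank ℝ V - 2) * ‖x‖ ^ (γ - 2)) := by
  have hpos : 0 < ‖x‖ := norm_pos_iff.2 hx
  have hsq : 0 < ‖x‖ ^ 2 := by positivity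
  have h := (hasLap_norm_sq x).comp (φ := fun s => s ^ (γ / 2))
    (φ' := fun s => γ / 2 * s ^ (γ / 2 - 1)) (φ'' := γ / 2 * ((γ / 2 - 1) * (‖x‖ ^ 2) ^ (γ / 2 - 1 - 1)))
    ((eventually_gt_nhds hsq).mono fun s hs => hasDerivAt_rpow_const (Or.inl hs.ne'))
    ((hasDerivAt_rpow_const (Or.inl hsq.ne')).const_mul _)
    (contDiffAt_rpow_const_of_ne hsq.ne')
  have hp : ∀ (y : V) (s : ℝ), (‖y‖ ^ 2) ^ s = ‖y‖ ^ (2 * s) := fun y s => by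
    rw [← rpow_natCast, ← rpow_mul (norm_nonneg _)]; norm_num
  have e1 : 2 * (γ / 2 - 1) = γ - 2 := by ring
  have e2 : ‖x‖ ^ (2 * (γ / 2 - 1 - 1)) * ‖x‖ ^ 2 = ‖x‖ ^ (γ - 2) := by
    rw [← rpow_natCast, ← rpow_add hpos]; congr 1; push_cast; ring
  simp only [hp, e1] at h
  have h' := h.congr (h := fun y => ‖y‖ ^ γ) (Eventually.of_forall fun y => by
    show ‖y‖ ^ γ = ‖y‖ ^ (2 * (γ / 2)); congr 1; ring)
  convert h' using 1
  · rw [smul_smul]; congr 1; ring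
  · rw [norm_smul, mul_pow, norm_two]
    linear_combination (-(γ * (γ - 2))) * e2

theorem IsLocalMin.laplacian_nonneg {f : V → ℝ} {x : V} (hm : IsLocalMin f x)
    (hf : ContDiffAt ℝ 2 f x) : 0 ≤ Δ f x := by
  rw [hf.laplacian_eq_sum (stdOrthonormalBasis ℝ V)]
  refine Finset.sum_nonneg fun i _ => ?_
  set e := stdOrthonormalBasis ℝ V i
  by_contra! hneg
  set φ : ℝ → ℝ := fun t => f (x + t • e) with hφ
  have hline : ∀ t : ℝ, HasDerivAt (fun t : ℝ => x + t • e) e t := fun t => by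
    simpa using ((hasDerivAt_id t).smul_const e).const_add x
  have hcont : ContinuousAt (fun t : ℝ => x + t • e) 0 := (hline 0).continuousAt
  have h0 : x + (0 : ℝ) • e = x := by simp
  have hev : ∀ᶠ t in 𝓝 (0 : ℝ), HasDerivAt φ (fderiv ℝ f (x + t • e) e) t := by
    have h1 : ∀ᶠ y in 𝓝 (x + (0 : ℝ) • e), DifferentiableAt ℝ f y := by
      rw [h0]; exact hf.eventually_differentiableAt
    filter_upwards [hcont.eventually h1] with t ht
    exact ht.hasFDerivAt.comp_hasDerivAt t (hline t)
  have hd : deriv φ =ᶠ[𝓝 0] fun t => fderiv ℝ f (x + t • e) e := hev.mono fun t ht => ht.deriv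
  have hdd : deriv (deriv φ) 0 = fderiv ℝ (fun y => fderiv ℝ f y e) x e := by
    rw [hd.deriv_eq]
    have hdx : HasFDerivAt (fun y => fderiv ℝ f y e) (fderiv ℝ (fun y => fderiv ℝ f y e) x)
        (x + (0 : ℝ) • e) := by
      rw [h0]; exact (hf.differentiableAt_fderiv_apply e).hasFDerivAt
    exact (hdx.comp_hasDerivAt (0 : ℝ) (hline 0)).deriv
  have hmin : IsLocalMin φ 0 := by
    have : ∀ᶠ y in 𝓝 (x + (0 : ℝ) • e), f x ≤ f y := by rw [h0]; exact hm
    filter_upwards [hcont.eventually this] with t ht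
    simpa [hφ] using ht
  have hmax : IsLocalMax φ 0 :=
    isLocalMax_of_deriv_deriv_neg (by rw [hdd]; exact hneg) hmin.deriv_eq_zero
      hev.self_of_nhds.continuousAt
  have hconst : φ =ᶠ[𝓝 0] fun _ => φ 0 := by
    filter_upwards [hmin, hmax] with t h1 h2 using le_antisymm h2 h1
  have : deriv (deriv φ) 0 = 0 := by
    have h1 : deriv φ =ᶠ[𝓝 0] fun _ => 0 := by
      filter_upwards [hconst.eventuallyEq_nhds] with t ht
      rw [ht.deriv_eq]; simp
    rw [h1.deriv_eq]; simp
  linarith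

/-- If `f` touches `h` from above at `x`, then `Δ h x ≤ Δ f x`. -/
theorem HasLap.le_of_eventually_le {f h : V → ℝ} {x g k : V} {l m : ℝ} (hf : HasLap f x g l)
    (hh : HasLap h x k m) (hle : ∀ᶠ y in 𝓝 x, h y ≤ f y) (heq : h x = f x) : m ≤ l := by
  have hs := hf.sub hh
  have : IsLocalMin (fun y => f y - h y) x := by
    filter_upwards [hle] with y hy
    rw [heq, sub_self]; linarith
  have := this.laplacian_nonneg hs.contDiffAt
  rw [hs.laplacian_eq] at this
  linarith

end LaplacianCalculus

section MeanValue

theorem hasDerivAt_max_zero_sq (s : ℝ) :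
    HasDerivAt (fun s : ℝ => max 0 s ^ 2) (2 * max 0 s) s := by
  rcases lt_trichotomy s 0 with h | rfl | h
  · have : (fun s : ℝ => max 0 s ^ 2) =ᶠ[𝓝 s] fun _ => 0 := by
      filter_upwards [eventually_lt_nhds h] with t ht
      simp [max_eq_left ht.le]
    rw [max_eq_left h.le, mul_zero]
    exact (hasDerivAt_const s (0 : ℝ)).congr_of_eventuallyEq this
  · rw [hasDerivAt_iff_isLittleO_nhds_zero]
    have : (fun h : ℝ => h ^ 2) =o[𝓝 0] fun h : ℝ => h := by
      simpa using Asymptotics.isLittleO_pow_pow (𝕜 := ℝ) (m := 1) (n := 2) (by norm_num)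
    refine Asymptotics.IsBigO.trans_isLittleO (Asymptotics.IsBigO.of_bound 1 ?_) this
    refine Eventually.of_forall fun h => ?_
    simp only [zero_add, max_self, mul_zero, smul_zero, sub_zero, one_mul, norm_eq_abs]
    rw [zero_pow two_ne_zero, sub_zero, abs_of_nonneg (sq_nonneg _), abs_of_nonneg (sq_nonneg _)]
    rcases le_total h 0 with h1 | h1
    · rw [max_eq_left h1, zero_pow two_ne_zero]; positivity
    · rw [max_eq_right h1]
  · have : (fun s : ℝ => max 0 s ^ 2) =ᶠ[𝓝 s] fun s => s ^ 2 := by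
      filter_upwards [eventually_gt_nhds h] with t ht
      rw [max_eq_right ht.le]
    rw [max_eq_right h.le]
    have h2 := hasDerivAt_pow 2 s
    simp only [Nat.cast_ofNat, Nat.add_one_sub_one, pow_one] at h2
    exact h2.congr_of_eventuallyEq this

theorem HasFDerivAt.congr_of_forall {E F : Type*} [NormedAddCommGroup E] [NormedSpace ℝ E]
    [NormedAddCommGroup F] [NormedSpace ℝ F] {f : E → F} {f' g' : E →L[ℝ] F} {x : E}
    (h : HasFDerivAt f f' x) (hg : ∀ v, f' v = g' v) : HasFDerivAt f g' x :=
  (ContinuousLinearMap.ext hg : f' = g') ▸ h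

variable {V : Type*} [NormedAddCommGroup V]

/-- The quadratic cutoff `(1 - |y|²)₊²`. -/
def cutoff (y : V) : ℝ := max 0 (1 - ‖y‖ ^ 2) ^ 2

/-- The radial density of `-∇ cutoff`. -/
def cutoffDensity (y : V) : ℝ := 4 * max 0 (1 - ‖y‖ ^ 2)

theorem continuous_cutoff : Continuous (cutoff : V → ℝ) := by
  unfold cutoff; fun_prop

theorem continuous_cutoffDensity : Continuous (cutoffDensity : V → ℝ) := by
  unfold cutoffDensity; fun_prop

theorem cutoff_nonneg (y : V) : 0 ≤ cutoff y := by unfold cutoff; positivity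

theorem cutoffDensity_nonneg (y : V) : 0 ≤ cutoffDensity y := by
  unfold cutoffDensity; positivity

theorem cutoffDensity_eq_zero {y : V} (h : 1 ≤ ‖y‖) : cutoffDensity y = 0 := by
  have : 1 ≤ ‖y‖ ^ 2 := one_le_pow₀ h
  simp [cutoffDensity, this]

theorem cutoff_eq_zero {y : V} (h : 1 ≤ ‖y‖) : cutoff y = 0 := by
  have : 1 ≤ ‖y‖ ^ 2 := one_le_pow₀ h
  simp [cutoff, this]

theorem cutoffDensity_le (y : V) : cutoffDensity y ≤ 4 := by
  unfold cutoffDensity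
  have : max 0 (1 - ‖y‖ ^ 2) ≤ 1 := max_le (by norm_num) (by nlinarith [sq_nonneg ‖y‖])
  linarith

variable [InnerProductSpace ℝ V]

theorem hasFDerivAt_cutoff (y : V) :
    HasFDerivAt cutoff (-(cutoffDensity y) • innerSL ℝ y) y := by
  have h1 : HasFDerivAt (fun y : V => 1 - ‖y‖ ^ 2) (-((2 : ℝ) • innerSL ℝ y)) y :=
    ((hasStrictFDerivAt_norm_sq y).hasFDerivAt.const_sub 1).congr_of_forall fun v => by simp
  refine ((hasDerivAt_max_zero_sq (1 - ‖y‖ ^ 2)).comp_hasFDerivAt y h1).congr_of_forall fun v => ?_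
  simp only [cutoffDensity, FunLike.coe_smul, FunLike.coe_neg, Pi.smul_apply, Pi.neg_apply,
    smul_eq_mul]
  ring

variable [FiniteDimensional ℝ V]

theorem hasCompactSupport_cutoff : HasCompactSupport (cutoff : V → ℝ) :=
  HasCompactSupport.of_support_subset_isCompact (isCompact_closedBall (0 : V) 1) fun y hy => by
    by_contra h
    simp only [Metric.mem_closedBall, dist_zero_right, not_le] at h
    exact hy (cutoff_eq_zero h.le)

theorem hasCompactSupport_cutoffDensity : HasCompactSupport (cutoffDensity : V → ℝ) :=
  HasCompactSupport.of_support_subset_isCompact (isCompact_closedBall (0 : V) 1) fun y hy => by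
    by_contra h
    simp only [Metric.mem_closedBall, dist_zero_right, not_le] at h
    exact hy (cutoffDensity_eq_zero h.le)

variable [MeasurableSpace V] [BorelSpace V]

variable (V) in
theorem integral_cutoffDensity_pos : 0 < ∫ y : V, cutoffDensity y :=
  continuous_cutoffDensity.integral_pos_of_hasCompactSupport_nonneg_nonzero (x := 0)
    hasCompactSupport_cutoffDensity cutoffDensity_nonneg (by simp [cutoffDensity])

theorem integral_fderiv_mul_cutoffDensity {f : V → ℝ} (hf : ContDiff ℝ 2 f) (ρ : ℝ) :
    ∫ y, fderiv ℝ f (ρ • y) y * cutoffDensity y = ρ * ∫ y, Δ f (ρ • y) * cutoff y := by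
  set b := stdOrthonormalBasis ℝ V
  have hf1 : ContDiff ℝ 1 (fderiv ℝ f) := hf.fderiv_right (by norm_num)
  have hG : ∀ i, ContDiff ℝ 1 (fun y => fderiv ℝ f y (b i)) := fun i => hf1.clm_apply contDiff_const
  have hGd : ∀ i y, HasFDerivAt (fun y => fderiv ℝ f (ρ • y) (b i))
      (ρ • fderiv ℝ (fun y => fderiv ℝ f y (b i)) (ρ • y)) y := fun i y => by
    have h1 : HasFDerivAt (fun y : V => ρ • y) (ρ • ContinuousLinearMap.id ℝ V) y :=
      (hasFDerivAt_id y).const_smul ρ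
    exact (((hG i).differentiable (by simp) (ρ • y)).hasFDerivAt.comp y h1).congr_of_forall
      fun v => by simp
  have hmulInt : ∀ {h k : V → ℝ}, Continuous h → Continuous k → HasCompactSupport k →
      Integrable fun y => h y * k y := fun hh hk hc =>
    (hh.mul hk).integrable_of_hasCompactSupport hc.mul_left
  have hcG : ∀ i, Continuous fun y => fderiv ℝ f (ρ • y) (b i) := fun i =>
    (hG i).continuous.comp (continuous_const_smul ρ)
  have hcG' : ∀ i, Continuous fun y => fderiv ℝ (fun y => fderiv ℝ f y (b i)) (ρ • y) (b i) :=
    fun i => (((hG i).continuous_fderiv (by simp)).comp (continuous_const_smul ρ)).clm_apply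
      continuous_const
  have hibp : ∀ i, ∫ y, fderiv ℝ f (ρ • y) (b i) * (inner ℝ y (b i) * cutoffDensity y) =
      ρ * ∫ y, fderiv ℝ (fun y => fderiv ℝ f y (b i)) (ρ • y) (b i) * cutoff y := fun i => by
    have key := integral_mul_fderiv_eq_neg_fderiv_mul_of_integrable (μ := (volume : Measure V))
      (f := fun y => fderiv ℝ f (ρ • y) (b i)) (g := cutoff) (v := b i)
      (by
        simp only [(hGd i _).fderiv]
        refine hmulInt (Continuous.const_smul ?_ ρ) continuous_cutoff hasCompactSupport_cutoff
        exact hcG' i)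
      (by
        simp only [(hasFDerivAt_cutoff _).fderiv]
        have : (fun y => fderiv ℝ f (ρ • y) (b i) *
            ((-(cutoffDensity y) • innerSL ℝ y : V →L[ℝ] ℝ) (b i))) =
            fun y => (fderiv ℝ f (ρ • y) (b i) * (- inner ℝ y (b i))) * cutoffDensity y := by
          ext y; simp; ring
        rw [this]
        exact hmulInt ((hcG i).mul (by fun_prop)) continuous_cutoffDensity
          hasCompactSupport_cutoffDensity)
      (hmulInt (hcG i) continuous_cutoff hasCompactSupport_cutoff)
      (fun y _ => (hGd i y).differentiableAt) (fun y _ => (hasFDerivAt_cutoff y).differentiableAt)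
    simp only [(hGd i _).fderiv, (hasFDerivAt_cutoff _).fderiv] at key
    rw [← integral_const_mul, ← neg_inj, ← integral_neg]
    refine Eq.trans (integral_congr_ae (Eventually.of_forall fun y => ?_)) (key.trans
      (congrArg Neg.neg (integral_congr_ae (Eventually.of_forall fun y => ?_))))
    · show -(_ * (inner ℝ y (b i) * cutoffDensity y)) = _ * (-(cutoffDensity y) * inner ℝ y (b i))
      ring
    · exact mul_assoc _ _ _
  have h1 : ∀ y, fderiv ℝ f (ρ • y) y * cutoffDensity y =
      ∑ i, fderiv ℝ f (ρ • y) (b i) * (inner ℝ y (b i) * cutoffDensity y) := fun y => by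
    conv_lhs => rw [← b.sum_repr y]
    rw [b.sum_repr y]
    have : fderiv ℝ f (ρ • y) y = ∑ i, fderiv ℝ f (ρ • y) (b i) * inner ℝ y (b i) := by
      conv_lhs => rw [← b.sum_repr' y, map_sum]
      refine Finset.sum_congr rfl fun i _ => ?_
      rw [b.sum_repr' y, map_smul, smul_eq_mul, real_inner_comm, mul_comm]
    rw [this, Finset.sum_mul]
    exact Finset.sum_congr rfl fun i _ => by ring
  have h2 : ∀ y, Δ f (ρ • y) * cutoff y =
      ∑ i, fderiv ℝ (fun y => fderiv ℝ f y (b i)) (ρ • y) (b i) * cutoff y := fun y => by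
    rw [hf.contDiffAt.laplacian_eq_sum b, Finset.sum_mul]
  simp only [h1, h2]
  rw [integral_finsetSum, integral_finsetSum, Finset.mul_sum]
  · exact Finset.sum_congr rfl fun i _ => hibp i
  · exact fun i _ => hmulInt (hcG' i) continuous_cutoff hasCompactSupport_cutoff
  · intro i _
    simp only [← mul_assoc]
    exact hmulInt ((hcG i).mul (by fun_prop)) continuous_cutoffDensity hasCompactSupport_cutoffDensity

theorem hasDerivAt_integral_mul_cutoffDensity {f : V → ℝ} (hf : ContDiff ℝ 2 f)
    (hc : HasCompactSupport f) (ρ : ℝ) :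
    HasDerivAt (fun ρ : ℝ => ∫ y, f (ρ • y) * cutoffDensity y)
      (∫ y, fderiv ℝ f (ρ • y) y * cutoffDensity y) ρ := by
  have hf1 : Continuous (fderiv ℝ f) := hf.continuous_fderiv (by simp)
  obtain ⟨C, hC⟩ := (hc.fderiv (𝕜 := ℝ)).exists_bound_of_continuous hf1
  have hmulInt : ∀ {h : V → ℝ}, Continuous h → Integrable fun y => h y * cutoffDensity y := fun hh =>
    (hh.mul continuous_cutoffDensity).integrable_of_hasCompactSupport
      hasCompactSupport_cutoffDensity.mul_left
  have hcf : ∀ r : ℝ, Continuous fun y => f (r • y) := fun r =>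
    hf.continuous.comp (continuous_const_smul r)
  refine (hasDerivAt_integral_of_dominated_loc_of_deriv_le (s := Set.univ)
    (F' := fun r y => fderiv ℝ f (r • y) y * cutoffDensity y)
    (bound := fun y => (C * ‖y‖) * cutoffDensity y) univ_mem
    (Eventually.of_forall fun r => (hmulInt (hcf r)).aestronglyMeasurable) (hmulInt (hcf ρ)) ?_ ?_
    (hmulInt (by fun_prop)) ?_).2
  · exact (hmulInt ((hf1.comp (continuous_const_smul ρ)).clm_apply continuous_id)).aestronglyMeasurable
  · refine Eventually.of_forall fun y r _ => ?_
    rw [norm_mul, norm_of_nonneg (cutoffDensity_nonneg y)]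
    refine mul_le_mul_of_nonneg_right ?_ (cutoffDensity_nonneg y)
    exact ((fderiv ℝ f (r • y)).le_opNorm y).trans
      (mul_le_mul_of_nonneg_right (hC _) (norm_nonneg _))
  · refine Eventually.of_forall fun y r _ => ?_
    have h1 : HasDerivAt (fun r : ℝ => r • y) y r := by
      simpa using (hasDerivAt_id r).smul_const y
    exact (((hf.differentiable (by simp)) _).hasFDerivAt.comp_hasDerivAt r h1).mul_const _

theorem mul_integral_cutoffDensity_le {f : V → ℝ} (hf : ContDiff ℝ 2 f) (hc : HasCompactSupport f)
    {Λ : ℝ} (hΛ : ∀ y ∈ Metric.closedBall (0 : V) 1, -Λ ≤ Δ f y) :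
    f 0 * ∫ y : V, cutoffDensity y ≤
      (∫ y, f y * cutoffDensity y) + Λ / 2 * ∫ y : V, cutoff y := by
  set M : ℝ → ℝ := fun ρ => ∫ y, f (ρ • y) * cutoffDensity y with hM
  set J : ℝ := ∫ y : V, cutoff y with hJ
  have hmulInt : ∀ {h : V → ℝ}, Continuous h → Integrable fun y => h y * cutoff y := fun hh =>
    (hh.mul continuous_cutoff).integrable_of_hasCompactSupport hasCompactSupport_cutoff.mul_left
  have hlap : Continuous (Δ f) := by
    have : Δ f = fun x => ∑ i, fderiv ℝ (fun y => fderiv ℝ f y (stdOrthonormalBasis ℝ V i)) x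
        (stdOrthonormalBasis ℝ V i) := by
      ext x; exact hf.contDiffAt.laplacian_eq_sum _
    rw [this]
    refine continuous_finsetSum _ fun i _ => ?_
    have h1 : ContDiff ℝ 1 (fun y => fderiv ℝ f y (stdOrthonormalBasis ℝ V i)) :=
      (hf.fderiv_right (m := 1) (by norm_num)).clm_apply contDiff_const
    exact (h1.continuous_fderiv (by simp)).clm_apply continuous_const
  have hder : ∀ ρ, HasDerivAt (fun ρ => M ρ + Λ / 2 * J * ρ ^ 2)
      (ρ * (∫ y, Δ f (ρ • y) * cutoff y) + Λ * J * ρ) ρ := fun ρ => by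
    have h1 := hasDerivAt_integral_mul_cutoffDensity hf hc ρ
    rw [integral_fderiv_mul_cutoffDensity hf] at h1
    refine (h1.add ((hasDerivAt_pow 2 ρ).const_mul (Λ / 2 * J))).congr_deriv ?_
    simp; ring
  have hmono : MonotoneOn (fun ρ => M ρ + Λ / 2 * J * ρ ^ 2) (Set.Icc 0 1) := by
    refine monotoneOn_of_deriv_nonneg (convex_Icc 0 1)
      (fun ρ _ => (hder ρ).continuousAt.continuousWithinAt)
      (fun ρ _ => (hder ρ).differentiableAt.differentiableWithinAt) fun ρ hρ => ?_
    rw [interior_Icc] at hρ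
    rw [(hder ρ).deriv]
    have : -(Λ * J) ≤ ∫ y, Δ f (ρ • y) * cutoff y := by
      rw [← neg_mul, hJ, ← integral_const_mul]
      refine integral_mono (hmulInt continuous_const)
        (hmulInt (hlap.comp (continuous_const_smul ρ))) fun y => ?_
      rcases le_total 1 ‖y‖ with h | h
      · simp [cutoff_eq_zero h]
      · refine mul_le_mul_of_nonneg_right (hΛ _ ?_) (cutoff_nonneg y)
        rw [Metric.mem_closedBall, dist_zero_right, norm_smul, norm_of_nonneg hρ.1.le]
        exact mul_le_one₀ hρ.2.le (norm_nonneg _) h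
    nlinarith [mul_le_mul_of_nonneg_left this hρ.1.le]
  have := hmono (Set.left_mem_Icc.2 zero_le_one) (Set.right_mem_Icc.2 zero_le_one) zero_le_one
  simpa [hM, integral_const_mul] using this

theorem setIntegral_ball_comp_affine (f : V → ℝ) (x : V) {r : ℝ} (hr : 0 < r) (s : ℝ) :
    ∫ y in Metric.ball (0 : V) s, f (x + r • y) =
      (r ^ Module.finrank ℝ V)⁻¹ * ∫ y in Metric.ball x (r * s), f y := by
  rw [Measure.setIntegral_comp_smul_of_pos volume (fun y => f (x + y)) _ hr, smul_ball hr.ne',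
    smul_zero, norm_of_nonneg hr.le, smul_eq_mul]
  congr 1
  have := (measurePreserving_add_left (volume : Measure V) x).setIntegral_preimage_emb
    (MeasurableEquiv.addLeft x).measurableEmbedding f (Metric.ball x (r * s))
  rw [← this]
  congr 2
  ext y; simp

variable (V) in
/-- Mean value inequality for functions whose Laplacian is bounded below. -/
theorem exists_mean_value_const : ∃ C : ℝ, 0 < C ∧ ∀ (f : V → ℝ) (x : V) (r Λ : ℝ), 0 < r → 0 ≤ Λ →
    (∀ y ∈ Metric.closedBall x (2 * r), ContDiffAt ℝ 2 f y) →
    (∀ y ∈ Metric.closedBall x r, 0 ≤ f y) → (∀ y ∈ Metric.closedBall x r, -Λ ≤ Δ f y) →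
    f x ≤ C * ((r ^ Module.finrank ℝ V)⁻¹ * (∫ y in Metric.ball x r, f y) + Λ * r ^ 2) := by
  set I : ℝ := ∫ y : V, cutoffDensity y with hI
  set J : ℝ := ∫ y : V, cutoff y with hJ
  have hI0 : 0 < I := integral_cutoffDensity_pos V
  have hJ0 : 0 ≤ J := integral_nonneg cutoff_nonneg
  refine ⟨(4 + J) / I, by positivity, fun f x r Λ hr hΛ hf hf0 hfl => ?_⟩
  let χ : ContDiffBump (0 : V) := ⟨5 / 4, 3 / 2, by norm_num, by norm_num⟩
  set h : V → ℝ := fun y => f (r • (LinearIsometryEquiv.refl ℝ V) y + x) with hh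
  have hlap : ∀ y, ‖y‖ ≤ 2 → HasLap h y (r • (LinearIsometryEquiv.refl ℝ V).symm
      (∇ f (r • (LinearIsometryEquiv.refl ℝ V) y + x)))
      (r ^ 2 * Δ f (r • (LinearIsometryEquiv.refl ℝ V) y + x)) := fun y hy => by
    refine HasLap.comp_affine (LinearIsometryEquiv.refl ℝ V) r x (ContDiffAt.hasLap (hf _ ?_))
    simp only [LinearIsometryEquiv.coe_refl, id_eq, Metric.mem_closedBall, dist_add_self_left,
      norm_smul, norm_of_nonneg hr.le]
    nlinarith
  set F : V → ℝ := fun y => χ y * h y with hF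
  have hFh : ∀ y, ‖y‖ ≤ 1 → F =ᶠ[𝓝 y] h := fun y hy => by
    have : y ∈ Metric.ball (0 : V) χ.rIn := by
      simp only [Metric.mem_ball, dist_zero_right]; exact hy.trans_lt (by norm_num)
    filter_upwards [χ.eventuallyEq_one_of_mem_ball this] with z hz
    simp [hF, hz]
  have hFc : ContDiff ℝ 2 F := by
    rw [contDiff_iff_contDiffAt]
    intro y
    rcases lt_or_ge ‖y‖ 2 with hy | hy
    · exact χ.contDiffAt.mul (hlap y hy.le).contDiffAt
    · have : F =ᶠ[𝓝 y] fun _ => 0 := by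
        have h1 : y ∈ (Metric.closedBall (0 : V) (3 / 2))ᶜ := by
          simp only [Set.mem_compl_iff, Metric.mem_closedBall, dist_zero_right]; linarith
        filter_upwards [Metric.isClosed_closedBall.isOpen_compl.mem_nhds h1] with z hz
        simp only [Set.mem_compl_iff, Metric.mem_closedBall, not_le] at hz
        simp only [hF]
        rw [χ.zero_of_le_dist hz.le, zero_mul]
      exact contDiffAt_const.congr_of_eventuallyEq this
  have hFs : HasCompactSupport F := χ.hasCompactSupport.mul_right
  have key := mul_integral_cutoffDensity_le hFc hFs (Λ := r ^ 2 * Λ) (fun y hy => by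
    rw [Metric.mem_closedBall, dist_zero_right] at hy
    rw [(laplacian_congr_nhds (hFh y hy)).eq_of_nhds, (hlap y (by linarith)).laplacian_eq]
    have := hfl (r • (LinearIsometryEquiv.refl ℝ V) y + x) (by
      simp only [LinearIsometryEquiv.coe_refl, id_eq, Metric.mem_closedBall, dist_add_self_left,
        norm_smul, norm_of_nonneg hr.le]
      nlinarith)
    nlinarith [mul_le_mul_of_nonneg_left this (sq_nonneg r)])
  have hF0 : F 0 = f x := by
    rw [(hFh 0 (by simp)).eq_of_nhds]; simp [hh]
  have hFint : ∫ y, F y * cutoffDensity y ≤ 4 * ∫ y in Metric.ball (0 : V) 1, F y := by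
    rw [← integral_const_mul, ← integral_indicator measurableSet_ball]
    refine integral_mono ((hFc.continuous.mul continuous_cutoffDensity).integrable_of_hasCompactSupport
      hasCompactSupport_cutoffDensity.mul_left) ?_ fun y => ?_
    · exact ((continuous_const.mul hFc.continuous).integrable_of_hasCompactSupport
        hFs.mul_left).indicator measurableSet_ball
    · by_cases hy : y ∈ Metric.ball (0 : V) 1
      · rw [Set.indicator_of_mem hy]
        rw [Metric.mem_ball, dist_zero_right] at hy
        have hpos : 0 ≤ F y := by
          rw [(hFh y hy.le).eq_of_nhds]
          refine hf0 _ ?_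
          simp only [LinearIsometryEquiv.coe_refl, id_eq, Metric.mem_closedBall, dist_add_self_left,
            norm_smul, norm_of_nonneg hr.le]
          nlinarith
        show F y * cutoffDensity y ≤ 4 * F y
        nlinarith [cutoffDensity_le y]
      · rw [Set.indicator_of_notMem hy]
        rw [Metric.mem_ball, dist_zero_right, not_lt] at hy
        simp [cutoffDensity_eq_zero hy]
  have hball : ∫ y in Metric.ball (0 : V) 1, F y =
      (r ^ Module.finrank ℝ V)⁻¹ * ∫ y in Metric.ball x r, f y := by
    have haff := setIntegral_ball_comp_affine f x hr 1
    rw [mul_one] at haff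
    rw [← haff]
    refine setIntegral_congr_fun measurableSet_ball fun y hy => ?_
    rw [Metric.mem_ball, dist_zero_right] at hy
    rw [(hFh y hy.le).eq_of_nhds]
    simp [hh, add_comm]
  have hAvg : 0 ≤ (r ^ Module.finrank ℝ V)⁻¹ * ∫ y in Metric.ball x r, f y := by
    have : 0 ≤ ∫ y in Metric.ball x r, f y :=
      setIntegral_nonneg measurableSet_ball fun y hy => hf0 y (Metric.ball_subset_closedBall hy)
    positivity
  rw [hball] at hFint
  rw [hF0] at key
  set Av := (r ^ Module.finrank ℝ V)⁻¹ * ∫ y in Metric.ball x r, f y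
  rw [div_mul_eq_mul_div, le_div_iff₀ hI0]
  nlinarith [mul_nonneg hJ0 hAvg, mul_nonneg hΛ (sq_nonneg r), mul_nonneg (mul_nonneg hΛ (sq_nonneg r)) hJ0]

end MeanValue

section EpsRegularity

theorem le_add_rpow_mul_rpow {s t p : ℝ} (hs : 0 ≤ s) (ht : 0 < t) (hp : 1 ≤ p) :
    s ≤ t + t ^ (1 - p) * s ^ p := by
  rcases le_total s t with h | h
  · have : 0 ≤ t ^ (1 - p) * s ^ p := by positivity
    linarith
  · have hs' : 0 < s := ht.trans_le h
    have h1 : s ^ (1 - p) ≤ t ^ (1 - p) := rpow_le_rpow_of_nonpos ht h (by linarith)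
    have h2 : s ^ (1 - p) * s ^ p = s := by rw [← rpow_add hs']; simp
    have h3 := mul_le_mul_of_nonneg_right h1 (rpow_nonneg hs p)
    linarith

variable (V : Type*) [NormedAddCommGroup V] [InnerProductSpace ℝ V] [FiniteDimensional ℝ V]
  [MeasurableSpace V] [BorelSpace V]

set_option maxHeartbeats 1000000 in
/-- Interior smallness estimate for subsolutions of `-Δ S ≤ A (S + S^(p-1))` with small
`L^p` norm. -/
theorem exists_eps_regularity {p A : ℝ} (hp : 2 < p)
    (hd : p * ((Module.finrank ℝ V : ℝ) - 2) ≤ 2 * Module.finrank ℝ V) (hA : 0 < A) :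
    ∃ C δ : ℝ, 0 < C ∧ 0 < δ ∧ ∀ (S : V → ℝ) (z : V) (X : ℝ),
      (∀ y ∈ Metric.closedBall z (1 / 4), ContDiffAt ℝ 2 S y) →
      (∀ y ∈ Metric.closedBall z (1 / 4), 0 ≤ S y) →
      (∀ y ∈ Metric.closedBall z (1 / 4), -(A * (S y + S y ^ (p - 1))) ≤ Δ S y) →
      ∫ y in Metric.ball z (1 / 4), S y ^ p ≤ X → X ≤ δ → S z ^ p ≤ C * X := by
  obtain ⟨C₀, hC₀, hmean⟩ := exists_mean_value_const V
  set d := Module.finrank ℝ V with hd_def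
  set m : ℝ := 2 ^ ((d : ℝ) / p) with hm
  have hp0 : 0 < p := by linarith
  have hm1 : 1 ≤ m := one_le_rpow (by norm_num) (by positivity)
  have hmp : m ^ p = 2 ^ d := by
    rw [hm, ← rpow_mul (by norm_num), div_mul_cancel₀ _ hp0.ne', rpow_natCast]
  set ω : ℝ := (volume : Measure V).real (Metric.ball 0 1) with hω
  have hω0 : 0 < ω := by
    rw [hω, measureReal_def]
    exact ENNReal.toReal_pos (Metric.measure_ball_pos _ _ one_pos).ne' measure_ball_lt_top.ne
  set B : ℝ := C₀ * (2 * A * m ^ (p - 1)) with hB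
  have hB0 : 0 < B := by positivity
  set θ : ℝ := min 1 (1 / (4 * B)) with hθ
  have hθ0 : 0 < θ := lt_min one_pos (by positivity)
  have hθ1 : θ ≤ 1 := min_le_left _ _
  have hθB : B * θ ^ 2 ≤ 1 / 4 := by
    have h1 : θ ≤ 1 / (4 * B) := min_le_right _ _
    rw [le_div_iff₀ (by positivity)] at h1
    nlinarith
  set η : ℝ := 1 / (4 * C₀ * ω) with hη
  have hη0 : 0 < η := by positivity
  have hηe : C₀ * η * ω = 1 / 4 := by rw [hη]; field_simp
  set C₁ : ℝ := 2 * C₀ * η ^ (1 - p) with hC₁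
  have hC₁0 : 0 < C₁ := by positivity
  refine ⟨4 ^ d * (2 ^ d * ((θ ^ d)⁻¹ * C₁)), θ ^ d / (2 * C₁), by positivity, by positivity,
    fun S z X hS hS0 hSl hX hXδ => ?_⟩
  have hScont : ContinuousOn S (Metric.closedBall z (1 / 4)) :=
    fun y hy => (hS y hy).continuousAt.continuousWithinAt
  have hSp : ContinuousOn (fun y => S y ^ p) (Metric.closedBall z (1 / 4)) :=
    hScont.rpow_const fun y _ => Or.inr hp0.le
  have hX0 : 0 ≤ X := le_trans (setIntegral_nonneg measurableSet_ball fun y hy =>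
    rpow_nonneg (hS0 y (Metric.ball_subset_closedBall hy)) p) hX
  have hz : z ∈ Metric.closedBall z (1 / 4) := Metric.mem_closedBall_self (by norm_num)
  obtain ⟨y₁, hy₁, hmax⟩ := (isCompact_closedBall z (1 / 4)).exists_isMaxOn ⟨z, hz⟩
    (f := fun y => (1 / 4 - dist y z) ^ d * S y ^ p)
    ((by fun_prop : ContinuousOn (fun y => (1 / 4 - dist y z) ^ d) _).mul hSp)
  have hmz : (1 / 4 : ℝ) ^ d * S z ^ p ≤ (1 / 4 - dist y₁ z) ^ d * S y₁ ^ p := by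
    have := hmax hz
    simpa using this
  set D : ℝ := 1 / 4 - dist y₁ z with hD
  set K : ℝ := S y₁ with hK
  have hD4 : D ≤ 1 / 4 := by have := dist_nonneg (x := y₁) (y := z); linarith
  suffices hgoal : D ^ d * K ^ p ≤ 2 ^ d * ((θ ^ d)⁻¹ * C₁) * X by
    have h4 : (4 : ℝ) ^ d * (1 / 4) ^ d = 1 := by rw [← mul_pow]; norm_num
    calc S z ^ p = 4 ^ d * ((1 / 4) ^ d * S z ^ p) := by rw [← mul_assoc, h4, one_mul]
      _ ≤ 4 ^ d * (2 ^ d * ((θ ^ d)⁻¹ * C₁) * X) :=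
          mul_le_mul_of_nonneg_left (hmz.trans hgoal) (by positivity)
      _ = _ := by ring
  rcases (show 0 ≤ D by rw [Metric.mem_closedBall] at hy₁; linarith).eq_or_lt with hD0 | hD0
  · rw [← hD0]
    have : (0 : ℝ) ^ d * K ^ p ≤ 0 := by
      rcases Nat.eq_zero_or_pos d with h | h
      · exfalso
        have hsub : Subsingleton V := Module.finrank_zero_iff.1 h
        rw [Subsingleton.elim y₁ z, dist_self] at hD
        linarith
      · simp [h.ne']
    exact this.trans (by positivity)
  rcases (hS0 y₁ hy₁).eq_or_lt with hK0 | hK0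
  · rw [hK, ← hK0, zero_rpow hp0.ne', mul_zero]; positivity
  change 0 < K at hK0
  set ρ : ℝ := D / 2 with hρ
  have hρ0 : 0 < ρ := by positivity
  set r : ℝ := θ * min ρ (K ^ (-((p - 2) / 2))) with hr
  have hmin0 : 0 < min ρ (K ^ (-((p - 2) / 2))) := lt_min hρ0 (by positivity)
  have hr0 : 0 < r := mul_pos hθ0 hmin0
  have hrρ : r ≤ ρ := (mul_le_of_le_one_left hmin0.le hθ1).trans (min_le_left _ _)
  have hsub : Metric.closedBall y₁ (2 * r) ⊆ Metric.closedBall z (1 / 4) :=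
    Metric.closedBall_subset_closedBall' (by linarith)
  have hsub' : Metric.closedBall y₁ r ⊆ Metric.closedBall z (1 / 4) :=
    (Metric.closedBall_subset_closedBall (by linarith)).trans hsub
  have hball : Metric.ball y₁ r ⊆ Metric.ball z (1 / 4) :=
    Metric.ball_subset_ball' (by linarith)
  have hSm : ∀ y ∈ Metric.closedBall y₁ r, S y ≤ m * K := fun y hy => by
    have h1 := hmax (hsub' hy)
    simp only [Set.mem_ofPred_eq] at h1
    have h2 : ρ ≤ 1 / 4 - dist y z := by
      have := dist_triangle y y₁ z
      rw [Metric.mem_closedBall] at hy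
      linarith
    have h3 : ρ ^ d * S y ^ p ≤ ρ ^ d * (m * K) ^ p := by
      calc ρ ^ d * S y ^ p ≤ (1 / 4 - dist y z) ^ d * S y ^ p := by
            have := rpow_nonneg (hS0 y (hsub' hy)) p
            gcongr
        _ ≤ D ^ d * K ^ p := h1
        _ = ρ ^ d * (m * K) ^ p := by
            rw [mul_rpow (by positivity) hK0.le, hmp, ← mul_assoc, ← mul_pow]
            congr 2; rw [hρ]; ring
    exact (rpow_le_rpow_iff (hS0 y (hsub' hy)) (by positivity) hp0).1
      (le_of_mul_le_mul_left h3 (by positivity))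
  set Λ : ℝ := A * m ^ (p - 1) * (K * (1 + K ^ (p - 2))) with hΛ
  have hKp : K * K ^ (p - 2) = K ^ (p - 1) := by
    rw [← rpow_one_add' hK0.le (by linarith)]; congr 1; ring
  have hlow : ∀ y ∈ Metric.closedBall y₁ r, -Λ ≤ Δ S y := fun y hy => by
    refine le_trans (neg_le_neg ?_) (hSl y (hsub' hy))
    have h1 : S y ^ (p - 1) ≤ (m * K) ^ (p - 1) :=
      rpow_le_rpow (hS0 y (hsub' hy)) (hSm y hy) (by linarith)
    rw [mul_rpow (by positivity) hK0.le] at h1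
    have h2 : m ≤ m ^ (p - 1) := by
      simpa using rpow_le_rpow_of_exponent_le hm1 (show 1 ≤ p - 1 by linarith)
    have h3 := hSm y hy
    calc A * (S y + S y ^ (p - 1)) ≤ A * (m ^ (p - 1) * K + m ^ (p - 1) * K ^ (p - 1)) := by
          gcongr; exact h3.trans (by gcongr)
      _ = Λ := by rw [hΛ, ← hKp]; ring
  have hmv := hmean S y₁ r Λ hr0 (by positivity) (fun y hy => hS y (hsub hy))
    (fun y hy => hS0 y (hsub' hy)) hlow
  change K ≤ _ at hmv
  have hr2 : (1 + K ^ (p - 2)) * r ^ 2 ≤ 2 * θ ^ 2 := by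
    have h1 : min ρ (K ^ (-((p - 2) / 2))) ^ 2 ≤ 1 := by
      have : min ρ (K ^ (-((p - 2) / 2))) ≤ 1 := (min_le_left _ _).trans (by linarith)
      exact pow_le_one₀ hmin0.le this
    have h2 : K ^ (p - 2) * min ρ (K ^ (-((p - 2) / 2))) ^ 2 ≤ 1 := by
      calc _ ≤ K ^ (p - 2) * (K ^ (-((p - 2) / 2))) ^ 2 := by gcongr; exact min_le_right _ _
        _ = 1 := by
          rw [← rpow_natCast, ← rpow_mul hK0.le, ← rpow_add hK0]
          have : p - 2 + -((p - 2) / 2) * ((2 : ℕ) : ℝ) = 0 := by push_cast; ring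
          rw [this, rpow_zero]
    calc _ = θ ^ 2 * (min ρ (K ^ (-((p - 2) / 2))) ^ 2 +
          K ^ (p - 2) * min ρ (K ^ (-((p - 2) / 2))) ^ 2) := by rw [hr]; ring
      _ ≤ θ ^ 2 * (1 + 1) := mul_le_mul_of_nonneg_left (add_le_add h1 h2) (sq_nonneg θ)
      _ = 2 * θ ^ 2 := by ring
  have hΛr : C₀ * (Λ * r ^ 2) ≤ K / 4 := by
    have : C₀ * (Λ * r ^ 2) = C₀ * A * m ^ (p - 1) * K * ((1 + K ^ (p - 2)) * r ^ 2) := by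
      rw [hΛ]; ring
    rw [this]
    calc _ ≤ C₀ * A * m ^ (p - 1) * K * (2 * θ ^ 2) := by gcongr
      _ = B * θ ^ 2 * K := by rw [hB]; ring
      _ ≤ 1 / 4 * K := by gcongr
      _ = K / 4 := by ring
  have hintS : ∫ y in Metric.ball y₁ r, S y ≤ η * K * (ω * r ^ d) + (η * K) ^ (1 - p) * X := by
    have hfin : IntegrableOn (fun y => S y ^ p) (Metric.ball z (1 / 4)) :=
      (hSp.integrableOn_compact (isCompact_closedBall z _)).mono_set Metric.ball_subset_closedBall
    have hfr : IntegrableOn (fun y => S y ^ p) (Metric.ball y₁ r) := hfin.mono_set hball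
    have hconst : Integrable (fun _ : V => η * K) (volume.restrict (Metric.ball y₁ r)) :=
      integrableOn_const measure_ball_lt_top.ne
    have hvol : (volume : Measure V).real (Metric.ball y₁ r) = ω * r ^ d := by
      rw [measureReal_def, Measure.addHaar_ball_of_pos _ _ hr0, ENNReal.toReal_mul,
        ENNReal.toReal_ofReal (by positivity), hω, measureReal_def, mul_comm]
    calc ∫ y in Metric.ball y₁ r, S y
        ≤ ∫ y in Metric.ball y₁ r, (η * K + (η * K) ^ (1 - p) * S y ^ p) := by
          refine setIntegral_mono_on ?_ ?_ measurableSet_ball fun y hy => ?_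
          · exact ((hScont.mono hsub').integrableOn_compact (isCompact_closedBall y₁ r)).mono_set
              Metric.ball_subset_closedBall
          · exact hconst.add (hfr.const_mul _)
          · exact le_add_rpow_mul_rpow (hS0 y (hsub' (Metric.ball_subset_closedBall hy)))
              (by positivity) (by linarith)
      _ = η * K * (ω * r ^ d) + (η * K) ^ (1 - p) * ∫ y in Metric.ball y₁ r, S y ^ p := by
          rw [integral_add hconst (hfr.const_mul _), integral_const_mul (_ ^ (1 - p)),
            setIntegral_const, smul_eq_mul, hvol, mul_comm (ω * r ^ d)]
      _ ≤ _ := by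
          gcongr
          refine le_trans (setIntegral_mono_set hfin ?_ hball.eventuallyLE) hX
          exact (ae_restrict_mem measurableSet_ball).mono fun y hy =>
            rpow_nonneg (hS0 y (Metric.ball_subset_closedBall hy)) p
  have hrd : 0 < r ^ d := by positivity
  have hmain : r ^ d * K ^ p ≤ C₁ * X := by
    have h1 : C₀ * ((r ^ d)⁻¹ * ∫ y in Metric.ball y₁ r, S y) ≤
        K / 4 + C₀ * ((r ^ d)⁻¹ * ((η * K) ^ (1 - p) * X)) := by
      calc _ ≤ C₀ * ((r ^ d)⁻¹ * (η * K * (ω * r ^ d) + (η * K) ^ (1 - p) * X)) := by gcongr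
        _ = (C₀ * η * ω) * K * ((r ^ d)⁻¹ * r ^ d) + C₀ * ((r ^ d)⁻¹ * ((η * K) ^ (1 - p) * X)) := by
          ring
        _ = _ := by rw [hηe, inv_mul_cancel₀ hrd.ne']; ring
    have h2 : K / 2 ≤ C₀ * ((r ^ d)⁻¹ * ((η * K) ^ (1 - p) * X)) := by
      rw [mul_add] at hmv; linarith
    have h3 : K ^ (p - 1) * r ^ d * (K / 2) ≤
        K ^ (p - 1) * r ^ d * (C₀ * ((r ^ d)⁻¹ * ((η * K) ^ (1 - p) * X))) := by gcongr
    have h4 : K ^ (p - 1) * K ^ (1 - p) = 1 := by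
      rw [← rpow_add hK0]; simp
    have h5 : K ^ (p - 1) * K = K ^ p := by
      rw [← rpow_add_one hK0.ne']; simp
    rw [mul_rpow hη0.le hK0.le] at h3
    have h6 : K ^ (p - 1) * r ^ d * (C₀ * ((r ^ d)⁻¹ * (η ^ (1 - p) * K ^ (1 - p) * X))) =
        C₀ * η ^ (1 - p) * X * (K ^ (p - 1) * K ^ (1 - p)) * (r ^ d * (r ^ d)⁻¹) := by ring
    rw [h6, h4, mul_inv_cancel₀ hrd.ne', mul_one, mul_one] at h3
    have h7 : r ^ d * K ^ p = 2 * (K ^ (p - 1) * r ^ d * (K / 2)) := by rw [← h5]; ring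
    rw [hC₁, h7]
    linarith
  rcases le_total ρ (K ^ (-((p - 2) / 2))) with hcase | hcase
  · rw [hr, min_eq_left hcase, mul_pow] at hmain
    have : D ^ d * K ^ p = 2 ^ d * ((θ ^ d)⁻¹ * (θ ^ d * ρ ^ d * K ^ p)) := by
      rw [hρ, div_pow]; field_simp
    calc D ^ d * K ^ p = 2 ^ d * ((θ ^ d)⁻¹ * (θ ^ d * ρ ^ d * K ^ p)) := this
      _ ≤ 2 ^ d * ((θ ^ d)⁻¹ * (C₁ * X)) := by gcongr
      _ = _ := by ring
  · exfalso
    rw [hr, min_eq_right hcase, mul_pow, mul_assoc] at hmain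
    have hK1 : 1 ≤ K := by
      by_contra! hlt
      have : 1 ≤ K ^ (-((p - 2) / 2)) :=
        one_le_rpow_of_pos_of_le_one_of_nonpos hK0 hlt.le (by linarith)
      linarith
    have h1 : 1 ≤ (K ^ (-((p - 2) / 2))) ^ d * K ^ p := by
      rw [← rpow_natCast, ← rpow_mul hK0.le, ← rpow_add hK0]
      refine one_le_rpow hK1 ?_
      linarith
    have h2 : θ ^ d ≤ C₁ * X := (le_mul_of_one_le_right (by positivity) h1).trans hmain
    have h3 : C₁ * X ≤ θ ^ d / 2 := by
      calc C₁ * X ≤ C₁ * (θ ^ d / (2 * C₁)) := by gcongr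
        _ = θ ^ d / 2 := by field_simp
    have : 0 < θ ^ d := by positivity
    linarith

end EpsRegularity

section EnergyEstimate

theorem continuous_of_continuousOn_tsupport {V : Type*} [TopologicalSpace V] {g h : V → ℝ} (hg : Continuous g)
    (hh : ∀ x ∈ tsupport g, ContinuousAt h x) : Continuous fun x => h x * g x := by
  rw [continuous_iff_continuousAt]
  intro x
  by_cases hx : x ∈ tsupport g
  · exact (hh x hx).mul hg.continuousAt
  · have : (fun x => h x * g x) =ᶠ[𝓝 x] fun _ => 0 := by
      filter_upwards [(isClosed_tsupport g).isOpen_compl.mem_nhds hx] with y hy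
      rw [image_eq_zero_of_notMem_tsupport hy, mul_zero]
    exact continuousAt_const.congr this.symm

theorem exists_annulus_cutoff (V : Type*) [NormedAddCommGroup V] [InnerProductSpace ℝ V]
    [FiniteDimensional ℝ V] : ∃ ψ : V → ℝ, ContDiff ℝ 2 ψ ∧ HasCompactSupport ψ ∧
    (∀ x, 0 ≤ ψ x ∧ ψ x ≤ 1) ∧ (∀ x, 3 / 4 ≤ ‖x‖ → ‖x‖ ≤ 5 / 4 → ψ x = 1) ∧
    tsupport ψ ⊆ {x | 1 / 2 ≤ ‖x‖ ∧ ‖x‖ ≤ 2} := by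
  let χ₁ : ContDiffBump (0 : V) := ⟨5 / 4, 2, by norm_num, by norm_num⟩
  let χ₂ : ContDiffBump (0 : V) := ⟨1 / 2, 3 / 4, by norm_num, by norm_num⟩
  have hsub : Function.support (fun x => χ₁ x - χ₂ x) ⊆ {x | 1 / 2 ≤ ‖x‖ ∧ ‖x‖ ≤ 2} := by
    intro x hx
    by_contra hcon
    refine hx ?_
    simp only [Set.mem_ofPred_eq, not_and_or, not_le] at hcon
    rcases hcon with h | h
    · have h1 : χ₁ x = 1 := χ₁.one_of_mem_closedBall (by
        rw [Metric.mem_closedBall, dist_zero_right]; exact h.le.trans (by norm_num [χ₁]))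
      have h2 : χ₂ x = 1 := χ₂.one_of_mem_closedBall (by
        rw [Metric.mem_closedBall, dist_zero_right]; exact h.le)
      simp only [h1, h2, sub_self]
    · have h1 : χ₁ x = 0 := χ₁.zero_of_le_dist (by rw [dist_zero_right]; exact h.le)
      have h2 : χ₂ x = 0 := χ₂.zero_of_le_dist (by
        rw [dist_zero_right]; exact le_trans (by norm_num [χ₂]) h.le)
      simp only [h1, h2, sub_self]
  have hcl : IsClosed {x : V | 1 / 2 ≤ ‖x‖ ∧ ‖x‖ ≤ 2} :=
    (isClosed_le continuous_const continuous_norm).inter (isClosed_le continuous_norm continuous_const)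
  refine ⟨fun x => χ₁ x - χ₂ x, χ₁.contDiff.sub χ₂.contDiff,
    χ₁.hasCompactSupport.sub χ₂.hasCompactSupport, fun x => ⟨?_, ?_⟩, fun x h1 h2 => ?_,
    closure_minimal hsub hcl⟩
  · change 0 ≤ χ₁ x - χ₂ x
    rcases le_total ‖x‖ (5 / 4) with h | h
    · have h1 : χ₁ x = 1 := χ₁.one_of_mem_closedBall (by
        rw [Metric.mem_closedBall, dist_zero_right]; exact h)
      rw [h1]; linarith [χ₂.le_one (x := x)]
    · have h2 : χ₂ x = 0 := χ₂.zero_of_le_dist (by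
        rw [dist_zero_right]; exact le_trans (by norm_num [χ₂]) h)
      rw [h2]; linarith [χ₁.nonneg (x := x)]
  · change χ₁ x - χ₂ x ≤ 1
    linarith [χ₁.le_one (x := x), χ₂.nonneg (x := x)]
  · have h3 : χ₁ x = 1 := χ₁.one_of_mem_closedBall (by
      rw [Metric.mem_closedBall, dist_zero_right]; exact h2)
    have h4 : χ₂ x = 0 := χ₂.zero_of_le_dist (by rw [dist_zero_right]; exact h1)
    simp only [h3, h4, sub_zero]

variable {V : Type*} [NormedAddCommGroup V] [InnerProductSpace ℝ V] [FiniteDimensional ℝ V]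
  [MeasurableSpace V] [BorelSpace V]

theorem integrable_mul_of_continuousAt_tsupport {g h : V → ℝ} (hg : Continuous g)
    (hc : HasCompactSupport g) (hh : ∀ x ∈ tsupport g, ContinuousAt h x) :
    Integrable fun x => h x * g x :=
  (continuous_of_continuousOn_tsupport hg hh).integrable_of_hasCompactSupport hc.mul_left

/-- Green's identity for the weighted divergence-form operator. -/
theorem integral_weight_inner_gradient {ω u g : V → ℝ} (hg : ContDiff ℝ 1 g)
    (hc : HasCompactSupport g) (hω : ∀ x ∈ tsupport g, ContDiffAt ℝ 2 ω x)
    (hu : ∀ x ∈ tsupport g, ContDiffAt ℝ 2 u x) :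
    ∫ x, ω x * inner ℝ (∇ u x) (∇ g x) =
      -∫ x, (ω x * Δ u x + inner ℝ (∇ ω x) (∇ u x)) * g x := by
  set b := stdOrthonormalBasis ℝ V
  have hgc : ∀ i, Continuous fun x => fderiv ℝ g x (b i) := fun i =>
    (hg.continuous_fderiv (by simp)).clm_apply continuous_const
  have hgs : ∀ i, HasCompactSupport fun x => fderiv ℝ g x (b i) := fun i => by
    exact hc.fderiv_apply (𝕜 := ℝ) (b i)
  have hgt : ∀ i, tsupport (fun x => fderiv ℝ g x (b i)) ⊆ tsupport g := fun i =>
    tsupport_fderiv_apply_subset ℝ (b i)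
  have hder : ∀ i, ∀ x ∈ tsupport g, HasFDerivAt (fun x => ω x * fderiv ℝ u x (b i))
      (ω x • fderiv ℝ (fun y => fderiv ℝ u y (b i)) x + fderiv ℝ u x (b i) • fderiv ℝ ω x) x :=
    fun i x hx =>
      ((hω x hx).differentiableAt (by simp)).hasFDerivAt.mul
        ((hu x hx).differentiableAt_fderiv_apply (b i)).hasFDerivAt
  have hcu : ∀ i, ∀ x ∈ tsupport g, ContinuousAt (fun x => fderiv ℝ u x (b i)) x := fun i x hx =>
    ((hu x hx).differentiableAt_fderiv_apply (b i)).continuousAt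
  have hcω : ∀ x ∈ tsupport g, ContinuousAt ω x := fun x hx => (hω x hx).continuousAt
  have hcω' : ∀ i, ∀ x ∈ tsupport g, ContinuousAt (fun x => fderiv ℝ ω x (b i)) x := fun i x hx =>
    ((hω x hx).differentiableAt_fderiv_apply (b i)).continuousAt
  have hcu' : ∀ i, ∀ x ∈ tsupport g,
      ContinuousAt (fun x => fderiv ℝ (fun y => fderiv ℝ u y (b i)) x (b i)) x := fun i x hx => by
    have h1 : ContDiffAt ℝ 1 (fun y => fderiv ℝ u y (b i)) x :=
      ((hu x hx).fderiv_right (m := 1) (by norm_num)).clm_apply contDiffAt_const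
    have h2 : ContDiffAt ℝ 0 (fderiv ℝ fun y => fderiv ℝ u y (b i)) x :=
      h1.fderiv_right (by norm_num)
    exact h2.continuousAt.clm_apply continuousAt_const
  have hI1 : ∀ i, Integrable fun x => (ω x * fderiv ℝ u x (b i)) * fderiv ℝ g x (b i) := fun i =>
    integrable_mul_of_continuousAt_tsupport (hgc i) (hgs i) fun x hx =>
      (hcω x (hgt i hx)).mul (hcu i x (hgt i hx))
  have hI2 : ∀ i, Integrable fun x => (ω x * fderiv ℝ (fun y => fderiv ℝ u y (b i)) x (b i) +
      fderiv ℝ ω x (b i) * fderiv ℝ u x (b i)) * g x := fun i =>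
    integrable_mul_of_continuousAt_tsupport hg.continuous hc fun x hx =>
      ((hcω x hx).mul (hcu' i x hx)).add ((hcω' i x hx).mul (hcu i x hx))
  have heq : ∀ i, (fun x => fderiv ℝ (fun x => ω x * fderiv ℝ u x (b i)) x (b i) * g x) =
      fun x => (ω x * fderiv ℝ (fun y => fderiv ℝ u y (b i)) x (b i) +
        fderiv ℝ ω x (b i) * fderiv ℝ u x (b i)) * g x := fun i => by
    ext x
    by_cases hx : x ∈ tsupport g
    · rw [(hder i x hx).fderiv]
      show (ω x * fderiv ℝ (fun y => fderiv ℝ u y (b i)) x (b i) +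
        fderiv ℝ u x (b i) * fderiv ℝ ω x (b i)) * g x = _
      ring
    · rw [image_eq_zero_of_notMem_tsupport hx, mul_zero, mul_zero]
  have hibp : ∀ i, ∫ x, (ω x * fderiv ℝ u x (b i)) * fderiv ℝ g x (b i) =
      -∫ x, (ω x * fderiv ℝ (fun y => fderiv ℝ u y (b i)) x (b i) +
        fderiv ℝ ω x (b i) * fderiv ℝ u x (b i)) * g x := fun i => by
    rw [integral_mul_fderiv_eq_neg_fderiv_mul_of_integrable (by rw [heq i]; exact hI2 i) (hI1 i)
      (integrable_mul_of_continuousAt_tsupport hg.continuous hc fun x hx =>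
        (hcω x hx).mul (hcu i x hx)) (fun x hx => (hder i x hx).differentiableAt)
      (fun x _ => (hg.differentiable (by simp)) x), heq i]
  have h1 : (fun x => ω x * inner ℝ (∇ u x) (∇ g x)) =
      fun x => ∑ i, (ω x * fderiv ℝ u x (b i)) * fderiv ℝ g x (b i) := by
    ext x
    rw [inner_gradient_eq_sum b, Finset.mul_sum]
    exact Finset.sum_congr rfl fun i _ => by ring
  have h2 : (fun x => (ω x * Δ u x + inner ℝ (∇ ω x) (∇ u x)) * g x) =
      fun x => ∑ i, (ω x * fderiv ℝ (fun y => fderiv ℝ u y (b i)) x (b i) +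
        fderiv ℝ ω x (b i) * fderiv ℝ u x (b i)) * g x := by
    ext x
    by_cases hx : x ∈ tsupport g
    · rw [inner_gradient_eq_sum b, (hu x hx).laplacian_eq_sum b, Finset.mul_sum,
        ← Finset.sum_add_distrib, Finset.sum_mul]
    · simp [image_eq_zero_of_notMem_tsupport hx]
  rw [h1, h2, integral_finsetSum _ fun i _ => hI1 i, integral_finsetSum _ fun i _ => hI2 i,
    ← Finset.sum_neg_distrib]
  exact Finset.sum_congr rfl fun i _ => hibp i

end EnergyEstimate

section EnergyThreshold

variable {V : Type*} [NormedAddCommGroup V] [InnerProductSpace ℝ V] [FiniteDimensional ℝ V]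

theorem ContDiffAt.continuousAt_gradient {u : V → ℝ} {x : V} (hu : ContDiffAt ℝ 2 u x) :
    ContinuousAt (∇ u) x :=
  (toDual ℝ V).symm.continuous.continuousAt.comp
    (hu.fderiv_right (m := 1) (by norm_num)).continuousAt

theorem ContDiffAt.continuousAt_laplacian {u : V → ℝ} {x : V} (hu : ContDiffAt ℝ 2 u x) :
    ContinuousAt (Δ u) x := by
  set b := stdOrthonormalBasis ℝ V
  have h : (fun y => ∑ i, fderiv ℝ (fun y => fderiv ℝ u y (b i)) y (b i)) =ᶠ[𝓝 x] Δ u :=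
    (hu.eventually (by simp)).mono fun y hy => (hy.laplacian_eq_sum b).symm
  refine ContinuousAt.congr (tendsto_finsetSum _ fun i _ => ?_) h
  have h1 : ContDiffAt ℝ 1 (fun y => fderiv ℝ u y (b i)) x :=
    ((hu.fderiv_right (m := 1) (by norm_num)).clm_apply contDiffAt_const)
  have h2 : ContDiffAt ℝ 0 (fderiv ℝ fun y => fderiv ℝ u y (b i)) x :=
    h1.fderiv_right (by norm_num)
  exact h2.continuousAt.clm_apply continuousAt_const

theorem isCompact_annulus (r s : ℝ) : IsCompact {x : V | r ≤ ‖x‖ ∧ ‖x‖ ≤ s} :=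
  (isCompact_closedBall (0 : V) s).of_isClosed_subset
    ((isClosed_le continuous_const continuous_norm).inter
      (isClosed_le continuous_norm continuous_const)) fun x hx => by
    rw [Metric.mem_closedBall, dist_zero_right]; exact hx.2

theorem energy_pointwise {w ψ u D Q δ p I : ℝ} (hw : 0 ≤ w) (hψ : 0 ≤ ψ) (hψ1 : ψ ≤ 1) (hu : 0 < u)
    (hδ : 0 < δ) (hp : 2 < p) (hI : I ≤ D * Q) :
    w * (ψ ^ 2 * D ^ 2 + 2 * ψ * u * I) ≤
      (1 + 1 / δ) * (w * D ^ 2) + δ * Q ^ 2 * (w * u ^ p * ψ ^ 2 + w * ψ ^ 2) := by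
  have h1 : u ^ 2 ≤ u ^ p + 1 := by
    rcases le_total u 1 with h | h
    · have : u ^ 2 ≤ 1 := pow_le_one₀ hu.le h
      have : 0 < u ^ p := by positivity
      linarith
    · have : u ^ (2 : ℝ) ≤ u ^ p := rpow_le_rpow_of_exponent_le h hp.le
      rw [rpow_two] at this; linarith
  have h2 : ψ ^ 2 * D ^ 2 ≤ D ^ 2 := mul_le_of_le_one_left (sq_nonneg _) (pow_le_one₀ hψ hψ1)
  have h3 : 2 * ψ * u * I ≤ 2 * ψ * u * (D * Q) := by gcongr
  have h4 : 2 * ψ * u * (D * Q) ≤ 1 / δ * D ^ 2 + δ * Q ^ 2 * (ψ ^ 2 * u ^ 2) := by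
    have h : 0 ≤ 1 / δ * (D - δ * Q * ψ * u) ^ 2 := by positivity
    have h' : 1 / δ * (D - δ * Q * ψ * u) ^ 2 =
        1 / δ * D ^ 2 - 2 * ψ * u * (D * Q) + δ * Q ^ 2 * (ψ ^ 2 * u ^ 2) := by field_simp; ring
    linarith
  have h5 : δ * Q ^ 2 * (ψ ^ 2 * u ^ 2) ≤ δ * Q ^ 2 * (ψ ^ 2 * (u ^ p + 1)) := by gcongr
  calc w * (ψ ^ 2 * D ^ 2 + 2 * ψ * u * I)
      ≤ w * (D ^ 2 + (1 / δ * D ^ 2 + δ * Q ^ 2 * (ψ ^ 2 * (u ^ p + 1)))) := by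
        gcongr; linarith
    _ = _ := by ring

variable [MeasurableSpace V] [BorelSpace V]

variable (V) in
theorem exists_energy_threshold {a k p ε : ℝ} (ha : 0 ≤ a) (hk : 0 < k) (hp : 2 < p) (hε : 0 < ε) :
    ∃ η : ℝ, 0 < η ∧ ∀ u : V → ℝ, (∀ x ≠ 0, ContDiffAt ℝ 2 u x) → (∀ x ≠ 0, 0 < u x) →
      (∀ x, 1 / 2 ≤ ‖x‖ → ‖x‖ ≤ 2 →
        k * u x ^ p ≤ -(Δ u x - 2 * a * inner ℝ x (∇ u x) / ‖x‖ ^ 2) * u x) →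
      ∫ x in {x : V | 1 / 2 ≤ ‖x‖ ∧ ‖x‖ ≤ 2}, ‖x‖ ^ (-(2 * a)) * ‖∇ u x‖ ^ 2 ≤ η →
      ∫ x in {x : V | 3 / 4 ≤ ‖x‖ ∧ ‖x‖ ≤ 5 / 4}, u x ^ p ≤ ε := by
  obtain ⟨ψ, hψ, hψc, hψ01, hψ1, hψs⟩ := exists_annulus_cutoff V
  have hψe : ∀ x, x ∉ {x : V | 1 / 2 ≤ ‖x‖ ∧ ‖x‖ ≤ 2} → ψ x = 0 := fun x hx =>
    image_eq_zero_of_notMem_tsupport fun h => hx (hψs h)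
  have hne : ∀ x ∈ {x : V | 1 / 2 ≤ ‖x‖ ∧ ‖x‖ ≤ 2}, x ≠ 0 := fun x hx h => by
    have := hx.1
    rw [h, norm_zero] at this; norm_num at this
  set ω : V → ℝ := fun x => ‖x‖ ^ (-(2 * a)) with hωdef
  have hωL : ∀ x ≠ 0, HasLap ω x _ _ := fun x hx => hasLap_norm_rpow (-(2 * a)) hx
  have hω0 : ∀ x, 0 ≤ ω x := fun x => by positivity
  obtain ⟨Q, hQ⟩ : ∃ Q : ℝ, ∀ x, ‖∇ ψ x‖ ≤ Q := by
    have hcont : Continuous (fderiv ℝ ψ) := hψ.continuous_fderiv (by simp)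
    obtain ⟨Q, hQ⟩ := hcont.bounded_above_of_compact_support (hψc.fderiv (𝕜 := ℝ))
    exact ⟨Q, fun x => by simpa [gradient] using hQ x⟩
  set c₁ : ℝ := 2 ^ (-(2 * a)) with hc₁
  have hc₁0 : 0 < c₁ := by positivity
  have hωc : ∀ x ∈ {x : V | 1 / 2 ≤ ‖x‖ ∧ ‖x‖ ≤ 2}, c₁ ≤ ω x := fun x hx =>
    rpow_le_rpow_of_nonpos (norm_pos_iff.2 (hne x hx)) hx.2 (by linarith)
  have hψ2 : Continuous fun x => ψ x ^ 2 := hψ.continuous.pow 2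
  have hψ2c : HasCompactSupport fun x => ψ x ^ 2 := by
    have : (fun x => ψ x ^ 2) = fun x => ψ x * ψ x := by ext x; ring
    rw [this]; exact hψc.mul_left
  have hψ2s : tsupport (fun x => ψ x ^ 2) ⊆ tsupport ψ := closure_mono fun x hx h => hx (by
    simp [h])
  have hInt : ∀ h : V → ℝ, (∀ x ≠ 0, ContinuousAt h x) → Integrable fun x => h x * ψ x ^ 2 :=
    fun h hh => integrable_mul_of_continuousAt_tsupport hψ2 hψ2c fun x hx =>
      hh x (hne x (hψs (hψ2s hx)))
  have hωcont : ∀ x ≠ 0, ContinuousAt ω x := fun x hx => (hωL x hx).contDiffAt.continuousAt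
  set N : ℝ := ∫ x, ω x * ψ x ^ 2
  have hN : 0 ≤ N := integral_nonneg fun x => mul_nonneg (hω0 x) (sq_nonneg _)
  set δ : ℝ := min (k / (2 * (Q ^ 2 + 1))) (k * c₁ * ε / (4 * ((Q ^ 2 + 1) * (N + 1)))) with hδ
  have hδ0 : 0 < δ := by positivity
  have hδ1 : δ * Q ^ 2 ≤ k / 2 := by
    have : δ * (Q ^ 2 + 1) ≤ k / (2 * (Q ^ 2 + 1)) * (Q ^ 2 + 1) := by gcongr; exact min_le_left _ _
    have h2 : k / (2 * (Q ^ 2 + 1)) * (Q ^ 2 + 1) = k / 2 := by field_simp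
    linarith
  have hδ2 : δ * Q ^ 2 * N ≤ k * c₁ * ε / 4 := by
    calc δ * Q ^ 2 * N ≤ δ * (Q ^ 2 + 1) * (N + 1) := by gcongr <;> linarith
      _ ≤ k * c₁ * ε / (4 * ((Q ^ 2 + 1) * (N + 1))) * (Q ^ 2 + 1) * (N + 1) := by
        gcongr; exact min_le_right _ _
      _ = _ := by field_simp
  refine ⟨k * c₁ * ε / 4 / (1 + 1 / δ), by positivity, fun u hu hupos hineq hen => ?_⟩
  have hucont : ∀ x ≠ 0, ContinuousAt u x := fun x hx => (hu x hx).continuousAt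
  have hupc : ∀ x ≠ 0, ContinuousAt (fun x => u x ^ p) x := fun x hx =>
    (hucont x hx).rpow_const (Or.inl (hupos x hx).ne')
  set g : V → ℝ := fun x => ψ x ^ 2 * u x with hg
  have hgs : tsupport g ⊆ tsupport ψ := closure_mono fun x hx h => hx (by simp [hg, h])
  have hgC : ContDiff ℝ 1 g := by
    rw [contDiff_iff_contDiffAt]
    intro x
    by_cases hx : x ∈ tsupport ψ
    · exact (((hψ.contDiffAt).pow 2).mul (hu x (hne x (hψs hx)))).of_le (by norm_num)
    · have : g =ᶠ[𝓝 x] fun _ => 0 := by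
        filter_upwards [(isClosed_tsupport ψ).isOpen_compl.mem_nhds hx] with y hy
        simp [hg, image_eq_zero_of_notMem_tsupport hy]
      exact contDiffAt_const.congr_of_eventuallyEq this
  have hgc : HasCompactSupport g := hψ2c.mul_right
  have hggrad : ∀ x, x ≠ 0 → ∇ g x = (ψ x ^ 2) • ∇ u x + (2 * ψ x * u x) • ∇ ψ x := fun x hx => by
    have h := ((hψ.contDiffAt (x := x)).hasLap.mul (hψ.contDiffAt (x := x)).hasLap).mul (hu x hx).hasLap
    have h2 := (h.congr (h := g) (Eventually.of_forall fun y => by simp [hg, pow_two])).gradient_eq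
    rw [h2]
    module
  have hgreen := integral_weight_inner_gradient (ω := ω) (u := u) hgC hgc
    (fun x hx => (hωL x (hne x (hψs (hgs hx)))).contDiffAt) (fun x hx => hu x (hne x (hψs (hgs hx))))
  set Z : ℝ := ∫ x, ω x * u x ^ p * ψ x ^ 2 with hZ
  have hZI : Integrable fun x => ω x * u x ^ p * ψ x ^ 2 :=
    hInt _ fun x hx => (hωcont x hx).mul (hupc x hx)
  have hlow : k * Z ≤ ∫ x, ω x * inner ℝ (∇ u x) (∇ g x) := by
    rw [hgreen, ← integral_neg, hZ, ← integral_const_mul]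
    have hwd : ∀ x ≠ 0, ω x * Δ u x + inner ℝ (∇ ω x) (∇ u x) =
        ω x * (Δ u x - 2 * a * inner ℝ x (∇ u x) / ‖x‖ ^ 2) := fun x hx => by
      have hn := norm_pos_iff.2 hx
      rw [(hωL x hx).gradient_eq, real_inner_smul_left, hωdef]
      have : ‖x‖ ^ (-(2 * a) - 2) = ‖x‖ ^ (-(2 * a)) / ‖x‖ ^ 2 := by
        rw [rpow_sub hn, rpow_two]
      rw [this]; field_simp; ring
    have hIg : Integrable fun x =>
        ((ω x * Δ u x + inner ℝ (∇ ω x) (∇ u x)) * u x) * ψ x ^ 2 :=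
      hInt _ fun x hx => (((hωcont x hx).mul (hu x hx).continuousAt_laplacian).add
        ((hωL x hx).contDiffAt.continuousAt_gradient.inner
          (hu x hx).continuousAt_gradient)).mul (hucont x hx)
    refine integral_mono (hZI.const_mul k) ?_ fun x => ?_
    · exact hIg.neg.congr (Eventually.of_forall fun x => by simp only [hg, Pi.neg_apply]; ring)
    · simp only [hg]
      by_cases hx : x ∈ {x : V | 1 / 2 ≤ ‖x‖ ∧ ‖x‖ ≤ 2}
      · rw [hwd x (hne x hx)]
        have h := mul_le_mul_of_nonneg_left (hineq x hx.1 hx.2)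
          (mul_nonneg (hω0 x) (sq_nonneg (ψ x)))
        linarith
      · simp [hψe x hx]
  have hup : ∫ x, ω x * inner ℝ (∇ u x) (∇ g x) ≤
      (1 + 1 / δ) * (∫ x in {x : V | 1 / 2 ≤ ‖x‖ ∧ ‖x‖ ≤ 2}, ω x * ‖∇ u x‖ ^ 2) +
        δ * Q ^ 2 * (Z + N) := by
    have hIA : IntegrableOn (fun x => ω x * ‖∇ u x‖ ^ 2) {x : V | 1 / 2 ≤ ‖x‖ ∧ ‖x‖ ≤ 2} :=
      ContinuousOn.integrableOn_compact (isCompact_annulus _ _) fun x hx =>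
        ((hωcont x (hne x hx)).mul
          ((hu x (hne x hx)).continuousAt_gradient.norm.pow 2)).continuousWithinAt
    have hmA := (isCompact_annulus (V := V) (1 / 2) 2).isClosed.measurableSet
    have hIA' := (integrable_indicator_iff hmA).2 hIA
    have hωI : Integrable fun x => ω x * ψ x ^ 2 := hInt _ hωcont
    have hZN : Integrable fun x => ω x * u x ^ p * ψ x ^ 2 + ω x * ψ x ^ 2 := hZI.add hωI
    rw [← integral_indicator hmA, hZ, ← integral_add hZI hωI, ← integral_const_mul,
      ← integral_const_mul, ← integral_add (hIA'.const_mul _) (hZN.const_mul _)]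
    refine integral_mono ?_ ((hIA'.const_mul _).add (hZN.const_mul _)) fun x => ?_
    · have h1 : Integrable fun x =>
          (ω x * inner ℝ (∇ u x) (∇ u x)) * ψ x ^ 2 + 2 * ((ω x * u x * inner ℝ (∇ u x) (∇ ψ x)) * ψ x) :=
        (hInt _ fun x hx => (hωcont x hx).mul
          ((hu x hx).continuousAt_gradient.inner (hu x hx).continuousAt_gradient)).add
        ((integrable_mul_of_continuousAt_tsupport hψ.continuous hψc fun x hx =>
          ((hωcont x (hne x (hψs hx))).mul (hucont x (hne x (hψs hx)))).mul
            ((hu x (hne x (hψs hx))).continuousAt_gradient.inner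
              hψ.contDiffAt.continuousAt_gradient)).const_mul 2)
      refine h1.congr ?_
      have h0 : ∀ᵐ x : V, x ∉ tsupport ψ ∨ x ≠ 0 := Eventually.of_forall fun x => by
        by_cases hx : x ∈ tsupport ψ
        · exact Or.inr (hne x (hψs hx))
        · exact Or.inl hx
      filter_upwards [h0] with x hx
      by_cases hx0 : x = 0
      · have hx' : x ∉ tsupport ψ := hx.resolve_right (not_not.2 hx0)
        have hgx : ∇ g x = 0 := by
          have : g =ᶠ[𝓝 x] fun _ => 0 := by
            filter_upwards [(isClosed_tsupport ψ).isOpen_compl.mem_nhds hx'] with y hy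
            simp [hg, image_eq_zero_of_notMem_tsupport hy]
          rw [gradient, this.fderiv_eq]; simp
        rw [hgx, image_eq_zero_of_notMem_tsupport hx']; simp
      · rw [hggrad x hx0, inner_add_right, real_inner_smul_right, real_inner_smul_right]; ring
    · dsimp only
      by_cases hx : x ∈ {x : V | 1 / 2 ≤ ‖x‖ ∧ ‖x‖ ≤ 2}
      · rw [Set.indicator_of_mem hx, hggrad x (hne x hx), inner_add_right, real_inner_smul_right,
          real_inner_smul_right, real_inner_self_eq_norm_sq]
        have hu0 := hupos x (hne x hx)
        have hcs : inner ℝ (∇ u x) (∇ ψ x) ≤ ‖∇ u x‖ * Q :=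
          (real_inner_le_norm _ _).trans (by gcongr; exact hQ x)
        exact energy_pointwise (hω0 x) (hψ01 x).1 (hψ01 x).2 hu0 hδ0 hp hcs
      · have hx' : x ∉ tsupport ψ := fun h => hx (hψs h)
        have hgx : ∇ g x = 0 := by
          have : g =ᶠ[𝓝 x] fun _ => 0 := by
            filter_upwards [(isClosed_tsupport ψ).isOpen_compl.mem_nhds hx'] with y hy
            simp [hg, image_eq_zero_of_notMem_tsupport hy]
          rw [gradient, this.fderiv_eq]; simp
        rw [hgx, Set.indicator_of_notMem hx, hψe x hx]; simp
  have hfin : c₁ * ∫ x in {x : V | 3 / 4 ≤ ‖x‖ ∧ ‖x‖ ≤ 5 / 4}, u x ^ p ≤ Z := by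
    have hms := (isCompact_annulus (V := V) (3 / 4) (5 / 4)).isClosed.measurableSet
    rw [← integral_const_mul, ← integral_indicator hms, hZ]
    refine integral_mono_of_nonneg (Eventually.of_forall fun x => ?_) hZI
      (Eventually.of_forall fun x => ?_)
    · refine Set.indicator_nonneg (fun x hx => ?_) x
      have := hupos x (hne x ⟨le_trans (by norm_num) hx.1, le_trans hx.2 (by norm_num)⟩)
      positivity
    · dsimp only
      by_cases hx : x ∈ {x : V | 3 / 4 ≤ ‖x‖ ∧ ‖x‖ ≤ 5 / 4}
      · have hx' : x ∈ {x : V | 1 / 2 ≤ ‖x‖ ∧ ‖x‖ ≤ 2} :=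
          ⟨le_trans (by norm_num) hx.1, le_trans hx.2 (by norm_num)⟩
        rw [Set.indicator_of_mem hx, hψ1 x hx.1 hx.2, one_pow, mul_one]
        have := hupos x (hne x hx')
        have := hωc x hx'
        gcongr
      · rw [Set.indicator_of_notMem hx]
        by_cases hx' : x ∈ {x : V | 1 / 2 ≤ ‖x‖ ∧ ‖x‖ ≤ 2}
        · have := hupos x (hne x hx')
          have := hω0 x
          positivity
        · simp [hψe x hx']
  have h1 : (1 + 1 / δ) * (∫ x in {x : V | 1 / 2 ≤ ‖x‖ ∧ ‖x‖ ≤ 2}, ω x * ‖∇ u x‖ ^ 2) ≤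
      k * c₁ * ε / 4 := by
    calc _ ≤ (1 + 1 / δ) * (k * c₁ * ε / 4 / (1 + 1 / δ)) := by gcongr
      _ = _ := by field_simp
  have hZ0 : 0 ≤ Z := integral_nonneg fun x => by
    by_cases hx : x ∈ {x : V | 1 / 2 ≤ ‖x‖ ∧ ‖x‖ ≤ 2}
    · have := hupos x (hne x hx)
      have := hω0 x
      positivity
    · simp [hψe x hx]
  have h2 : δ * Q ^ 2 * Z ≤ k / 2 * Z := by gcongr
  have h3 : k / 2 * Z ≤ k / 2 * (c₁ * ε) := by linarith
  have h4 : Z ≤ c₁ * ε := le_of_mul_le_mul_left h3 (by positivity)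
  exact le_of_mul_le_mul_left (hfin.trans h4) hc₁0

end EnergyThreshold

section CoupledSystem

/-- The parameters of the coupled critical system on `V`: `m = (dim V - 2) / 2`, and the linear part
has the Hardy coefficient `m ^ 2 - l ^ 2`. -/
structure CoupledParams (V : Type*) [NormedAddCommGroup V] [InnerProductSpace ℝ V] where
  (l m p σ : ℝ)
  (κ α β : Fin 2 → Fin 2 → ℝ)
  two_mul_m : 2 * m = Module.finrank ℝ V - 2
  l_pos : 0 < l
  l_le_m : l ≤ m
  σ_nonneg : 0 ≤ σ
  two_lt_p : 2 < p
  m_mul_p : m * p + σ = Module.finrank ℝ V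
  strict : l < m ∨ 0 < σ
  κ_pos : ∀ i j, 0 < κ i j
  one_lt_α : ∀ i j, 1 < α i j
  one_lt_β : ∀ i j, 1 < β i j
  α_add_β : ∀ i j, α i j + β i j = p

namespace CoupledParams

variable {V : Type*} [NormedAddCommGroup V] [InnerProductSpace ℝ V] (P : CoupledParams V)

/-- The homogeneous coupling nonlinearity. -/
def nonlin (z : Fin 2 → ℝ) (i : Fin 2) : ℝ :=
  ∑ j, P.κ i j * z i ^ (P.α i j - 1) * z j ^ (P.β i j)

theorem m_pos : 0 < P.m := P.l_pos.trans_le P.l_le_m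

theorem nonlin_pos {z : Fin 2 → ℝ} (hz : ∀ i, 0 < z i) (i : Fin 2) : 0 < P.nonlin z i :=
  Finset.sum_pos (fun j _ => mul_pos (mul_pos (P.κ_pos i j) (rpow_pos_of_pos (hz i) _))
    (rpow_pos_of_pos (hz j) _)) ⟨i, Finset.mem_univ i⟩

theorem nonlin_smul {t : ℝ} (ht : 0 < t) {z : Fin 2 → ℝ} (hz : ∀ i, 0 < z i) (i : Fin 2) :
    P.nonlin (fun j => t * z j) i = t ^ (P.p - 1) * P.nonlin z i := by
  unfold nonlin
  rw [Finset.mul_sum]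
  refine Finset.sum_congr rfl fun j _ => ?_
  rw [mul_rpow ht.le (hz i).le, mul_rpow ht.le (hz j).le, ← P.α_add_β i j,
    show P.α i j + P.β i j - 1 = (P.α i j - 1) + P.β i j by ring, rpow_add ht]
  ring

theorem le_nonlin {z : Fin 2 → ℝ} (hz : ∀ i, 0 < z i) (i : Fin 2) :
    P.κ i i * z i ^ (P.p - 1) ≤ P.nonlin z i := by
  refine le_trans (le_of_eq ?_) (Finset.single_le_sum (f := fun j =>
    P.κ i j * z i ^ (P.α i j - 1) * z j ^ (P.β i j)) (fun j _ =>
      (mul_pos (mul_pos (P.κ_pos i j) (rpow_pos_of_pos (hz i) _)) (rpow_pos_of_pos (hz j) _)).le)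
    (Finset.mem_univ i))
  rw [mul_assoc, ← rpow_add (hz i), ← P.α_add_β i i]
  ring_nf

/-- The sum of all coupling constants. -/
def κsum : ℝ := ∑ i, ∑ j, P.κ i j

theorem κsum_pos : 0 < P.κsum :=
  Finset.sum_pos (fun i _ => Finset.sum_pos (fun j _ => P.κ_pos i j) ⟨0, Finset.mem_univ 0⟩)
    ⟨0, Finset.mem_univ 0⟩

theorem nonlin_sum_le {z : Fin 2 → ℝ} (hz : ∀ i, 0 < z i) :
    ∑ i, P.nonlin z i ≤ P.κsum * (∑ i, z i) ^ (P.p - 1) := by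
  unfold nonlin κsum
  rw [Finset.sum_mul]
  refine Finset.sum_le_sum fun i _ => ?_
  rw [Finset.sum_mul]
  refine Finset.sum_le_sum fun j _ => ?_
  have hle : ∀ k, z k ≤ ∑ i, z i := fun k =>
    Finset.single_le_sum (fun i _ => (hz i).le) (Finset.mem_univ k)
  have hS : 0 < ∑ i, z i := (hz 0).trans_le (hle 0)
  have h1 := P.one_lt_α i j
  have h2 := P.one_lt_β i j
  have h0 := P.κ_pos i j
  calc P.κ i j * z i ^ (P.α i j - 1) * z j ^ (P.β i j)
      ≤ P.κ i j * (∑ i, z i) ^ (P.α i j - 1) * (∑ i, z i) ^ (P.β i j) := by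
        have := hz i
        have := hz j
        gcongr
        · exact hle i
        · exact hle j
    _ = _ := by
        rw [mul_assoc, ← rpow_add hS, ← P.α_add_β i j]
        ring_nf

variable [FiniteDimensional ℝ V]

/-- Positive classical solutions on `V \ {0}` of the system after removal of the drift term. -/
structure IsSol (w : Fin 2 → V → ℝ) : Prop where
  contDiffAt : ∀ i x, x ≠ 0 → ContDiffAt ℝ 2 (w i) x
  pos : ∀ i x, x ≠ 0 → 0 < w i x
  laplacian_eq : ∀ i x, x ≠ 0 → Δ (w i) x =
    -((P.m ^ 2 - P.l ^ 2) / ‖x‖ ^ 2 * w i x) - ‖x‖ ^ (-P.σ) * P.nonlin (fun j => w j x) i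

/-- Positive classical solutions on `V \ {0}` of the system in weighted divergence form. -/
structure IsHenonSol (u : Fin 2 → V → ℝ) : Prop where
  contDiffAt : ∀ i x, x ≠ 0 → ContDiffAt ℝ 2 (u i) x
  pos : ∀ i x, x ≠ 0 → 0 < u i x
  laplacian_eq : ∀ i x, x ≠ 0 →
    -(Δ (u i) x - 2 * (P.m - P.l) * inner ℝ x (∇ (u i) x) / ‖x‖ ^ 2) =
      ‖x‖ ^ (P.l * (P.p - 2) - 2) * P.nonlin (fun j => u j x) i

variable {P}

theorem IsHenonSol.isSol {u : Fin 2 → V → ℝ} (hu : P.IsHenonSol u) :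
    P.IsSol fun i x => ‖x‖ ^ (P.l - P.m) * u i x := by
  have hL : ∀ i x, x ≠ 0 → HasLap (fun x => ‖x‖ ^ (P.l - P.m) * u i x) x _ _ := fun i x hx =>
    (hasLap_norm_rpow (P.l - P.m) hx).mul (hu.contDiffAt i x hx).hasLap
  refine ⟨fun i x hx => (hL i x hx).contDiffAt, fun i x hx =>
    mul_pos (rpow_pos_of_pos (norm_pos_iff.2 hx) _) (hu.pos i x hx), fun i x hx => ?_⟩
  have hn := norm_pos_iff.2 hx
  rw [(hL i x hx).laplacian_eq, P.nonlin_smul (rpow_pos_of_pos hn _) (fun j => hu.pos j x hx),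
    ← rpow_mul hn.le, real_inner_smul_left]
  have he : Δ (u i) x = 2 * (P.m - P.l) * inner ℝ x (∇ (u i) x) / ‖x‖ ^ 2 -
      ‖x‖ ^ (P.l * (P.p - 2) - 2) * P.nonlin (fun j => u j x) i := by
    linarith [hu.laplacian_eq i x hx]
  have h2 : ‖x‖ ^ (P.l - P.m - 2) = ‖x‖ ^ (P.l - P.m) / ‖x‖ ^ 2 := by
    rw [rpow_sub hn, rpow_two]
  have hσ : P.σ = Module.finrank ℝ V - P.m * P.p := by linarith [P.m_mul_p]
  have h3 : ‖x‖ ^ (-P.σ) * ‖x‖ ^ ((P.l - P.m) * (P.p - 1)) =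
      ‖x‖ ^ (P.l - P.m) * ‖x‖ ^ (P.l * (P.p - 2) - 2) := by
    rw [← rpow_add hn, ← rpow_add hn]
    congr 1
    rw [hσ]
    linarith [P.two_mul_m]
  have h4 : ‖x‖ ^ (-P.σ) * (‖x‖ ^ ((P.l - P.m) * (P.p - 1)) * P.nonlin (fun j => u j x) i) =
      ‖x‖ ^ (P.l - P.m) * ‖x‖ ^ (P.l * (P.p - 2) - 2) * P.nonlin (fun j => u j x) i := by
    rw [← mul_assoc, h3]
  rw [he, h4, h2]
  have hd : (Module.finrank ℝ V : ℝ) = 2 * P.m + 2 := by linarith [P.two_mul_m]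
  rw [hd]
  field_simp
  ring

theorem IsHenonSol.hasLap_scale {u : Fin 2 → V → ℝ} (hu : P.IsHenonSol u) {R : ℝ} (hR : 0 < R)
    (i : Fin 2) {x : V} (hx : x ≠ 0) : HasLap (fun x => R ^ P.l * u i (R • x)) x
      (R ^ P.l • R • ∇ (u i) (R • x)) (R ^ P.l * (R ^ 2 * Δ (u i) (R • x))) := by
  have h' : HasLap (u i) (R • (LinearIsometryEquiv.refl ℝ V) x + 0) (∇ (u i) (R • x))
      (Δ (u i) (R • x)) := by
    rw [add_zero]; exact (hu.contDiffAt i (R • x) (smul_ne_zero hR.ne' hx)).hasLap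
  have h2 := (h'.comp_affine (LinearIsometryEquiv.refl ℝ V) R 0).const_mul (R ^ P.l)
  exact h2.congr (Eventually.of_forall fun y => by simp)

theorem IsHenonSol.scale {u : Fin 2 → V → ℝ} (hu : P.IsHenonSol u) {R : ℝ} (hR : 0 < R) :
    P.IsHenonSol fun i x => R ^ P.l * u i (R • x) := by
  have hne : ∀ x : V, x ≠ 0 → R • x ≠ 0 := fun x hx => smul_ne_zero hR.ne' hx
  have hL := fun i x (hx : x ≠ 0) => hu.hasLap_scale hR i hx
  refine ⟨fun i x hx => (hL i x hx).contDiffAt, fun i x hx =>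
    mul_pos (rpow_pos_of_pos hR _) (hu.pos i _ (hne x hx)), fun i x hx => ?_⟩
  have hn := norm_pos_iff.2 hx
  rw [(hL i x hx).laplacian_eq, (hL i x hx).gradient_eq,
    P.nonlin_smul (rpow_pos_of_pos hR _) (fun j => hu.pos j _ (hne x hx)), ← rpow_mul hR.le]
  have he := hu.laplacian_eq i (R • x) (hne x hx)
  rw [norm_smul, norm_of_nonneg hR.le, real_inner_smul_left, mul_rpow hR.le hn.le] at he
  have h3 : R ^ (P.l * (P.p - 1)) = R ^ P.l * R ^ 2 * R ^ (P.l * (P.p - 2) - 2) := by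
    rw [← rpow_two, ← rpow_add hR, ← rpow_add hR]; congr 1; ring
  rw [h3, real_inner_smul_right, real_inner_smul_right]
  calc _ = R ^ P.l * R ^ 2 * -(Δ (u i) (R • x) - 2 * (P.m - P.l) *
        (R * inner ℝ x (∇ (u i) (R • x))) / (R * ‖x‖) ^ 2) := by field_simp
    _ = _ := by rw [he]; ring

end CoupledParams

end CoupledSystem

section Decay

open Pointwise

theorem not_mem_annulus_atTop {V : Type*} [NormedAddCommGroup V] (x : V) :
    ∀ᶠ R in atTop, ¬ (R * (1 / 2) ≤ ‖x‖ ∧ ‖x‖ ≤ R * 2) := by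
  filter_upwards [eventually_gt_atTop (2 * ‖x‖)] with R hR h
  linarith [h.1]

theorem not_mem_annulus_zero {V : Type*} [NormedAddCommGroup V] (x : V) :
    ∀ᶠ R in 𝓝[>] (0 : ℝ), ¬ (R * (1 / 2) ≤ ‖x‖ ∧ ‖x‖ ≤ R * 2) := by
  by_cases hx : x = 0
  · filter_upwards [self_mem_nhdsWithin] with R hR h
    rw [hx, norm_zero] at h
    have : 0 < R := hR
    linarith [h.1]
  · have h0 : 0 < ‖x‖ / 2 := by have := norm_pos_iff.2 hx; positivity
    filter_upwards [Ioo_mem_nhdsGT h0] with R hR h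
    linarith [h.2, hR.2]

theorem rpow_two_neg_abs_le {t τ : ℝ} (h1 : 1 / 2 ≤ t) (h2 : t ≤ 2) : 2 ^ (-|τ|) ≤ t ^ τ := by
  rcases le_total 0 τ with h | h
  · rw [abs_of_nonneg h, rpow_neg (by norm_num), ← inv_rpow (by norm_num)]
    exact rpow_le_rpow (by norm_num) (by linarith) h
  · rw [abs_of_nonpos h, neg_neg]
    exact rpow_le_rpow_of_nonpos (by linarith) h2 h

theorem rpow_le_rpow_two_abs {t τ : ℝ} (h1 : 1 / 2 ≤ t) (h2 : t ≤ 2) : t ^ τ ≤ 2 ^ |τ| := by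
  have ht : 0 < t := by linarith
  have h := rpow_two_neg_abs_le (τ := -τ) h1 h2
  rw [abs_neg, rpow_neg (by norm_num), rpow_neg ht.le] at h
  exact (inv_le_inv₀ (by positivity) (by positivity)).1 h

variable {V : Type*} [NormedAddCommGroup V] [InnerProductSpace ℝ V] [FiniteDimensional ℝ V]
  [MeasurableSpace V] [BorelSpace V]

theorem tendsto_setIntegral_annulus {f : V → ℝ} (hf : Integrable f) {l : Filter ℝ}
    [l.IsCountablyGenerated]
    (hl : ∀ x : V, ∀ᶠ R in l, ¬ (R * (1 / 2) ≤ ‖x‖ ∧ ‖x‖ ≤ R * 2)) :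
    Tendsto (fun R => ∫ x in {x : V | R * (1 / 2) ≤ ‖x‖ ∧ ‖x‖ ≤ R * 2}, f x) l (𝓝 0) := by
  have hm : ∀ R : ℝ, MeasurableSet {x : V | R * (1 / 2) ≤ ‖x‖ ∧ ‖x‖ ≤ R * 2} := fun R =>
    (isCompact_annulus _ _).isClosed.measurableSet
  have h : Tendsto (fun R => ∫ x, Set.indicator {x : V | R * (1 / 2) ≤ ‖x‖ ∧ ‖x‖ ≤ R * 2} f x) l
      (𝓝 (∫ _ : V, (0 : ℝ))) := by
    refine tendsto_integral_filter_of_dominated_convergence (fun x => ‖f x‖)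
      (Eventually.of_forall fun R => hf.aestronglyMeasurable.indicator (hm R))
      (Eventually.of_forall fun R => Eventually.of_forall fun x => norm_indicator_le_norm_self f x)
      hf.norm (Eventually.of_forall fun x => ?_)
    refine tendsto_const_nhds.congr' ?_
    filter_upwards [hl x] with R hR
    exact (Set.indicator_of_notMem (show x ∉ {x : V | R * (1 / 2) ≤ ‖x‖ ∧ ‖x‖ ≤ R * 2} from hR) f).symm
  rw [integral_zero] at h
  exact h.congr fun R => integral_indicator (hm R)

namespace CoupledParams

variable {P : CoupledParams V} {u w : Fin 2 → V → ℝ}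

theorem IsHenonSol.energy_scale (hu : P.IsHenonSol u) {R : ℝ} (hR : 0 < R) (i : Fin 2) :
    ∫ x in {x : V | 1 / 2 ≤ ‖x‖ ∧ ‖x‖ ≤ 2},
        ‖x‖ ^ (-(2 * (P.m - P.l))) * ‖∇ (fun x => R ^ P.l * u i (R • x)) x‖ ^ 2 =
      ∫ x in {x : V | R * (1 / 2) ≤ ‖x‖ ∧ ‖x‖ ≤ R * 2},
        ‖x‖ ^ (-(2 * (P.m - P.l))) * ‖∇ (u i) x‖ ^ 2 := by
  have hm : MeasurableSet {x : V | 1 / 2 ≤ ‖x‖ ∧ ‖x‖ ≤ 2} :=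
    (isCompact_annulus _ _).isClosed.measurableSet
  have hs := Measure.setIntegral_comp_smul_of_pos (volume : Measure V)
    (fun x => ‖x‖ ^ (-(2 * (P.m - P.l))) * ‖∇ (u i) x‖ ^ 2) {x : V | 1 / 2 ≤ ‖x‖ ∧ ‖x‖ ≤ 2} hR
  have hset : R • {x : V | 1 / 2 ≤ ‖x‖ ∧ ‖x‖ ≤ 2} =
      {x : V | R * (1 / 2) ≤ ‖x‖ ∧ ‖x‖ ≤ R * 2} := by
    ext x
    rw [Set.mem_smul_set_iff_inv_smul_mem₀ hR.ne']
    simp only [Set.mem_ofPred_eq, norm_smul, norm_inv, norm_of_nonneg hR.le]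
    rw [inv_mul_le_iff₀ hR, le_inv_mul_iff₀ hR]
  rw [hset, smul_eq_mul] at hs
  have h1 : ∫ x in {x : V | 1 / 2 ≤ ‖x‖ ∧ ‖x‖ ≤ 2},
        ‖x‖ ^ (-(2 * (P.m - P.l))) * ‖∇ (fun x => R ^ P.l * u i (R • x)) x‖ ^ 2 =
      ∫ x in {x : V | 1 / 2 ≤ ‖x‖ ∧ ‖x‖ ≤ 2}, R ^ Module.finrank ℝ V *
        (‖R • x‖ ^ (-(2 * (P.m - P.l))) * ‖∇ (u i) (R • x)‖ ^ 2) := by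
    refine setIntegral_congr_fun hm fun x hx => ?_
    have hx0 : x ≠ 0 := fun h => by
      have := hx.1
      rw [h, norm_zero] at this; norm_num at this
    have hn := norm_pos_iff.2 hx0
    have hRl := rpow_pos_of_pos hR P.l
    rw [(hu.hasLap_scale hR i hx0).gradient_eq, norm_smul, norm_smul, norm_smul,
      norm_of_nonneg hR.le, norm_of_nonneg hRl.le, mul_rpow hR.le hn.le]
    have h3 : R ^ Module.finrank ℝ V * R ^ (-(2 * (P.m - P.l))) = R ^ P.l * R ^ P.l * R ^ 2 := by
      rw [← rpow_natCast, ← rpow_two, ← rpow_add hR, ← rpow_add hR, ← rpow_add hR]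
      congr 1
      linarith [P.two_mul_m]
    calc _ = (R ^ P.l * R ^ P.l * R ^ 2) * ‖x‖ ^ (-(2 * (P.m - P.l))) * ‖∇ (u i) (R • x)‖ ^ 2 := by
          ring
      _ = _ := by rw [← h3]; ring
  rw [h1, integral_const_mul, hs, mul_inv_cancel_left₀ (by positivity)]

/-- Solutions of small energy on a unit annulus are small on the unit sphere. -/
theorem exists_small_of_energy (P : CoupledParams V) {ε : ℝ} (hε : 0 < ε) :
    ∃ η : ℝ, 0 < η ∧ ∀ u : Fin 2 → V → ℝ, P.IsHenonSol u →
      (∀ i, ∫ x in {x : V | 1 / 2 ≤ ‖x‖ ∧ ‖x‖ ≤ 2},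
        ‖x‖ ^ (-(2 * (P.m - P.l))) * ‖∇ (u i) x‖ ^ 2 ≤ η) →
      ∀ i z, ‖z‖ = 1 → u i z ≤ ε := by
  have hp := P.two_lt_p
  have hp0 : 0 < P.p := by linarith
  have hm := P.m_pos
  have hκ := P.κsum_pos
  obtain ⟨C, δ, hC, hδ, hreg⟩ := exists_eps_regularity (V := V) (p := P.p)
    (A := 4 * P.m ^ 2 + 2 ^ |-P.σ| * P.κsum) hp (by
      have := P.two_mul_m
      have := P.m_mul_p
      have := P.σ_nonneg
      have : P.p * (Module.finrank ℝ V - 2) = 2 * (P.m * P.p) := by rw [← P.two_mul_m]; ring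
      linarith) (by positivity)
  set X : ℝ := min δ (ε ^ P.p / C)
  have hX : 0 < X := by positivity
  set K : ℝ := (2 * 2 ^ |P.l - P.m|) ^ P.p with hK
  have hK0 : 0 < K := by positivity
  have hth := fun i => exists_energy_threshold V (a := P.m - P.l)
    (k := P.κ i i * 2 ^ (-|P.l * (P.p - 2) - 2|)) (p := P.p) (ε := X / (2 * K))
    (by linarith [P.l_le_m]) (mul_pos (P.κ_pos i i) (by positivity)) hp (by positivity)
  choose η hη hth using hth
  refine ⟨min (η 0) (η 1), lt_min (hη 0) (hη 1), fun u hu hE i z hz => ?_⟩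
  have hne : ∀ {r s : ℝ}, 0 < r → ∀ x ∈ {x : V | r ≤ ‖x‖ ∧ ‖x‖ ≤ s}, x ≠ 0 := fun hr x hx =>
    norm_pos_iff.1 (hr.trans_le hx.1)
  have hsmall : ∀ i, ∫ x in {x : V | 3 / 4 ≤ ‖x‖ ∧ ‖x‖ ≤ 5 / 4}, u i x ^ P.p ≤ X / (2 * K) := by
    intro i
    refine hth i (u i) (hu.contDiffAt i) (hu.pos i) (fun x h1 h2 => ?_) ((hE i).trans ?_)
    · have hx : x ≠ 0 := hne one_half_pos x ⟨h1, h2⟩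
      have hx0 := hu.pos i x hx
      rw [hu.laplacian_eq i x hx]
      calc P.κ i i * 2 ^ (-|P.l * (P.p - 2) - 2|) * u i x ^ P.p
          = 2 ^ (-|P.l * (P.p - 2) - 2|) * (P.κ i i * u i x ^ (P.p - 1)) * u i x := by
            rw [rpow_sub_one hx0.ne']; field_simp
        _ ≤ _ := by
            have := P.κ_pos i i
            gcongr
            · exact rpow_two_neg_abs_le h1 h2
            · exact P.le_nonlin (fun j => hu.pos j x hx) i
    · fin_cases i
      · exact min_le_left _ _
      · exact min_le_right _ _
  have hball : Metric.closedBall z (1 / 4) ⊆ {x : V | 3 / 4 ≤ ‖x‖ ∧ ‖x‖ ≤ 5 / 4} := fun x hx => by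
    rw [mem_closedBall_iff_norm] at hx
    have h1 := norm_sub_norm_le x z
    have h2 := norm_sub_norm_le z x
    rw [norm_sub_rev] at h2
    constructor <;> linarith
  have hw := hu.isSol
  set w : Fin 2 → V → ℝ := fun i x => ‖x‖ ^ (P.l - P.m) * u i x with hwdef
  have hmulInt : ∀ i, IntegrableOn (fun x => u i x ^ P.p) {x : V | 3 / 4 ≤ ‖x‖ ∧ ‖x‖ ≤ 5 / 4} :=
    fun i => ContinuousOn.integrableOn_compact (isCompact_annulus _ _) fun x hx =>
      ((hu.contDiffAt i x (hne (by norm_num) x hx)).continuousAt.rpow_const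
        (Or.inl (hu.pos i x (hne (by norm_num) x hx)).ne')).continuousWithinAt
  have hms : MeasurableSet {x : V | 3 / 4 ≤ ‖x‖ ∧ ‖x‖ ≤ 5 / 4} :=
    (isCompact_annulus _ _).isClosed.measurableSet
  have hS := hreg (fun x => w 0 x + w 1 x) z X (fun y hy => ?_) (fun y hy => ?_) (fun y hy => ?_) ?_
    (min_le_left _ _)
  · have h1 : ∀ i, w i z = u i z := fun i => by simp [hwdef, hz]
    have hz0 : z ≠ 0 := norm_pos_iff.1 (by rw [hz]; norm_num)
    rw [h1, h1] at hS
    have h2 : (u 0 z + u 1 z) ^ P.p ≤ ε ^ P.p := by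
      refine hS.trans ?_
      calc C * X ≤ C * (ε ^ P.p / C) := by gcongr; exact min_le_right _ _
        _ = _ := by field_simp
    have h3 := (rpow_le_rpow_iff (add_pos (hu.pos 0 z hz0) (hu.pos 1 z hz0)).le hε.le hp0).1 h2
    have h40 := hu.pos 0 z hz0
    have h41 := hu.pos 1 z hz0
    fin_cases i
    · show u 0 z ≤ ε
      linarith
    · show u 1 z ≤ ε
      linarith
  · have hy0 := hne (by norm_num) y (hball hy)
    exact (hw.contDiffAt 0 y hy0).add (hw.contDiffAt 1 y hy0)
  · have hy0 := hne (by norm_num) y (hball hy)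
    exact (add_pos (hw.pos 0 y hy0) (hw.pos 1 y hy0)).le
  · have hyb := hball hy
    have hy0 := hne (by norm_num) y hyb
    have h0 := hw.pos 0 y hy0
    have h1 := hw.pos 1 y hy0
    rw [((hw.contDiffAt 0 y hy0).hasLap.add (hw.contDiffAt 1 y hy0).hasLap).laplacian_eq,
      hw.laplacian_eq 0 y hy0, hw.laplacian_eq 1 y hy0]
    have hF := P.nonlin_sum_le (z := fun j => w j y) (fun j => hw.pos j y hy0)
    rw [Fin.sum_univ_two, Fin.sum_univ_two] at hF
    have hn : 1 / 2 ≤ ‖y‖ := le_trans (by norm_num) hyb.1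
    have hn2 : ‖y‖ ≤ 2 := le_trans hyb.2 (by norm_num)
    have hc : (P.m ^ 2 - P.l ^ 2) / ‖y‖ ^ 2 ≤ 4 * P.m ^ 2 := by
      rw [div_le_iff₀ (by positivity)]
      have : (1 / 2) ^ 2 ≤ ‖y‖ ^ 2 := by gcongr
      calc P.m ^ 2 - P.l ^ 2 ≤ 4 * P.m ^ 2 * (1 / 2) ^ 2 := by linarith [sq_nonneg P.l]
        _ ≤ _ := by gcongr
    have e1 : (P.m ^ 2 - P.l ^ 2) / ‖y‖ ^ 2 * (w 0 y + w 1 y) ≤ 4 * P.m ^ 2 * (w 0 y + w 1 y) := by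
      gcongr
    have e2 : ‖y‖ ^ (-P.σ) * (P.nonlin (fun j => w j y) 0 + P.nonlin (fun j => w j y) 1) ≤
        2 ^ |-P.σ| * (P.κsum * (w 0 y + w 1 y) ^ (P.p - 1)) := by
      have := P.nonlin_pos (z := fun j => w j y) (fun j => hw.pos j y hy0) 0
      have := P.nonlin_pos (z := fun j => w j y) (fun j => hw.pos j y hy0) 1
      gcongr
      exact rpow_le_rpow_two_abs hn hn2
    have e3 : 0 ≤ 4 * P.m ^ 2 * (w 0 y + w 1 y) ^ (P.p - 1) := by positivity
    have e4 : 0 ≤ 2 ^ |-P.σ| * P.κsum * (w 0 y + w 1 y) := by positivity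
    linarith
  · have hle : ∀ y ∈ {x : V | 3 / 4 ≤ ‖x‖ ∧ ‖x‖ ≤ 5 / 4},
        (w 0 y + w 1 y) ^ P.p ≤ K * (u 0 y ^ P.p + u 1 y ^ P.p) := fun y hy => by
      have hy0 := hne (by norm_num) y hy
      have h0 := hu.pos 0 y hy0
      have h1 := hu.pos 1 y hy0
      have hn := rpow_le_rpow_two_abs (t := ‖y‖) (τ := P.l - P.m) (le_trans (by norm_num) hy.1)
        (le_trans hy.2 (by norm_num))
      have hM : (max (u 0 y) (u 1 y)) ^ P.p ≤ u 0 y ^ P.p + u 1 y ^ P.p := by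
        have e0 : 0 < u 0 y ^ P.p := by positivity
        have e1 : 0 < u 1 y ^ P.p := by positivity
        rcases max_choice (u 0 y) (u 1 y) with h | h <;> rw [h] <;> linarith
      calc (w 0 y + w 1 y) ^ P.p = (‖y‖ ^ (P.l - P.m) * (u 0 y + u 1 y)) ^ P.p := by
            simp only [hwdef]; ring_nf
        _ ≤ (2 ^ |P.l - P.m| * (2 * max (u 0 y) (u 1 y))) ^ P.p := by
            gcongr
            linarith [le_max_left (u 0 y) (u 1 y), le_max_right (u 0 y) (u 1 y)]
        _ = K * (max (u 0 y) (u 1 y)) ^ P.p := by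
            rw [hK, ← mul_rpow (by positivity) (by positivity)]; ring_nf
        _ ≤ _ := by gcongr
    have hI : IntegrableOn (fun y => K * (u 0 y ^ P.p + u 1 y ^ P.p))
        {x : V | 3 / 4 ≤ ‖x‖ ∧ ‖x‖ ≤ 5 / 4} := ((hmulInt 0).add (hmulInt 1)).const_mul K
    have hmono := setIntegral_mono_set hI ((ae_restrict_iff' hms).2 (Eventually.of_forall fun y hy => by
      have hy0 := hne (by norm_num) y hy
      have h0 := hu.pos 0 y hy0
      have h1 := hu.pos 1 y hy0
      show 0 ≤ K * (u 0 y ^ P.p + u 1 y ^ P.p)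
      positivity)) (Metric.ball_subset_closedBall.trans hball).eventuallyLE
    calc _ ≤ ∫ y in Metric.ball z (1 / 4), K * (u 0 y ^ P.p + u 1 y ^ P.p) := by
          refine integral_mono_of_nonneg ?_ (hI.mono_set
            (Metric.ball_subset_closedBall.trans hball)) ?_
          · refine (ae_restrict_iff' Metric.isOpen_ball.measurableSet).2
              (Eventually.of_forall fun y hy => ?_)
            have hy0 := hne (by norm_num) y (hball (Metric.ball_subset_closedBall hy))
            have h0 := hw.pos 0 y hy0
            have h1 := hw.pos 1 y hy0
            show 0 ≤ (w 0 y + w 1 y) ^ P.p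
            positivity
          · exact (ae_restrict_iff' Metric.isOpen_ball.measurableSet).2
              (Eventually.of_forall fun y hy => hle y (hball (Metric.ball_subset_closedBall hy)))
      _ ≤ ∫ y in {x : V | 3 / 4 ≤ ‖x‖ ∧ ‖x‖ ≤ 5 / 4}, K * (u 0 y ^ P.p + u 1 y ^ P.p) := hmono
      _ = K * (∫ y in {x : V | 3 / 4 ≤ ‖x‖ ∧ ‖x‖ ≤ 5 / 4}, u 0 y ^ P.p) +
          K * ∫ y in {x : V | 3 / 4 ≤ ‖x‖ ∧ ‖x‖ ≤ 5 / 4}, u 1 y ^ P.p := by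
          rw [integral_const_mul, integral_add (hmulInt 0) (hmulInt 1), mul_add]
      _ ≤ K * (X / (2 * K)) + K * (X / (2 * K)) := by
          gcongr
          · exact hsmall 0
          · exact hsmall 1
      _ = X := by field_simp; ring

theorem IsHenonSol.tendsto_zero (hu : P.IsHenonSol u)
    (hE : ∀ i, Integrable fun x => ‖x‖ ^ (-(2 * (P.m - P.l))) * ‖∇ (u i) x‖ ^ 2) {l : Filter ℝ}
    [l.IsCountablyGenerated]
    (hl : ∀ x : V, ∀ᶠ R in l, ¬ (R * (1 / 2) ≤ ‖x‖ ∧ ‖x‖ ≤ R * 2)) (hl0 : ∀ᶠ R in l, 0 < R)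
    {ε : ℝ} (hε : 0 < ε) : ∀ᶠ R in l, ∀ i x, ‖x‖ = R → ‖x‖ ^ P.l * u i x ≤ ε := by
  obtain ⟨η, hη, h⟩ := P.exists_small_of_energy hε
  have ht := fun i => (tendsto_setIntegral_annulus (hE i) hl).eventually (Iic_mem_nhds hη)
  filter_upwards [hl0, eventually_all.2 ht] with R hR hI i x hx
  have h1 := h _ (hu.scale hR) (fun i => (hu.energy_scale hR i).trans_le (hI i)) i (R⁻¹ • x) (by
    rw [norm_smul, norm_inv, norm_of_nonneg hR.le, hx, inv_mul_cancel₀ hR.ne'])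
  rwa [smul_inv_smul₀ hR.ne', ← hx] at h1

/-- Vanishing of the rescaled components at the origin and at infinity. -/
structure Vanishing (P : CoupledParams V) (w : Fin 2 → V → ℝ) : Prop where
  infty : ∀ ε > 0, ∃ R > 0, ∀ i x, R ≤ ‖x‖ → ‖x‖ ^ P.m * w i x ≤ ε
  zero : ∀ ε > 0, ∃ r > 0, ∀ i x, x ≠ 0 → ‖x‖ ≤ r → ‖x‖ ^ P.m * w i x ≤ ε

theorem IsHenonSol.vanishing (hu : P.IsHenonSol u)
    (hE : ∀ i, Integrable fun x => ‖x‖ ^ (-(2 * (P.m - P.l))) * ‖∇ (u i) x‖ ^ 2) :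
    P.Vanishing fun i x => ‖x‖ ^ (P.l - P.m) * u i x := by
  have key : ∀ x : V, x ≠ 0 → ∀ y : ℝ, ‖x‖ ^ P.m * (‖x‖ ^ (P.l - P.m) * y) = ‖x‖ ^ P.l * y :=
    fun x hx y => by
      rw [← mul_assoc, ← rpow_add (norm_pos_iff.2 hx)]; ring_nf
  constructor
  · intro ε hε
    obtain ⟨R, hR⟩ := eventually_atTop.1 (hu.tendsto_zero hE not_mem_annulus_atTop
      (eventually_gt_atTop 0) hε)
    refine ⟨max R 1, by positivity, fun i x hx => ?_⟩
    have hx0 : x ≠ 0 := norm_pos_iff.1 (lt_of_lt_of_le (by positivity) hx)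
    rw [key x hx0]
    exact hR ‖x‖ ((le_max_left _ _).trans hx) i x rfl
  · intro ε hε
    obtain ⟨r, hr, h⟩ := mem_nhdsGT_iff_exists_Ioc_subset.1 (hu.tendsto_zero hE not_mem_annulus_zero
      self_mem_nhdsWithin hε)
    refine ⟨r, hr, fun i x hx0 hx => ?_⟩
    rw [key x hx0]
    exact h ⟨norm_pos_iff.2 hx0, hx⟩ i x rfl

end CoupledParams

end Decay

section Barriers

variable {V : Type*} [NormedAddCommGroup V] [InnerProductSpace ℝ V] [FiniteDimensional ℝ V]

theorem exists_isLocalMin_exterior {φ : V → ℝ} {r : ℝ}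
    (hφ : ∀ x, r ≤ ‖x‖ → ContinuousAt φ x) (hb : ∀ x, ‖x‖ = r → 0 ≤ φ x)
    (hinf : ∀ ε > 0, ∃ R, ∀ x, R ≤ ‖x‖ → -ε ≤ φ x) {x₁ : V} (hx₁ : r ≤ ‖x₁‖) (h₁ : φ x₁ < 0) :
    ∃ x, r < ‖x‖ ∧ φ x < 0 ∧ IsLocalMin φ x := by
  obtain ⟨R, hR⟩ := hinf (-φ x₁ / 2) (by linarith)
  have hK := isCompact_annulus (V := V) r (max R ‖x₁‖)
  obtain ⟨x, hx, hmin⟩ := hK.exists_isMinOn ⟨x₁, hx₁, le_max_right _ _⟩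
    (fun y hy => (hφ y hy.1).continuousWithinAt)
  have hle : φ x ≤ φ x₁ := hmin ⟨hx₁, le_max_right _ _⟩
  have hxr : r < ‖x‖ := lt_of_le_of_ne hx.1 fun h => by linarith [hb x h.symm]
  refine ⟨x, hxr, hle.trans_lt h₁, ?_⟩
  filter_upwards [(isOpen_lt continuous_const continuous_norm).mem_nhds hxr] with y hy
  by_cases hyR : ‖y‖ ≤ max R ‖x₁‖
  · exact hmin ⟨le_of_lt hy, hyR⟩
  · have := hR y ((le_max_left _ _).trans (not_le.1 hyR).le)
    linarith

/-- Maximum principle in the exterior of a ball, for an operator of Hardy type. -/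
theorem nonneg_of_laplacian_le_exterior {f : V → ℝ} {r m ν : ℝ} (hr : 0 < r)
    (hm : 2 * m = Module.finrank ℝ V - 2) (hν : 0 < ν)
    (hf : ∀ x, r ≤ ‖x‖ → ContDiffAt ℝ 2 f x) (hb : ∀ x, ‖x‖ = r → 0 ≤ f x)
    (hinf : ∀ ε > 0, ∃ R, ∀ x, R ≤ ‖x‖ → -ε ≤ ‖x‖ ^ m * f x)
    (hΔ : ∀ x, r ≤ ‖x‖ → f x < 0 → Δ f x ≤ -((m ^ 2 - ν ^ 2) / ‖x‖ ^ 2 * f x)) :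
    ∀ x, r ≤ ‖x‖ → 0 ≤ f x := by
  by_contra! hcon
  obtain ⟨x₁, hx₁, h₁⟩ := hcon
  have hne : ∀ x : V, r ≤ ‖x‖ → x ≠ 0 := fun x hx => norm_pos_iff.1 (hr.trans_le hx)
  obtain ⟨x, hx, hneg, hmin⟩ := exists_isLocalMin_exterior (φ := fun x => ‖x‖ ^ m * f x) (r := r)
    (fun x hx => ((hasLap_norm_rpow m (hne x hx)).contDiffAt.continuousAt).mul
      (hf x hx).continuousAt)
    (fun x hx => mul_nonneg (by positivity) (hb x hx)) hinf hx₁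
    (mul_neg_of_pos_of_neg (rpow_pos_of_pos (hr.trans_le hx₁) _) h₁)
  have hn : 0 < ‖x‖ := hr.trans hx
  have hx0 := norm_pos_iff.1 hn
  set q := ‖x‖ ^ m * f x with hq
  have hfx : f x = q * ‖x‖ ^ (-m) := by
    rw [hq, mul_right_comm, ← rpow_add hn, add_neg_cancel, rpow_zero, one_mul]
  have hle : ∀ᶠ y in 𝓝 x, q * ‖y‖ ^ (-m) ≤ f y := by
    filter_upwards [hmin, isOpen_ne.mem_nhds hx0] with y hy hy0
    have hyn := norm_pos_iff.2 hy0
    have h2 : q * ‖y‖ ^ (-m) ≤ (‖y‖ ^ m * f y) * ‖y‖ ^ (-m) := by gcongr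
    have h3 : ‖y‖ ^ m * f y * ‖y‖ ^ (-m) = f y := by
      rw [mul_right_comm, ← rpow_add hyn, add_neg_cancel, rpow_zero, one_mul]
    exact h2.trans_eq h3
  have hlap := (hf x hx.le).hasLap.le_of_eventually_le
    ((hasLap_norm_rpow (-m) hx0).const_mul q) hle hfx.symm
  have hfn : f x < 0 := by
    rw [hfx]; exact mul_neg_of_neg_of_pos hneg (rpow_pos_of_pos hn _)
  have h3 := hlap.trans (hΔ x hx.le hfn)
  have h4 : q * (-m * (-m + Module.finrank ℝ V - 2) * ‖x‖ ^ (-m - 2)) = -(m ^ 2 / ‖x‖ ^ 2 * f x) := by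
    rw [hfx, rpow_sub hn, rpow_two, show (Module.finrank ℝ V : ℝ) = 2 * m + 2 by linarith]
    field_simp; ring
  rw [h4, sub_div, sub_mul] at h3
  have h5 : ν ^ 2 / ‖x‖ ^ 2 * f x < 0 := mul_neg_of_pos_of_neg (by positivity) hfn
  linarith

/-- A positive strictly superharmonic function on a punctured ball is bounded below by its bound on
the sphere. -/
theorem le_of_laplacian_neg_punctured {f : V → ℝ} {x₀ : V} {ρ η m : ℝ} (hm0 : 0 < m)
    (hm : 2 * m = Module.finrank ℝ V - 2)
    (hf : ∀ x, x ≠ x₀ → ‖x - x₀‖ ≤ ρ → ContDiffAt ℝ 2 f x)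
    (hf0 : ∀ x, x ≠ x₀ → ‖x - x₀‖ ≤ ρ → 0 ≤ f x)
    (hΔ : ∀ x, x ≠ x₀ → ‖x - x₀‖ < ρ → Δ f x < 0)
    (hb : ∀ x, ‖x - x₀‖ = ρ → η ≤ f x) :
    ∀ x, x ≠ x₀ → ‖x - x₀‖ ≤ ρ → η ≤ f x := by
  intro x₁ hx₁ hx₁ρ
  have hn₁ : 0 < ‖x₁ - x₀‖ := norm_sub_pos_iff.2 hx₁
  have key : ∀ ε > 0, η ≤ f x₁ + ε * ‖x₁ - x₀‖ ^ (-(2 * m)) := by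
    intro ε hε
    by_contra! hcon
    obtain ⟨t, ht, htη⟩ : ∃ t, 0 < t ∧ ∀ s, 0 < s → s ≤ t → η ≤ ε * s ^ (-(2 * m)) := by
      have h := (tendsto_rpow_neg_nhdsGT_zero (y := -(2 * m)) (by linarith)).eventually
        (eventually_ge_atTop (η / ε))
      obtain ⟨t, ht, h'⟩ := mem_nhdsGT_iff_exists_Ioc_subset.1 h
      refine ⟨t, ht, fun s hs hst => ?_⟩
      have := h' ⟨hs, hst⟩
      rw [mul_comm]; exact (div_le_iff₀ hε).1 this
    set φ : V → ℝ := fun x => f x + ε * ‖x - x₀‖ ^ (-(2 * m)) with hφ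
    have hL : ∀ x, x ≠ x₀ → ‖x - x₀‖ ≤ ρ → ∃ g, HasLap φ x g (Δ f x) := fun x hx hxρ => by
      have h1 := hasLap_norm_rpow (-(2 * m)) (sub_ne_zero.2 hx)
      have e : (1 : ℝ) • (LinearIsometryEquiv.refl ℝ V) x + -x₀ = x - x₀ := by
        simp [sub_eq_add_neg]
      rw [← e] at h1
      have h3 := (h1.comp_affine (LinearIsometryEquiv.refl ℝ V) 1 (-x₀)).const_mul ε
      have h4 := ((hf x hx hxρ).hasLap.add h3).congr (h := φ) (Eventually.of_forall fun y => by
        simp [hφ, sub_eq_add_neg])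
      refine ⟨_, h4.contDiffAt, h4.gradient_eq, ?_⟩
      rw [h4.laplacian_eq, show (Module.finrank ℝ V : ℝ) = 2 * m + 2 by linarith]
      ring
    have hcn : Continuous fun x : V => ‖x - x₀‖ := by fun_prop
    have hK : IsCompact {x : V | min t ‖x₁ - x₀‖ ≤ ‖x - x₀‖ ∧ ‖x - x₀‖ ≤ ρ} :=
      (isCompact_closedBall x₀ ρ).of_isClosed_subset
        ((isClosed_le continuous_const hcn).inter
          (isClosed_le hcn continuous_const)) fun x hx => by
        rw [mem_closedBall_iff_norm]; exact hx.2
    have hKne : ∀ x ∈ {x : V | min t ‖x₁ - x₀‖ ≤ ‖x - x₀‖ ∧ ‖x - x₀‖ ≤ ρ}, x ≠ x₀ := fun x hx =>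
      norm_sub_pos_iff.1 ((lt_min ht hn₁).trans_le hx.1)
    obtain ⟨x, hx, hmin⟩ := hK.exists_isMinOn ⟨x₁, min_le_right _ _, hx₁ρ⟩ (f := φ) fun y hy => by
      obtain ⟨g, hg⟩ := hL y (hKne y hy) hy.2
      exact hg.contDiffAt.continuousAt.continuousWithinAt
    have hxη : φ x < η := (hmin ⟨min_le_right _ _, hx₁ρ⟩ : φ x ≤ φ x₁).trans_lt hcon
    have hxρ : ‖x - x₀‖ < ρ := lt_of_le_of_ne hx.2 fun h => by
      have h1 := hb x h
      have : 0 ≤ ε * ‖x - x₀‖ ^ (-(2 * m)) := by positivity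
      simp only [hφ] at hxη
      linarith
    have hxne := hKne x hx
    have hloc : IsLocalMin φ x := by
      filter_upwards [isOpen_ne.mem_nhds hxne,
        (isOpen_lt hcn continuous_const).mem_nhds hxρ]
        with y hy hyρ
      by_cases hyt : min t ‖x₁ - x₀‖ ≤ ‖y - x₀‖
      · exact hmin ⟨hyt, le_of_lt hyρ⟩
      · have h1 := htη ‖y - x₀‖ (norm_sub_pos_iff.2 hy) ((not_le.1 hyt).le.trans (min_le_left _ _))
        have h2 := hf0 y hy (le_of_lt hyρ)
        simp only [hφ] at hxη ⊢
        linarith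
    obtain ⟨g, hg⟩ := hL x hxne hx.2
    have := hloc.laplacian_nonneg hg.contDiffAt
    rw [hg.laplacian_eq] at this
    exact absurd (hΔ x hxne hxρ) (not_lt.2 this)
  refine le_of_forall_pos_le_add fun ε hε => ?_
  have hp := rpow_pos_of_pos hn₁ (-(2 * m))
  have := key (ε / ‖x₁ - x₀‖ ^ (-(2 * m))) (by positivity)
  rwa [div_mul_cancel₀ _ hp.ne'] at this

end Barriers

namespace CoupledParams

variable {V : Type*} [NormedAddCommGroup V] [InnerProductSpace ℝ V] (P : CoupledParams V)

/-- A bound for the difference quotient of the nonlinearity. -/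
def slope (z : Fin 2 → ℝ) (i : Fin 2) : ℝ :=
  ∑ j, P.κ i j * P.p * (z i ^ (P.α i j - 2) * z j ^ (P.β i j) +
    z i ^ (P.α i j - 1) * z j ^ (P.β i j - 1))

theorem p_pos : 0 < P.p := by linarith [P.two_lt_p]

theorem α_lt_p (i j : Fin 2) : P.α i j < P.p := by linarith [P.α_add_β i j, P.one_lt_β i j]

theorem β_lt_p (i j : Fin 2) : P.β i j < P.p := by linarith [P.α_add_β i j, P.one_lt_α i j]

theorem m_mul_p_sub_two : P.m * (P.p - 2) = 2 - P.σ := by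
  linarith [P.m_mul_p, P.two_mul_m]

theorem rpow_sub_rpow_le {x y γ p : ℝ} (hy : 0 < y) (hyx : y ≤ x) (hγp : γ ≤ p)
    (hp : 1 ≤ p) : x ^ γ - y ^ γ ≤ p * x ^ (γ - 1) * (x - y) := by
  have hx : 0 < x := hy.trans_le hyx
  have ht0 : 0 < y / x := div_pos hy hx
  have ht1 : y / x ≤ 1 := (div_le_one hx).2 hyx
  have key : 1 - (y / x) ^ γ ≤ p * (1 - y / x) := by
    rcases le_total 1 γ with h | h
    · have h1 := one_add_mul_self_le_rpow_one_add (s := y / x - 1) (by linarith) h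
      rw [add_sub_cancel] at h1
      have h2 : γ * (1 - y / x) ≤ p * (1 - y / x) := by gcongr
      linarith
    · have h1 : (y / x) ^ (1 : ℝ) ≤ (y / x) ^ γ := rpow_le_rpow_of_exponent_ge ht0 ht1 h
      rw [rpow_one] at h1
      have h2 : 1 * (1 - y / x) ≤ p * (1 - y / x) := by gcongr
      linarith
  calc x ^ γ - y ^ γ = x ^ γ * (1 - (y / x) ^ γ) := by
        rw [div_rpow hy.le hx.le]; field_simp
    _ ≤ x ^ γ * (p * (1 - y / x)) := by gcongr
    _ = p * x ^ (γ - 1) * (x - y) := by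
        rw [rpow_sub_one hx.ne']; field_simp

theorem nonlin_sub_le {X Y : Fin 2 → ℝ} (hX : ∀ i, 0 < X i) (hY : ∀ i, 0 < Y i) {i : Fin 2} {d : ℝ}
    (hd : 0 < d) (hi : X i - Y i = d) (hle : ∀ j, X j - Y j ≤ d) :
    P.nonlin X i - P.nonlin Y i ≤ P.slope X i * d := by
  unfold nonlin slope
  rw [← Finset.sum_sub_distrib, Finset.sum_mul]
  refine Finset.sum_le_sum fun j _ => ?_
  have hα := P.one_lt_α i j
  have hβ := P.one_lt_β i j
  have hκ := P.κ_pos i j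
  have hp := P.two_lt_p
  set M := min (Y j) (X j) with hM
  have hM0 : 0 < M := lt_min (hY j) (hX j)
  have hMX : M ≤ X j := min_le_right _ _
  have hMd : X j - M ≤ d := by
    rcases min_choice (Y j) (X j) with h | h
    · rw [hM, h]; exact hle j
    · rw [hM, h, sub_self]; exact hd.le
  have h1 : M ^ P.β i j ≤ Y j ^ P.β i j := by gcongr; exact min_le_left _ _
  have h2 := rpow_sub_rpow_le hM0 hMX (P.β_lt_p i j).le
    (by linarith)
  have h3 := rpow_sub_rpow_le (hY i) (show Y i ≤ X i by linarith)
    (show P.α i j - 1 ≤ P.p by linarith [P.α_lt_p i j])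
    (by linarith)
  rw [hi, show P.α i j - 1 - 1 = P.α i j - 2 by ring] at h3
  have hXi := hX i
  have hYi := hY i
  have hXj := hX j
  have hpp := P.p_pos
  have h4 : X j ^ P.β i j - M ^ P.β i j ≤ P.p * X j ^ (P.β i j - 1) * d :=
    h2.trans (by gcongr)
  have h5 : M ^ P.β i j ≤ X j ^ P.β i j := by gcongr
  have h6 : 0 ≤ P.p * X i ^ (P.α i j - 2) * d := by positivity
  have e1 : Y i ^ (P.α i j - 1) * M ^ P.β i j ≤ Y i ^ (P.α i j - 1) * Y j ^ P.β i j := by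
    gcongr
  have e2 : X i ^ (P.α i j - 1) * (X j ^ P.β i j - M ^ P.β i j) ≤
      X i ^ (P.α i j - 1) * (P.p * X j ^ (P.β i j - 1) * d) := by gcongr
  have e3 : (X i ^ (P.α i j - 1) - Y i ^ (P.α i j - 1)) * M ^ P.β i j ≤
      P.p * X i ^ (P.α i j - 2) * d * X j ^ P.β i j :=
    (mul_le_mul_of_nonneg_right h3 (by positivity)).trans (by gcongr)
  have e4 : X i ^ (P.α i j - 1) * X j ^ P.β i j - Y i ^ (P.α i j - 1) * Y j ^ P.β i j ≤
      P.p * (X i ^ (P.α i j - 2) * X j ^ P.β i j + X i ^ (P.α i j - 1) * X j ^ (P.β i j - 1)) * d := by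
    linarith
  calc _ = P.κ i j * (X i ^ (P.α i j - 1) * X j ^ P.β i j -
        Y i ^ (P.α i j - 1) * Y j ^ P.β i j) := by ring
    _ ≤ P.κ i j * (P.p * (X i ^ (P.α i j - 2) * X j ^ P.β i j +
        X i ^ (P.α i j - 1) * X j ^ (P.β i j - 1)) * d) := mul_le_mul_of_nonneg_left e4 hκ.le
    _ = _ := by ring

theorem nonlin_mono {X Y : Fin 2 → ℝ} (hX : ∀ i, 0 < X i) (hXY : ∀ i, X i ≤ Y i) (i : Fin 2) :
    P.nonlin X i ≤ P.nonlin Y i := by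
  unfold nonlin
  refine Finset.sum_le_sum fun j _ => ?_
  have hα := P.one_lt_α i j
  have hβ := P.one_lt_β i j
  have hκ := P.κ_pos i j
  have h1 := hX i
  have h2 := hX j
  have h3 := hXY i
  have h4 := hXY j
  have h5 := h1.trans_le h3
  gcongr

end CoupledParams

section SolutionBounds

open CoupledParams

variable {V : Type*} [NormedAddCommGroup V] [InnerProductSpace ℝ V] [FiniteDimensional ℝ V]
variable {P : CoupledParams V} {w : Fin 2 → V → ℝ}

theorem CoupledParams.IsSol.exists_pos_le_on_sphere (hw : P.IsSol w) {r : ℝ} (hr : 0 < r) :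
    ∃ ℓ > 0, ∀ i x, ‖x‖ = r → ℓ ≤ w i x := by
  have hK : IsCompact {x : V | ‖x‖ = r} := by
    convert isCompact_annulus (V := V) r r using 1
    ext x; exact ⟨fun h => ⟨h.symm.le, h.le⟩, fun h => le_antisymm h.2 h.1⟩
  have hne : ∀ x : V, ‖x‖ = r → x ≠ 0 := fun x hx => norm_pos_iff.1 (hx ▸ hr)
  have : ∀ i, ∃ ℓ > 0, ∀ x, ‖x‖ = r → ℓ ≤ w i x := fun i => by
    rcases Set.eq_empty_or_nonempty {x : V | ‖x‖ = r} with h | h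
    · exact ⟨1, one_pos, fun x hx => absurd (show x ∈ {x : V | ‖x‖ = r} from hx) (by simp [h])⟩
    · obtain ⟨x, hx, hmin⟩ := hK.exists_isMinOn h (f := w i) fun y hy =>
        (hw.contDiffAt i y (hne y hy)).continuousAt.continuousWithinAt
      exact ⟨w i x, hw.pos i x (hne x hx), fun y hy => hmin hy⟩
  choose ℓ h0 hℓ using this
  refine ⟨min (ℓ 0) (ℓ 1), lt_min (h0 0) (h0 1), fun i x hx => ?_⟩
  fin_cases i
  · exact (min_le_left _ _).trans (hℓ 0 x hx)
  · exact (min_le_right _ _).trans (hℓ 1 x hx)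

theorem CoupledParams.IsSol.laplacian_neg (hw : P.IsSol w) (i : Fin 2) {x : V} (hx : x ≠ 0) :
    Δ (w i) x < 0 := by
  have hn := norm_pos_iff.2 hx
  rw [hw.laplacian_eq i x hx]
  have h1 : 0 ≤ (P.m ^ 2 - P.l ^ 2) / ‖x‖ ^ 2 * w i x := by
    have := hw.pos i x hx
    have : 0 ≤ P.m ^ 2 - P.l ^ 2 := by
      have := P.l_le_m; have := P.l_pos; nlinarith
    positivity
  have h2 := mul_pos (rpow_pos_of_pos hn (-P.σ)) (P.nonlin_pos (fun j => hw.pos j x hx) i)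
  linarith

theorem CoupledParams.IsSol.exists_lower_punctured (hw : P.IsSol w) :
    ∃ ℓ > 0, ∀ i x, x ≠ 0 → ‖x‖ ≤ 1 → ℓ ≤ w i x := by
  obtain ⟨ℓ, h0, hℓ⟩ := hw.exists_pos_le_on_sphere one_pos
  refine ⟨ℓ, h0, fun i x hx hx1 => ?_⟩
  refine le_of_laplacian_neg_punctured (x₀ := 0) (ρ := 1) P.m_pos P.two_mul_m
    (fun y hy _ => hw.contDiffAt i y hy) (fun y hy _ => (hw.pos i y hy).le)
    (fun y hy _ => hw.laplacian_neg i hy) (fun y hy => hℓ i y ?_) x hx ?_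
  · rwa [sub_zero] at hy
  · rwa [sub_zero]

theorem CoupledParams.IsSol.exists_lower_infty (hw : P.IsSol w) :
    ∃ m₀ > 0, ∀ i x, 1 ≤ ‖x‖ → m₀ * ‖x‖ ^ (-(P.m + P.l)) ≤ w i x := by
  obtain ⟨ℓ, h0, hℓ⟩ := hw.exists_pos_le_on_sphere one_pos
  refine ⟨ℓ, h0, fun i => ?_⟩
  have hne : ∀ x : V, 1 ≤ ‖x‖ → x ≠ 0 := fun x hx => norm_pos_iff.1 (one_pos.trans_le hx)
  have hL : ∀ x : V, x ≠ 0 → _ := fun x hx => (hw.contDiffAt i x hx).hasLap.sub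
    ((hasLap_norm_rpow (-(P.m + P.l)) hx).const_mul ℓ)
  suffices h : ∀ x : V, 1 ≤ ‖x‖ → 0 ≤ w i x - ℓ * ‖x‖ ^ (-(P.m + P.l)) from
    fun x hx => sub_nonneg.1 (h x hx)
  refine nonneg_of_laplacian_le_exterior one_pos P.two_mul_m P.l_pos
    (fun x hx => (hL x (hne x hx)).contDiffAt) (fun x hx => ?_) (fun ε hε => ?_)
    (fun x hx _ => ?_)
  · rw [hx, one_rpow, mul_one]; exact sub_nonneg.2 (hℓ i x hx)
  · have h := ((tendsto_rpow_neg_atTop P.l_pos).const_mul ℓ).eventually_lt_const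
      (show ℓ * 0 < ε by simpa using hε)
    obtain ⟨R, hR⟩ := eventually_atTop.1 h
    refine ⟨max R 1, fun x hx => ?_⟩
    have hn : 0 < ‖x‖ := one_pos.trans_le ((le_max_right _ _).trans hx)
    have h1 := hR ‖x‖ ((le_max_left _ _).trans hx)
    have h2 := hw.pos i x (norm_pos_iff.1 hn)
    have h3 : ‖x‖ ^ P.m * (ℓ * ‖x‖ ^ (-(P.m + P.l))) = ℓ * ‖x‖ ^ (-P.l) := by
      rw [mul_left_comm, ← rpow_add hn]; ring_nf
    have h4 : 0 ≤ ‖x‖ ^ P.m * w i x := by positivity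
    rw [mul_sub, h3]; linarith
  · have hn : 0 < ‖x‖ := one_pos.trans_le hx
    rw [(hL x (hne x hx)).laplacian_eq, hw.laplacian_eq i x (hne x hx)]
    have h2 := mul_pos (rpow_pos_of_pos hn (-P.σ)) (P.nonlin_pos (fun j => hw.pos j x (hne x hx)) i)
    have h3 : ℓ * (-(P.m + P.l) * (-(P.m + P.l) + Module.finrank ℝ V - 2) *
        ‖x‖ ^ (-(P.m + P.l) - 2)) =
        -((P.m ^ 2 - P.l ^ 2) / ‖x‖ ^ 2 * (ℓ * ‖x‖ ^ (-(P.m + P.l)))) := by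
      rw [rpow_sub hn, rpow_two, show (Module.finrank ℝ V : ℝ) = 2 * P.m + 2 by
        linarith [P.two_mul_m]]
      field_simp; ring
    rw [h3, mul_sub]; linarith

theorem CoupledParams.IsSol.exists_upper_infty (hw : P.IsSol w) (hv : P.Vanishing w) :
    ∃ R ≥ 1, ∃ C > 0, ∀ i x, R ≤ ‖x‖ → w i x ≤ C * ‖x‖ ^ (-(P.m + P.l / (P.p - 1))) := by
  have hp := P.two_lt_p
  have hl := P.l_pos
  have hmp := P.m_pos
  set ν := P.l / (P.p - 1) with hν
  have hν0 : 0 < ν := div_pos hl (by linarith)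
  have hνl : ν < P.l := div_lt_self hl (by linarith)
  have hgap : 0 < P.l ^ 2 - ν ^ 2 := by nlinarith
  have hκ := P.κsum_pos
  obtain ⟨δ, hδ, hδP⟩ : ∃ δ > 0, P.κsum * (2 * δ) ^ (P.p - 2) ≤ P.l ^ 2 - ν ^ 2 := by
    refine ⟨((P.l ^ 2 - ν ^ 2) / P.κsum) ^ (P.p - 2)⁻¹ / 2, by positivity, ?_⟩
    rw [mul_div_cancel₀ _ two_ne_zero, ← rpow_mul (by positivity),
      inv_mul_cancel₀ (by linarith), rpow_one, mul_div_cancel₀ _ hκ.ne']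
  obtain ⟨R₀, hR₀, hR₀'⟩ := hv.infty δ hδ
  set R := max R₀ 1 with hR
  have hR1 : 1 ≤ R := le_max_right _ _
  have hRpos : 0 < R := by linarith
  have hne : ∀ x : V, R ≤ ‖x‖ → x ≠ 0 := fun x hx => norm_pos_iff.1 (hRpos.trans_le hx)
  set C := 2 * δ * R ^ ν with hC
  have hC0 : 0 < C := by positivity
  refine ⟨R, hR1, C, hC0, ?_⟩
  suffices h : ∀ x : V, R ≤ ‖x‖ → 0 ≤ C * ‖x‖ ^ (-(P.m + ν)) - (w 0 x + w 1 x) by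
    intro i x hx
    have h0 := hw.pos 0 x (hne x hx)
    have h1 := hw.pos 1 x (hne x hx)
    have h2 := h x hx
    fin_cases i
    · change w 0 x ≤ _; linarith
    · change w 1 x ≤ _; linarith
  have hL : ∀ x : V, x ≠ 0 → _ := fun x hx =>
    ((hasLap_norm_rpow (-(P.m + ν)) hx).const_mul C).sub
    ((hw.contDiffAt 0 x hx).hasLap.add (hw.contDiffAt 1 x hx).hasLap)
  have hsmall : ∀ x : V, R ≤ ‖x‖ → ‖x‖ ^ P.m * (w 0 x + w 1 x) ≤ 2 * δ := fun x hx => by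
    have h0 := hR₀' 0 x ((le_max_left _ _).trans hx)
    have h1 := hR₀' 1 x ((le_max_left _ _).trans hx)
    linarith
  refine nonneg_of_laplacian_le_exterior hRpos P.two_mul_m hν0
    (fun x hx => (hL x (hne x hx)).contDiffAt) (fun x hx => ?_) (fun ε hε => ?_)
    (fun x hx _ => ?_)
  · have h1 := hsmall x hx.ge
    have h2 : C * ‖x‖ ^ (-(P.m + ν)) = 2 * δ * R ^ (-P.m) := by
      rw [hx, hC, mul_assoc, ← rpow_add hRpos]; ring_nf
    rw [h2, rpow_neg hRpos.le, ← div_eq_mul_inv, sub_nonneg, le_div_iff₀ (by positivity), mul_comm]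
    rwa [hx] at h1
  · obtain ⟨R', hR', hR''⟩ := hv.infty (ε / 2) (by positivity)
    refine ⟨max R' 1, fun x hx => ?_⟩
    have h0 := hR'' 0 x ((le_max_left _ _).trans hx)
    have h1 := hR'' 1 x ((le_max_left _ _).trans hx)
    have h2 : 0 ≤ ‖x‖ ^ P.m * (C * ‖x‖ ^ (-(P.m + ν))) := by positivity
    rw [mul_sub]; linarith
  · have hx0 := hne x hx
    have hn : 0 < ‖x‖ := norm_pos_iff.2 hx0
    have hSpos : 0 < w 0 x + w 1 x := add_pos (hw.pos 0 x hx0) (hw.pos 1 x hx0)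
    rw [(hL x hx0).laplacian_eq, hw.laplacian_eq 0 x hx0, hw.laplacian_eq 1 x hx0]
    have hF := P.nonlin_sum_le (z := fun j => w j x) (fun j => hw.pos j x hx0)
    simp only [Fin.sum_univ_two] at hF
    have h3 : C * (-(P.m + ν) * (-(P.m + ν) + Module.finrank ℝ V - 2) *
        ‖x‖ ^ (-(P.m + ν) - 2)) =
        -((P.m ^ 2 - ν ^ 2) / ‖x‖ ^ 2 * (C * ‖x‖ ^ (-(P.m + ν)))) := by
      rw [rpow_sub hn, rpow_two, show (Module.finrank ℝ V : ℝ) = 2 * P.m + 2 by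
        linarith [P.two_mul_m]]
      field_simp; ring
    set S := w 0 x + w 1 x with hS
    have h4 : ‖x‖ ^ (-P.σ) * (P.κsum * S ^ (P.p - 1)) ≤ (P.l ^ 2 - ν ^ 2) / ‖x‖ ^ 2 * S := by
      have e1 : ‖x‖ ^ (-P.σ) * (P.κsum * S ^ (P.p - 1)) =
          P.κsum * (‖x‖ ^ P.m * S) ^ (P.p - 2) / ‖x‖ ^ 2 * S := by
        rw [mul_rpow (by positivity) hSpos.le, ← rpow_mul hn.le, P.m_mul_p_sub_two,
          rpow_sub hn, rpow_two, rpow_neg hn.le,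
          show P.p - 1 = P.p - 2 + 1 by ring, rpow_add_one hSpos.ne']
        field_simp
      rw [e1]
      gcongr
      exact (mul_le_mul_of_nonneg_left (rpow_le_rpow (by positivity) (hsmall x hx) (by linarith))
        hκ.le).trans hδP
    have h5 := (mul_le_mul_of_nonneg_left hF (rpow_nonneg hn.le (-P.σ))).trans h4
    rw [h3]
    have h6 : ∀ A B : ℝ, (A - B) / ‖x‖ ^ 2 = A / ‖x‖ ^ 2 - B / ‖x‖ ^ 2 := fun A B => sub_div _ _ _
    have h7 : S = w 0 x + w 1 x := hS
    simp only [h6] at h5 ⊢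
    have h8 : P.m ^ 2 / ‖x‖ ^ 2 * S = P.m ^ 2 / ‖x‖ ^ 2 * w 0 x + P.m ^ 2 / ‖x‖ ^ 2 * w 1 x := by
      rw [h7]; ring
    have h9 : P.l ^ 2 / ‖x‖ ^ 2 * S = P.l ^ 2 / ‖x‖ ^ 2 * w 0 x + P.l ^ 2 / ‖x‖ ^ 2 * w 1 x := by
      rw [h7]; ring
    linarith

end SolutionBounds

section SlopeDecay

open CoupledParams

theorem tendsto_cobounded_of_le {V : Type*} [NormedAddCommGroup V] {f : V → ℝ} {R A θ : ℝ} (hθ : 0 < θ) (hf0 : ∀ x, 0 ≤ f x)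
    (hf : ∀ x, R ≤ ‖x‖ → f x ≤ A * ‖x‖ ^ (-θ)) :
    Tendsto f (Bornology.cobounded V) (𝓝 0) := by
  have h1 : Tendsto (fun x : V => A * ‖x‖ ^ (-θ)) (Bornology.cobounded V) (𝓝 0) := by
    have := ((tendsto_rpow_neg_atTop hθ).comp (tendsto_norm_cobounded_atTop (E := V))).const_mul A
    rwa [mul_zero] at this
  refine tendsto_of_tendsto_of_tendsto_of_le_of_le' tendsto_const_nhds h1
    (Eventually.of_forall hf0) ?_
  filter_upwards [(tendsto_norm_cobounded_atTop (E := V)).eventually (eventually_ge_atTop R)]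
    with x hx using hf x hx

/-- The mixed powers appearing in `CoupledParams.slope` are controlled by two-sided power bounds. -/
theorem rpow_mul_rpow_le_of_barrier {a b s t A B C r l ν : ℝ} (hr : 0 < r)
    (hB : 0 < B) (hC : 0 < C) (ha : B * r ^ (-l) ≤ a) (haC : a ≤ C * r ^ (-ν))
    (hb0 : 0 < b) (hbC : b ≤ C * r ^ (-ν)) (ht : 0 ≤ t) (hA : A = if 0 ≤ s then C else B) :
    a ^ s * b ^ t ≤ A ^ s * C ^ t * r ^ (-(if 0 ≤ s then ν * s + ν * t else l * s + ν * t)) := by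
  have ha0 : 0 < a := lt_of_lt_of_le (by positivity) ha
  have h2 : b ^ t ≤ C ^ t * r ^ (-ν * t) := by
    rw [rpow_mul hr.le, ← mul_rpow hC.le (by positivity)]; gcongr
  by_cases hs : 0 ≤ s
  · rw [if_pos hs] at hA ⊢
    have h1 : a ^ s ≤ A ^ s * r ^ (-ν * s) := by
      rw [rpow_mul hr.le, hA, ← mul_rpow hC.le (by positivity)]; gcongr
    calc a ^ s * b ^ t ≤ (A ^ s * r ^ (-ν * s)) * (C ^ t * r ^ (-ν * t)) := by
          gcongr
          rw [hA]; positivity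
      _ = A ^ s * C ^ t * (r ^ (-ν * s) * r ^ (-ν * t)) := by ring
      _ = _ := by rw [← rpow_add hr]; ring_nf
  · rw [if_neg hs] at hA ⊢
    have h1 : a ^ s ≤ A ^ s * r ^ (-l * s) := by
      rw [rpow_mul hr.le, hA, ← mul_rpow hB.le (by positivity)]
      exact rpow_le_rpow_of_nonpos (by positivity) ha (not_le.1 hs).le
    calc a ^ s * b ^ t ≤ (A ^ s * r ^ (-l * s)) * (C ^ t * r ^ (-ν * t)) := by
          gcongr
          rw [hA]; positivity
      _ = A ^ s * C ^ t * (r ^ (-l * s) * r ^ (-ν * t)) := by ring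
      _ = _ := by rw [← rpow_add hr]; ring_nf

variable {V : Type*} [NormedAddCommGroup V] [InnerProductSpace ℝ V] {P : CoupledParams V}

theorem CoupledParams.slope_smul {t : ℝ} (ht : 0 < t) {z : Fin 2 → ℝ} (hz : ∀ i, 0 < z i)
    (i : Fin 2) : P.slope (fun j => t * z j) i = t ^ (P.p - 2) * P.slope z i := by
  unfold slope
  rw [Finset.mul_sum]
  refine Finset.sum_congr rfl fun j _ => ?_
  simp only [mul_rpow ht.le (hz i).le, mul_rpow ht.le (hz j).le]
  have h1 : t ^ (P.p - 2) = t ^ (P.α i j - 2) * t ^ P.β i j := by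
    rw [← rpow_add ht, ← P.α_add_β i j]; ring_nf
  have h2 : t ^ (P.p - 2) = t ^ (P.α i j - 1) * t ^ (P.β i j - 1) := by
    rw [← rpow_add ht, ← P.α_add_β i j]; ring_nf
  linear_combination
    -(P.κ i j * P.p * (z i ^ (P.α i j - 2) * z j ^ P.β i j)) * h1 -
      P.κ i j * P.p * (z i ^ (P.α i j - 1) * z j ^ (P.β i j - 1)) * h2

variable [FiniteDimensional ℝ V] {w : Fin 2 → V → ℝ}

theorem CoupledParams.IsSol.slope_decay (hw : P.IsSol w) (hv : P.Vanishing w) {ε : ℝ} (hε : 0 < ε) :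
    ∃ R > 0, ∀ i x, R ≤ ‖x‖ →
      ‖x‖ ^ (-P.σ) * P.slope (fun j => w j x) i < ε / ‖x‖ ^ 2 := by
  have hp := P.two_lt_p
  have hl := P.l_pos
  obtain ⟨B, hB, hlow⟩ := hw.exists_lower_infty
  obtain ⟨R, hR, C, hC, hup⟩ := hw.exists_upper_infty hv
  set ν := P.l / (P.p - 1) with hν
  have hν0 : 0 < ν := div_pos hl (by linarith)
  have hνl : ν * (P.p - 1) = P.l := div_mul_cancel₀ _ (by linarith)
  have hpos : ∀ j (x : V), R ≤ ‖x‖ → 0 < ‖x‖ ^ P.m * w j x := fun j x hx => by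
    have hn : 0 < ‖x‖ := by linarith
    have := hw.pos j x (norm_pos_iff.1 hn)
    positivity
  have hlow' : ∀ j (x : V), R ≤ ‖x‖ → B * ‖x‖ ^ (-P.l) ≤ ‖x‖ ^ P.m * w j x := fun j x hx => by
    have hn : 0 < ‖x‖ := by linarith
    calc B * ‖x‖ ^ (-P.l) = ‖x‖ ^ P.m * (B * ‖x‖ ^ (-(P.m + P.l))) := by
          rw [mul_left_comm, ← rpow_add hn]; ring_nf
      _ ≤ _ := by gcongr; exact hlow j x (hR.trans hx)
  have hup' : ∀ j (x : V), R ≤ ‖x‖ → ‖x‖ ^ P.m * w j x ≤ C * ‖x‖ ^ (-ν) := fun j x hx => by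
    have hn : 0 < ‖x‖ := by linarith
    calc ‖x‖ ^ P.m * w j x ≤ ‖x‖ ^ P.m * (C * ‖x‖ ^ (-(P.m + ν))) := by
          gcongr; exact hup j x hx
      _ = _ := by rw [mul_left_comm, ← rpow_add hn]; ring_nf
  have hterm : ∀ i j (s t : ℝ), 0 ≤ t → (s < 0 → 0 < P.l * s + ν * t) → 0 < s + t →
      ∃ A θ : ℝ, 0 < θ ∧ ∀ x : V, R ≤ ‖x‖ →
        (‖x‖ ^ P.m * w i x) ^ s * (‖x‖ ^ P.m * w j x) ^ t ≤ A * ‖x‖ ^ (-θ) := by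
    intro i j s t ht hs hst
    refine ⟨(if 0 ≤ s then C else B) ^ s * C ^ t,
      (if 0 ≤ s then ν * s + ν * t else P.l * s + ν * t), ?_, fun x hx => ?_⟩
    · split_ifs with h
      · rw [← mul_add]; positivity
      · exact hs (not_le.1 h)
    · exact rpow_mul_rpow_le_of_barrier (by linarith) hB hC (hlow' i x hx) (hup' i x hx)
        (hpos j x hx) (hup' j x hx) ht rfl
  have hbd : ∀ i j, ∃ A θ : ℝ, 0 < θ ∧ ∀ x : V, R ≤ ‖x‖ →
      (‖x‖ ^ P.m * w i x) ^ (P.α i j - 2) * (‖x‖ ^ P.m * w j x) ^ P.β i j ≤ A * ‖x‖ ^ (-θ) :=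
    fun i j => by
      have hα := P.one_lt_α i j
      have hβ := P.one_lt_β i j
      have hs := P.α_add_β i j
      refine hterm i j _ _ (by linarith) (fun _ => ?_) (by linarith)
      have h1 : P.l * (P.α i j - 2) + ν * P.β i j = ν * ((P.p - 2) * (P.α i j - 1)) := by
        rw [← hνl, ← hs]; ring
      rw [h1]
      exact mul_pos hν0 (mul_pos (by linarith) (by linarith))
  have hbd' : ∀ i j, ∃ A θ : ℝ, 0 < θ ∧ ∀ x : V, R ≤ ‖x‖ →
      (‖x‖ ^ P.m * w i x) ^ (P.α i j - 1) * (‖x‖ ^ P.m * w j x) ^ (P.β i j - 1) ≤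
        A * ‖x‖ ^ (-θ) := fun i j => by
      have hα := P.one_lt_α i j
      have hβ := P.one_lt_β i j
      exact hterm i j _ _ (by linarith) (fun _ => by linarith) (by linarith)
  have hlim : ∀ i, Tendsto (fun x : V => P.slope (fun j => |‖x‖ ^ P.m * w j x|) i)
      (Bornology.cobounded V) (𝓝 0) := by
    intro i
    unfold slope
    rw [show (0 : ℝ) = ∑ j : Fin 2, P.κ i j * P.p * (0 + 0) by simp]
    refine tendsto_finsetSum _ fun j _ => Tendsto.const_mul _ (Tendsto.add ?_ ?_)
    · obtain ⟨A, θ, hθ, h⟩ := hbd i j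
      refine tendsto_cobounded_of_le (R := R) (A := A) hθ (fun x => by positivity) fun x hx => ?_
      beta_reduce
      rw [abs_of_pos (hpos i x hx), abs_of_pos (hpos j x hx)]
      exact h x hx
    · obtain ⟨A, θ, hθ, h⟩ := hbd' i j
      refine tendsto_cobounded_of_le (R := R) (A := A) hθ (fun x => by positivity) fun x hx => ?_
      beta_reduce
      rw [abs_of_pos (hpos i x hx), abs_of_pos (hpos j x hx)]
      exact h x hx
  have hev : ∀ᶠ x in Bornology.cobounded V, ∀ i,
      P.slope (fun j => |‖x‖ ^ P.m * w j x|) i < ε :=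
    eventually_all.2 fun i => (hlim i).eventually_lt_const hε
  obtain ⟨R', -, hR'⟩ := (hasBasis_cobounded_norm (E := V)).eventually_iff.1 hev
  refine ⟨max R R', by linarith [le_max_left R R'], fun i x hx => ?_⟩
  have hxR : R ≤ ‖x‖ := (le_max_left _ _).trans hx
  have hn : 0 < ‖x‖ := by linarith
  have h := hR' (show x ∈ {x : V | R' ≤ ‖x‖} from (le_max_right _ _).trans hx) i
  have e : (fun j => |‖x‖ ^ P.m * w j x|) = fun j => ‖x‖ ^ P.m * w j x :=
    funext fun j => abs_of_pos (hpos j x hxR)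
  rw [e, P.slope_smul (by positivity) (fun j => hw.pos j x (norm_pos_iff.1 hn)), ← rpow_mul hn.le,
    P.m_mul_p_sub_two, rpow_sub hn, rpow_two] at h
  rw [rpow_neg hn.le, lt_div_iff₀ (by positivity)]
  calc _ = ‖x‖ ^ 2 / ‖x‖ ^ P.σ * P.slope (fun j => w j x) i := by field_simp
    _ < ε := h

end SlopeDecay

section PlaneReflection

variable {V : Type*} [NormedAddCommGroup V] [InnerProductSpace ℝ V]

/-- Reflection across the hyperplane `⟪x, e⟫ = s`, for a unit vector `e`. -/
def planeRefl (e : V) (s : ℝ) (x : V) : V := x - (2 * (inner ℝ x e - s)) • e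

variable {e : V}

theorem inner_planeRefl (he : ‖e‖ = 1) (s : ℝ) (x : V) :
    inner ℝ (planeRefl e s x) e = 2 * s - inner ℝ x e := by
  rw [planeRefl, inner_sub_left, real_inner_smul_left, real_inner_self_eq_norm_sq, he]; ring

theorem planeRefl_planeRefl (he : ‖e‖ = 1) (s : ℝ) (x : V) :
    planeRefl e s (planeRefl e s x) = x := by
  rw [planeRefl, inner_planeRefl he, planeRefl]; module

theorem planeRefl_eq_self {s : ℝ} {x : V} (h : inner ℝ x e = s) : planeRefl e s x = x := by
  rw [planeRefl, h, sub_self, mul_zero, zero_smul, sub_zero]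

theorem norm_sq_planeRefl (he : ‖e‖ = 1) (s : ℝ) (x : V) :
    ‖planeRefl e s x‖ ^ 2 = ‖x‖ ^ 2 - 4 * s * (inner ℝ x e - s) := by
  rw [planeRefl, norm_sub_sq_real, real_inner_smul_right, norm_smul, he, mul_one,
    Real.norm_eq_abs, sq_abs]
  ring

theorem norm_planeRefl (he : ‖e‖ = 1) (s : ℝ) (x : V) :
    ‖planeRefl e s x‖ = ‖x - (2 * s) • e‖ := by
  refine (pow_left_inj₀ (norm_nonneg _) (norm_nonneg _) two_ne_zero).1 ?_
  rw [norm_sq_planeRefl he, norm_sub_sq_real, real_inner_smul_right, norm_smul, he, mul_one,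
    Real.norm_eq_abs, sq_abs]
  ring

theorem planeRefl_ne_zero (he : ‖e‖ = 1) {s : ℝ} {x : V} (hx : x ≠ (2 * s) • e) :
    planeRefl e s x ≠ 0 := by
  rw [← norm_pos_iff, norm_planeRefl he]; exact norm_sub_pos_iff.2 hx

theorem norm_planeRefl_lt (he : ‖e‖ = 1) {s : ℝ} (hs : 0 < s) {x : V} (hx : s < inner ℝ x e) :
    ‖planeRefl e s x‖ < ‖x‖ := by
  refine (pow_lt_pow_iff_left₀ (norm_nonneg _) (norm_nonneg _) two_ne_zero).1 ?_
  rw [norm_sq_planeRefl he]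
  have : 0 < s * (inner ℝ x e - s) := mul_pos hs (by linarith)
  linarith

theorem inner_le_norm_of_unit (he : ‖e‖ = 1) (x : V) : inner ℝ x e ≤ ‖x‖ := by
  have := real_inner_le_norm x e
  rwa [he, mul_one] at this

theorem ne_zero_of_inner_pos {s : ℝ} (hs : 0 < s) {x : V} (hx : s ≤ inner ℝ x e) : x ≠ 0 := by
  rintro rfl
  rw [inner_zero_left] at hx
  linarith

theorem continuous_planeRefl (e : V) : Continuous fun z : ℝ × V => planeRefl e z.1 z.2 := by
  unfold planeRefl; fun_prop

variable [FiniteDimensional ℝ V]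

theorem HasLap.comp_planeRefl (he : ‖e‖ = 1) {s : ℝ} {x : V} {f : V → ℝ} {g : V} {l : ℝ}
    (hf : HasLap f (planeRefl e s x) g l) :
    ∃ g', HasLap (fun y => f (planeRefl e s y)) x g' l := by
  have key : ∀ y, (1 : ℝ) • (ℝ ∙ e)ᗮ.reflection y + (2 * s) • e = planeRefl e s y := fun y => by
    rw [Submodule.reflection_orthogonal_apply, Submodule.reflection_singleton_apply, he, planeRefl,
      real_inner_comm]
    simp only [RCLike.ofReal_real_eq_id, id]
    module
  rw [← key] at hf
  have h := hf.comp_affine ((ℝ ∙ e)ᗮ.reflection) 1 ((2 * s) • e)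
  have h2 := h.congr (h := fun y => f (planeRefl e s y)) (Eventually.of_forall fun y => by
    simp only [key])
  rw [one_pow, one_mul] at h2
  exact ⟨_, h2⟩

end PlaneReflection

section MovingPlane

open CoupledParams

variable {V : Type*} [NormedAddCommGroup V] [InnerProductSpace ℝ V] {e : V}

/-- The comparison function of the moving plane argument. -/
def planeBarrier (P : CoupledParams V) (e : V) (s k : ℝ) (x : V) : ℝ :=
  ‖x‖ ^ (-P.m) * (2 - exp (-k * (inner ℝ x e - s)))

theorem planeBarrier_bounds {s k : ℝ} (hk : 0 < k) {x : V} (hx : s ≤ inner ℝ x e) :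
    1 ≤ 2 - exp (-k * (inner ℝ x e - s)) ∧ 2 - exp (-k * (inner ℝ x e - s)) ≤ 2 := by
  have h1 : exp (-k * (inner ℝ x e - s)) ≤ 1 := exp_le_one_iff.2 (by
    rw [neg_mul]; exact neg_nonpos.2 (mul_nonneg hk.le (by linarith)))
  have h2 := exp_pos (-k * (inner ℝ x e - s))
  constructor <;> linarith

theorem planeBarrier_pos (P : CoupledParams V) {s k : ℝ} (hk : 0 < k) {x : V} (hx0 : x ≠ 0)
    (hx : s ≤ inner ℝ x e) : 0 < planeBarrier P e s k x :=
  mul_pos (rpow_pos_of_pos (norm_pos_iff.2 hx0) _)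
    (by linarith [(planeBarrier_bounds hk hx).1])

variable [FiniteDimensional ℝ V]

theorem hasLap_planeBarrier (P : CoupledParams V) (he : ‖e‖ = 1) {s k : ℝ} (hs : 0 < s) (hk : 0 < k)
    {x : V} (hx : s ≤ inner ℝ x e) : ∃ g l, HasLap (planeBarrier P e s k) x g l ∧
      l ≤ -((P.m ^ 2 / ‖x‖ ^ 2 + k ^ 2 * exp (-k * (inner ℝ x e - s)) / 2) *
        planeBarrier P e s k x) := by
  have hx0 := ne_zero_of_inner_pos hs hx
  have hn := norm_pos_iff.2 hx0
  have hE : ∀ t, HasDerivAt (fun t => 2 - exp (-k * (t - s))) (k * exp (-k * (t - s))) t :=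
    fun t => by
      have h := ((((hasDerivAt_id t).sub_const s).const_mul (-k)).exp).const_sub 2
      refine h.congr_deriv ?_
      simp only [id]; ring
  have hE' : ∀ t, HasDerivAt (fun t => k * exp (-k * (t - s))) (-(k ^ 2 * exp (-k * (t - s)))) t :=
    fun t => by
      have h := ((((hasDerivAt_id t).sub_const s).const_mul (-k)).exp).const_mul k
      refine h.congr_deriv ?_
      simp only [id]; ring
  have h1 := (hasLap_inner e x).comp (φ := fun t => 2 - exp (-k * (t - s)))
    (φ' := fun t => k * exp (-k * (t - s))) (φ'' := -(k ^ 2 * exp (-k * (inner ℝ x e - s))))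
    (Eventually.of_forall hE) (hE' _) (by fun_prop)
  have h := (hasLap_norm_rpow (-P.m) hx0).mul h1
  refine ⟨_, _, h, ?_⟩
  obtain ⟨hb1, hb2⟩ := planeBarrier_bounds (e := e) (s := s) hk hx
  unfold planeBarrier
  set E := exp (-k * (inner ℝ x e - s)) with hEdef
  have hE0 : 0 < E := exp_pos _
  simp only [real_inner_smul_left, real_inner_smul_right, he]
  set g := ‖x‖ ^ (-P.m) with hg
  have hg0 : 0 < g := rpow_pos_of_pos hn _
  have hg2 : ‖x‖ ^ (-P.m - 2) = g / ‖x‖ ^ 2 := by rw [rpow_sub hn, rpow_two]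
  rw [hg2, show (Module.finrank ℝ V : ℝ) = 2 * P.m + 2 by linarith [P.two_mul_m]]
  have hi : 0 ≤ P.m * (g / ‖x‖ ^ 2) * (k * E * inner ℝ x e) := by
    have := P.m_pos
    have : 0 < inner ℝ x e := hs.trans_le hx
    positivity
  have h5 : g * (2 - E) ≤ 2 * g := by rw [mul_comm]; gcongr
  have h6 : k ^ 2 * E / 2 * (g * (2 - E)) ≤ k ^ 2 * E / 2 * (2 * g) := by gcongr
  have h7 : -P.m * (-P.m + (2 * P.m + 2) - 2) * (g / ‖x‖ ^ 2) * (2 - E) =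
      -(P.m ^ 2 / ‖x‖ ^ 2 * (g * (2 - E))) := by field_simp; ring
  rw [add_mul]
  linarith

variable {P : CoupledParams V} {w : Fin 2 → V → ℝ}

theorem CoupledParams.IsSol.hasLap_sub_planeRefl (hw : P.IsSol w) (he : ‖e‖ = 1) {s : ℝ}
    (hs : 0 < s) (i : Fin 2) {x : V} (hx : s ≤ inner ℝ x e) (hx' : x ≠ (2 * s) • e) :
    ∃ g, HasLap (fun y => w i y - w i (planeRefl e s y)) x g
      (Δ (w i) x - Δ (w i) (planeRefl e s x)) := by
  obtain ⟨g, hg⟩ := ((hw.contDiffAt i _ (planeRefl_ne_zero he hx')).hasLap).comp_planeRefl he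
  exact ⟨_, (hw.contDiffAt i x (ne_zero_of_inner_pos hs hx)).hasLap.sub hg⟩

theorem CoupledParams.IsSol.slope_lower_of_isMax (hw : P.IsSol w) (he : ‖e‖ = 1) {s k q : ℝ}
    (hs : 0 < s) (hk : 0 < k) (hq : 0 < q) {x : V} (hx : s < inner ℝ x e) (hx' : x ≠ (2 * s) • e)
    {i : Fin 2} (hi : w i x - w i (planeRefl e s x) = q * planeBarrier P e s k x)
    (hle : ∀ᶠ y in 𝓝 x, ∀ j, w j y - w j (planeRefl e s y) ≤ q * planeBarrier P e s k y) :
    P.l ^ 2 / ‖x‖ ^ 2 + k ^ 2 * exp (-k * (inner ℝ x e - s)) / 2 ≤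
      ‖x‖ ^ (-P.σ) * P.slope (fun j => w j x) i := by
  have hx0 := ne_zero_of_inner_pos hs hx.le
  have hR0 := planeRefl_ne_zero he hx'
  have hn := norm_pos_iff.2 hx0
  have hRn := norm_pos_iff.2 hR0
  obtain ⟨g, hg⟩ := hw.hasLap_sub_planeRefl he hs i hx.le hx'
  obtain ⟨gG, lG, hG, hlG⟩ := hasLap_planeBarrier P he hs hk hx.le
  have h1 := (hG.const_mul q).le_of_eventually_le hg (hle.mono fun y hy => hy i) hi
  have hGpos := planeBarrier_pos P hk hx0 hx.le
  set D := q * planeBarrier P e s k x with hD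
  have hDpos : 0 < D := mul_pos hq hGpos
  have h2 : q * lG ≤ -((P.m ^ 2 / ‖x‖ ^ 2 + k ^ 2 * exp (-k * (inner ℝ x e - s)) / 2) * D) := by
    refine (mul_le_mul_of_nonneg_left hlG hq.le).trans_eq ?_
    rw [hD]; ring
  have hc : 0 ≤ P.m ^ 2 - P.l ^ 2 := sub_nonneg.2 (pow_le_pow_left₀ P.l_pos.le P.l_le_m 2)
  have hRlt := norm_planeRefl_lt he hs hx
  have hRpos : ∀ j, 0 < w j (planeRefl e s x) := fun j => hw.pos j _ hR0
  have h3 := P.nonlin_sub_le (X := fun j => w j x) (Y := fun j => w j (planeRefl e s x))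
    (fun j => hw.pos j x hx0) hRpos hDpos hi hle.self_of_nhds
  rw [hw.laplacian_eq i x hx0, hw.laplacian_eq i _ hR0] at h1
  have h4 : (P.m ^ 2 - P.l ^ 2) / ‖x‖ ^ 2 * w i (planeRefl e s x) ≤
      (P.m ^ 2 - P.l ^ 2) / ‖planeRefl e s x‖ ^ 2 * w i (planeRefl e s x) := by
    have := (hRpos i).le
    gcongr
  have h5 : ‖x‖ ^ (-P.σ) * P.nonlin (fun j => w j (planeRefl e s x)) i ≤
      ‖planeRefl e s x‖ ^ (-P.σ) * P.nonlin (fun j => w j (planeRefl e s x)) i := by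
    have := (P.nonlin_pos hRpos i).le
    exact mul_le_mul_of_nonneg_right (rpow_le_rpow_of_nonpos hRn hRlt.le
      (neg_nonpos.2 P.σ_nonneg)) this
  have h6 := mul_le_mul_of_nonneg_left h3 (rpow_pos_of_pos hn (-P.σ)).le
  have h7 : (P.m ^ 2 - P.l ^ 2) / ‖x‖ ^ 2 * w i x =
      (P.m ^ 2 - P.l ^ 2) / ‖x‖ ^ 2 * (w i (planeRefl e s x) + D) := by rw [← hi]; ring
  rw [h7] at h1
  refine le_of_mul_le_mul_right ?_ hDpos
  have h8 : (P.m ^ 2 - P.l ^ 2) / ‖x‖ ^ 2 = P.m ^ 2 / ‖x‖ ^ 2 - P.l ^ 2 / ‖x‖ ^ 2 := sub_div _ _ _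
  have h9 : (P.m ^ 2 - P.l ^ 2) / ‖x‖ ^ 2 * D = P.m ^ 2 / ‖x‖ ^ 2 * D - P.l ^ 2 / ‖x‖ ^ 2 * D := by
    rw [h8]; ring
  linarith

theorem CoupledParams.IsSol.lt_planeRefl (hw : P.IsSol w) (he : ‖e‖ = 1) {s : ℝ} (hs : 0 < s)
    (hgood : ∀ j x, s < inner ℝ x e → x ≠ (2 * s) • e → w j x ≤ w j (planeRefl e s x))
    (i : Fin 2) {x : V} (hx : s < inner ℝ x e) (hx' : x ≠ (2 * s) • e) :
    Δ (w i) (planeRefl e s x) < Δ (w i) x ∧ w i x < w i (planeRefl e s x) := by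
  have hx0 := ne_zero_of_inner_pos hs hx.le
  have hR0 := planeRefl_ne_zero he hx'
  have hn := norm_pos_iff.2 hx0
  have hRn := norm_pos_iff.2 hR0
  have hRlt := norm_planeRefl_lt he hs hx
  have hc : 0 ≤ P.m ^ 2 - P.l ^ 2 := sub_nonneg.2 (pow_le_pow_left₀ P.l_pos.le P.l_le_m 2)
  have hlap : Δ (w i) (planeRefl e s x) < Δ (w i) x := by
    rw [hw.laplacian_eq i x hx0, hw.laplacian_eq i _ hR0]
    have hwle := hgood i x hx hx'
    have hwi := hw.pos i x hx0
    have hRpos : ∀ j, 0 < w j (planeRefl e s x) := fun j => hw.pos j _ hR0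
    have hF := P.nonlin_mono (fun j => hw.pos j x hx0) (fun j => hgood j x hx hx') i
    have hFpos := P.nonlin_pos (fun j => hw.pos j x hx0) i
    have h1 : (P.m ^ 2 - P.l ^ 2) / ‖x‖ ^ 2 * w i x ≤
        (P.m ^ 2 - P.l ^ 2) / ‖planeRefl e s x‖ ^ 2 * w i x := by gcongr
    have h2 : (P.m ^ 2 - P.l ^ 2) / ‖planeRefl e s x‖ ^ 2 * w i x ≤
        (P.m ^ 2 - P.l ^ 2) / ‖planeRefl e s x‖ ^ 2 * w i (planeRefl e s x) := by gcongr
    have h3 : ‖x‖ ^ (-P.σ) * P.nonlin (fun j => w j x) i ≤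
        ‖planeRefl e s x‖ ^ (-P.σ) * P.nonlin (fun j => w j x) i :=
      mul_le_mul_of_nonneg_right (rpow_le_rpow_of_nonpos hRn hRlt.le
        (neg_nonpos.2 P.σ_nonneg)) hFpos.le
    have h4 := mul_le_mul_of_nonneg_left hF (rpow_pos_of_pos hRn (-P.σ)).le
    rcases P.strict with h | h
    · have hc' : 0 < P.m ^ 2 - P.l ^ 2 := sub_pos.2 (pow_lt_pow_left₀ h P.l_pos.le two_ne_zero)
      have h5 : (P.m ^ 2 - P.l ^ 2) / ‖x‖ ^ 2 * w i x <
          (P.m ^ 2 - P.l ^ 2) / ‖planeRefl e s x‖ ^ 2 * w i x := by gcongr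
      linarith
    · have h5 : ‖x‖ ^ (-P.σ) * P.nonlin (fun j => w j x) i <
          ‖planeRefl e s x‖ ^ (-P.σ) * P.nonlin (fun j => w j x) i :=
        mul_lt_mul_of_pos_right (rpow_lt_rpow_of_neg hRn hRlt (neg_neg_of_pos h)) hFpos
      linarith
  refine ⟨hlap, lt_of_le_of_ne (hgood i x hx hx') fun heq => ?_⟩
  obtain ⟨g, hg⟩ := hw.hasLap_sub_planeRefl he hs i hx.le hx'
  have hcn : Continuous fun y : V => inner ℝ y e := by fun_prop
  have h1 := (HasLap.const 0 x).le_of_eventually_le hg (by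
    filter_upwards [(isOpen_lt continuous_const hcn).mem_nhds hx, isOpen_ne.mem_nhds hx']
      with y hy hy'
    exact sub_nonpos.2 (hgood i y hy hy')) (sub_eq_zero.2 heq)
  linarith

end MovingPlane

section MovingPlaneStart

open CoupledParams

variable {V : Type*} [NormedAddCommGroup V] [InnerProductSpace ℝ V]

/-- The solution is dominated by its reflection beyond the hyperplane `⟪x, e⟫ = s`, at distance less
than `ρ` from the reflected origin. -/
def PlaneDominated (w : Fin 2 → V → ℝ) (e : V) (s ρ : ℝ) : Prop :=
  ∀ i x, s < inner ℝ x e → x ≠ (2 * s) • e → ‖x - (2 * s) • e‖ < ρ → w i x ≤ w i (planeRefl e s x)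

variable [FiniteDimensional ℝ V] {P : CoupledParams V} {w : Fin 2 → V → ℝ} {e : V}

theorem CoupledParams.IsSol.exists_slope_lower (hw : P.IsSol w) (hv : P.Vanishing w) (he : ‖e‖ = 1)
    {s k ρ : ℝ} (hs : 0 < s) (hk : 0 < k) (hρ : 0 < ρ) (hsafe : PlaneDominated w e s ρ)
    {i₁ : Fin 2} {x₁ : V} (hx₁ : s < inner ℝ x₁ e) (hx₁' : x₁ ≠ (2 * s) • e)
    (hbad : w i₁ (planeRefl e s x₁) < w i₁ x₁) :
    ∃ i x, s < inner ℝ x e ∧ x ≠ (2 * s) • e ∧ ρ ≤ ‖x - (2 * s) • e‖ ∧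
      w i (planeRefl e s x) < w i x ∧
      P.l ^ 2 / ‖x‖ ^ 2 + k ^ 2 * exp (-k * (inner ℝ x e - s)) / 2 ≤
        ‖x‖ ^ (-P.σ) * P.slope (fun j => w j x) i := by
  set D : Fin 2 → V → ℝ := fun i x => (w i x - w i (planeRefl e s x)) / planeBarrier P e s k x
    with hD
  set ψ : V → ℝ := fun x => max (D 0 x) (D 1 x) with hψ
  have hDψ : ∀ i x, D i x ≤ ψ x := fun i x => by
    fin_cases i
    · exact le_max_left _ _
    · exact le_max_right _ _
  have hψD : ∀ x, ∃ i, ψ x = D i x := fun x => by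
    rcases max_choice (D 0 x) (D 1 x) with h | h
    · exact ⟨0, h⟩
    · exact ⟨1, h⟩
  have hx₁0 := ne_zero_of_inner_pos hs hx₁.le
  have hGpos : ∀ x : V, s ≤ inner ℝ x e → 0 < planeBarrier P e s k x := fun x hx =>
    planeBarrier_pos P hk (ne_zero_of_inner_pos hs hx) hx
  have hψ₁ : 0 < ψ x₁ := lt_of_lt_of_le (div_pos (sub_pos.2 hbad) (hGpos x₁ hx₁.le)) (hDψ i₁ x₁)
  obtain ⟨R, hR, hinf⟩ := hv.infty (ψ x₁) hψ₁
  have hfar : ∀ x : V, s ≤ inner ℝ x e → x ≠ (2 * s) • e → R ≤ ‖x‖ → ψ x ≤ ψ x₁ := by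
    intro x hx hx' hxR
    obtain ⟨i, hi⟩ := hψD x
    have hn : 0 < ‖x‖ := norm_pos_iff.2 (ne_zero_of_inner_pos hs hx)
    have h1 := hw.pos i _ (planeRefl_ne_zero he hx')
    have h2 := hw.pos i x (ne_zero_of_inner_pos hs hx)
    have h3 := (planeBarrier_bounds (e := e) (s := s) hk hx).1
    rw [hi]
    refine le_trans ?_ (hinf i x hxR)
    rw [hD]
    refine (div_le_iff₀ (hGpos x hx)).2 ?_
    have h4 : ‖x‖ ^ P.m * w i x * planeBarrier P e s k x =
        w i x * (2 - exp (-k * (inner ℝ x e - s))) := by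
      rw [planeBarrier, rpow_neg hn.le]; field_simp
    rw [h4]
    have h5 := mul_le_mul_of_nonneg_left h3 h2.le
    linarith
  have hci : Continuous fun x : V => inner ℝ x e := by fun_prop
  have hcn : Continuous fun x : V => ‖x - (2 * s) • e‖ := by fun_prop
  set K : Set V := {x | ‖x‖ ≤ max R ‖x₁‖ ∧ s ≤ inner ℝ x e ∧ ρ ≤ ‖x - (2 * s) • e‖} with hKdef
  have hK : IsCompact K :=
    (isCompact_closedBall (0 : V) (max R ‖x₁‖)).of_isClosed_subset
      ((isClosed_le continuous_norm continuous_const).inter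
        ((isClosed_le continuous_const hci).inter (isClosed_le continuous_const hcn)))
      fun x hx => mem_closedBall_zero_iff.2 hx.1
  have hKne : ∀ x ∈ K, x ≠ (2 * s) • e := fun x hx =>
    norm_sub_pos_iff.1 (hρ.trans_le hx.2.2)
  have hx₁K : x₁ ∈ K := ⟨le_max_right _ _, hx₁.le, not_lt.1 fun h =>
    absurd (hsafe i₁ x₁ hx₁ hx₁' h) (not_le.2 hbad)⟩
  have hcont : ContinuousOn ψ K := fun x hx => by
    have hDc : ∀ i, ContinuousAt (D i) x := fun i => by
      obtain ⟨g, hg⟩ := hw.hasLap_sub_planeRefl he hs i hx.2.1 (hKne x hx)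
      obtain ⟨_, _, hG, -⟩ := hasLap_planeBarrier P he hs hk hx.2.1
      exact hg.contDiffAt.continuousAt.div hG.contDiffAt.continuousAt (hGpos x hx.2.1).ne'
    exact ContinuousAt.continuousWithinAt (f := ψ) ((hDc 0).max (hDc 1))
  obtain ⟨x, hxK, hmax⟩ := hK.exists_isMaxOn ⟨x₁, hx₁K⟩ hcont
  have hx' := hKne x hxK
  have hψx : ψ x₁ ≤ ψ x := hmax hx₁K
  have hψpos : 0 < ψ x := hψ₁.trans_le hψx
  have hxs : s < inner ℝ x e := lt_of_le_of_ne hxK.2.1 fun h => by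
    obtain ⟨i, hi⟩ := hψD x
    rw [hi, hD] at hψpos
    simp only [planeRefl_eq_self h.symm, sub_self, zero_div, lt_self_iff_false] at hψpos
  have hall : ∀ y : V, s < inner ℝ y e → y ≠ (2 * s) • e → ψ y ≤ ψ x := by
    intro y hy hy'
    by_cases h1 : ‖y - (2 * s) • e‖ < ρ
    · obtain ⟨i, hi⟩ := hψD y
      rw [hi]
      exact (div_nonpos_of_nonpos_of_nonneg (sub_nonpos.2 (hsafe i y hy hy' h1))
        (hGpos y hy.le).le).trans hψpos.le
    · by_cases h2 : ‖y‖ ≤ max R ‖x₁‖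
      · exact hmax ⟨h2, hy.le, not_lt.1 h1⟩
      · exact (hfar y hy.le hy' ((le_max_left _ _).trans (not_le.1 h2).le)).trans hψx
  obtain ⟨i, hi⟩ := hψD x
  have hGx := hGpos x hxs.le
  have hval : w i x - w i (planeRefl e s x) = ψ x * planeBarrier P e s k x := by
    rw [hi, hD]; exact (div_mul_cancel₀ _ hGx.ne').symm
  refine ⟨i, x, hxs, hx', hxK.2.2, ?_, hw.slope_lower_of_isMax he hs hk hψpos hxs hx' hval ?_⟩
  · have := mul_pos hψpos hGx
    linarith
  · filter_upwards [(isOpen_lt continuous_const hci).mem_nhds hxs, isOpen_ne.mem_nhds hx']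
      with y hy hy' j
    exact (div_le_iff₀ (hGpos y (le_of_lt hy))).1 ((hDψ j y).trans (hall y hy hy'))

/-- Domination beyond the whole hyperplane. -/
def PlaneGood (w : Fin 2 → V → ℝ) (e : V) (s : ℝ) : Prop :=
  ∀ i x, s < inner ℝ x e → x ≠ (2 * s) • e → w i x ≤ w i (planeRefl e s x)

theorem CoupledParams.IsSol.exists_slope_lower_of_not_good (hw : P.IsSol w) (hv : P.Vanishing w)
    (he : ‖e‖ = 1) {s k ρ R₀ : ℝ} (hs : 0 < s) (hk : 0 < k) (hρ : 0 < ρ)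
    (hR₀ : ∀ i x, R₀ ≤ ‖x‖ → ‖x‖ ^ (-P.σ) * P.slope (fun j => w j x) i < P.l ^ 2 / ‖x‖ ^ 2)
    (hsafe : PlaneDominated w e s ρ) (hbad : ¬ PlaneGood w e s) :
    ∃ i x, s < inner ℝ x e ∧ ρ ≤ ‖x - (2 * s) • e‖ ∧ ‖x‖ < R₀ ∧
      w i (planeRefl e s x) < w i x ∧
      k ^ 2 * exp (-k * (inner ℝ x e - s)) / 2 ≤ ‖x‖ ^ (-P.σ) * P.slope (fun j => w j x) i := by
  unfold PlaneGood at hbad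
  push Not at hbad
  obtain ⟨i₁, x₁, h1, h2, h3⟩ := hbad
  obtain ⟨i, x, hx, -, hxρ, hlt, h⟩ := hw.exists_slope_lower hv he hs hk hρ hsafe h1 h2 h3
  have hn : 0 < ‖x‖ := norm_pos_iff.2 (ne_zero_of_inner_pos hs hx.le)
  have e1 : 0 ≤ P.l ^ 2 / ‖x‖ ^ 2 := by positivity
  have e2 : 0 ≤ k ^ 2 * exp (-k * (inner ℝ x e - s)) / 2 := by positivity
  refine ⟨i, x, hx, hxρ, ?_, hlt, by linarith⟩
  by_contra! hcon
  have := hR₀ i x hcon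
  linarith

theorem CoupledParams.IsSol.exists_forall_good (hw : P.IsSol w) (hv : P.Vanishing w)
    (he : ‖e‖ = 1) : ∃ S, ∀ s, S ≤ s → PlaneGood w e s := by
  obtain ⟨R₀, hR₀pos, hR₀⟩ := hw.slope_decay hv (pow_pos P.l_pos 2)
  obtain ⟨ℓ, hℓ, hlow⟩ := hw.exists_lower_punctured
  obtain ⟨R, hR, hinf⟩ := hv.infty ℓ hℓ
  refine ⟨max (max R₀ R) 1, fun s hs => ?_⟩
  have hs0 : R₀ ≤ s := (le_max_left _ _).trans ((le_max_left _ _).trans hs)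
  have hs1 : R ≤ s := (le_max_right _ _).trans ((le_max_left _ _).trans hs)
  have hs2 : 1 ≤ s := (le_max_right _ _).trans hs
  have hspos : 0 < s := by linarith
  by_contra hbad
  have hsafe : PlaneDominated w e s 1 := fun i x hx hx' hxρ => by
    have hxs : s < ‖x‖ := hx.trans_le (inner_le_norm_of_unit he x)
    have h1 := hlow i _ (planeRefl_ne_zero he hx') (by rw [norm_planeRefl he]; exact hxρ.le)
    have h2 := hinf i x (hs1.trans hxs.le)
    have h3 : 1 ≤ ‖x‖ ^ P.m := one_le_rpow (by linarith) P.m_pos.le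
    have h4 := hw.pos i x (ne_zero_of_inner_pos hspos hx.le)
    have h5 : 1 * w i x ≤ ‖x‖ ^ P.m * w i x := by gcongr
    linarith
  obtain ⟨i, x, hx, -, hxR, -⟩ :=
    hw.exists_slope_lower_of_not_good hv he hspos one_pos one_pos hR₀ hsafe hbad
  have := hx.trans_le (inner_le_norm_of_unit he x)
  linarith

theorem CoupledParams.IsSol.continuousAt_planeRefl (hw : P.IsSol w) (he : ‖e‖ = 1) (i : Fin 2)
    {s : ℝ} {x : V} (hx : x ≠ (2 * s) • e) :
    ContinuousAt (fun z : ℝ × V => w i (planeRefl e z.1 z.2)) (s, x) :=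
  ContinuousAt.comp (f := fun z : ℝ × V => planeRefl e z.1 z.2) (g := w i) (x := (s, x))
    (hw.contDiffAt i _ (planeRefl_ne_zero he hx)).continuousAt
    (continuous_planeRefl e).continuousAt

theorem CoupledParams.IsSol.good_of_forall_gt (hw : P.IsSol w) (he : ‖e‖ = 1) {s : ℝ}
    (h : ∀ s', s < s' → PlaneGood w e s') : PlaneGood w e s := by
  intro i x hx hx'
  have h1 : Tendsto (fun s' => w i (planeRefl e s' x)) (𝓝[>] s) (𝓝 (w i (planeRefl e s x))) :=
    tendsto_nhdsWithin_of_tendsto_nhds <|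
      (hw.continuousAt_planeRefl he i hx').comp (f := fun s' => (s', x)) (x := s)
        (by fun_prop)
  refine ge_of_tendsto h1 ?_
  have hc : Continuous fun s' : ℝ => (2 * s') • e := by fun_prop
  filter_upwards [self_mem_nhdsWithin, nhdsWithin_le_nhds (Iio_mem_nhds hx),
    nhdsWithin_le_nhds ((isOpen_ne_fun continuous_const hc).mem_nhds hx')] with s' h2 h3 h4
  exact h s' h2 i x h3 h4

end MovingPlaneStart

section MovingPlaneDescent

open CoupledParams

variable {V : Type*} [NormedAddCommGroup V] [InnerProductSpace ℝ V] [FiniteDimensional ℝ V]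
variable {P : CoupledParams V} {w : Fin 2 → V → ℝ} {e : V}

theorem CoupledParams.IsSol.slope_bounded_annulus (hw : P.IsSol w) {r R : ℝ} (hr : 0 < r) :
    ∃ M, ∀ i x, r ≤ ‖x‖ → ‖x‖ ≤ R → ‖x‖ ^ (-P.σ) * P.slope (fun j => w j x) i ≤ M := by
  have : ∀ i, ∃ M, ∀ x, r ≤ ‖x‖ → ‖x‖ ≤ R → ‖x‖ ^ (-P.σ) * P.slope (fun j => w j x) i ≤ M := by
    intro i
    have hc : ContinuousOn (fun x : V => ‖x‖ ^ (-P.σ) * P.slope (fun j => w j x) i)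
        {x | r ≤ ‖x‖ ∧ ‖x‖ ≤ R} := by
      intro x hx
      have hx0 : x ≠ 0 := norm_pos_iff.1 (hr.trans_le hx.1)
      have hwc : ∀ j (γ : ℝ), ContinuousAt (fun x => w j x ^ γ) x := fun j γ =>
        (hw.contDiffAt j x hx0).continuousAt.rpow_const (Or.inl (hw.pos j x hx0).ne')
      refine ContinuousAt.continuousWithinAt
        ((continuous_norm.continuousAt.rpow_const (Or.inl (norm_ne_zero_iff.2 hx0))).mul ?_)
      unfold slope
      exact tendsto_finsetSum _ fun j _ => ((((hwc i _).mul (hwc j _)).add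
        ((hwc i _).mul (hwc j _))).const_mul _)
    obtain ⟨M, hM⟩ := (isCompact_annulus r R).bddAbove_image hc
    exact ⟨M, fun x h1 h2 => hM ⟨x, ⟨h1, h2⟩, rfl⟩⟩
  choose M hM using this
  refine ⟨max (M 0) (M 1), fun i x h1 h2 => (hM i x h1 h2).trans ?_⟩
  fin_cases i
  · exact le_max_left _ _
  · exact le_max_right _ _

theorem CoupledParams.IsSol.exists_uniform_dominated (hw : P.IsSol w) (he : ‖e‖ = 1) {s : ℝ}
    (hs : 0 < s) (hgood : PlaneGood w e s) :
    ∃ ρ > 0, ∀ᶠ s' in 𝓝 s, PlaneDominated w e s' ρ := by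
  set z : V := (2 * s) • e with hz
  have hzn : ‖z‖ = 2 * s := by
    rw [hz, norm_smul, he, mul_one, Real.norm_eq_abs, abs_of_pos (by linarith)]
  have hz0 : z ≠ 0 := norm_pos_iff.1 (by rw [hzn]; linarith)
  have hze : inner ℝ z e = 2 * s := by
    rw [hz, real_inner_smul_left, real_inner_self_eq_norm_sq, he]; ring
  have hin : ∀ x : V, ‖x - z‖ ≤ s / 2 → s < inner ℝ x e := fun x hx => by
    have h1 := inner_le_norm_of_unit he (z - x)
    rw [inner_sub_left, hze, norm_sub_rev] at h1
    linarith
  have hcn : Continuous fun x : V => ‖x - z‖ := by fun_prop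
  have key : ∀ i, ∃ η > 0, ∀ x, x ≠ z → ‖x - z‖ ≤ s / 2 → η ≤ w i (planeRefl e s x) - w i x := by
    intro i
    have hL : ∀ x, x ≠ z → ‖x - z‖ ≤ s / 2 → ∃ g,
        HasLap (fun y => w i (planeRefl e s y) - w i y) x g
          (Δ (w i) (planeRefl e s x) - Δ (w i) x) := fun x hx hx' => by
      obtain ⟨g, hg⟩ := ((hw.contDiffAt i _ (planeRefl_ne_zero he hx)).hasLap).comp_planeRefl he
      exact ⟨_, hg.sub (hw.contDiffAt i x (ne_zero_of_inner_pos hs (hin x hx').le)).hasLap⟩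
    have hpos : ∀ x, x ≠ z → ‖x - z‖ ≤ s / 2 → 0 < w i (planeRefl e s x) - w i x := fun x hx hx' =>
      sub_pos.2 (hw.lt_planeRefl he hs hgood i (hin x hx') hx).2
    have hK : IsCompact {x : V | ‖x - z‖ = s / 2} := by
      have := isCompact_sphere z (s / 2)
      convert this using 1
      ext x; exact mem_sphere_iff_norm.symm
    have hne : ∀ x ∈ {x : V | ‖x - z‖ = s / 2}, x ≠ z := fun x hx => norm_sub_pos_iff.1 (by
      rw [show ‖x - z‖ = s / 2 from hx]; linarith)
    obtain ⟨η, hη, hηle⟩ : ∃ η > 0, ∀ x, ‖x - z‖ = s / 2 → η ≤ w i (planeRefl e s x) - w i x := by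
      rcases Set.eq_empty_or_nonempty {x : V | ‖x - z‖ = s / 2} with h | h
      · exact ⟨1, one_pos, fun x hx => absurd
          (show x ∈ {x : V | ‖x - z‖ = s / 2} from hx) (by simp [h])⟩
      · obtain ⟨x, hx, hmin⟩ := hK.exists_isMinOn h
          (f := fun y => w i (planeRefl e s y) - w i y) fun y hy => by
            obtain ⟨g, hg⟩ := hL y (hne y hy) (le_of_eq hy)
            exact hg.contDiffAt.continuousAt.continuousWithinAt
        exact ⟨_, hpos x (hne x hx) (le_of_eq hx), fun y hy => hmin hy⟩
    refine ⟨η, hη, le_of_laplacian_neg_punctured P.m_pos P.two_mul_m (fun x hx hx' => ?_)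
      (fun x hx hx' => (hpos x hx hx').le) (fun x hx hx' => ?_) hηle⟩
    · obtain ⟨g, hg⟩ := hL x hx hx'
      exact hg.contDiffAt
    · obtain ⟨g, hg⟩ := hL x hx hx'.le
      rw [hg.laplacian_eq]
      exact sub_neg.2 (hw.lt_planeRefl he hs hgood i (hin x hx'.le) hx).1
  have hball : ∀ i, ∃ δ > 0, (∀ y : V, y ≠ 0 → ‖y‖ < δ → ∀ x, ‖x - z‖ < δ → w i x ≤ w i y) := by
    intro i
    obtain ⟨η, hη, hle⟩ := key i
    obtain ⟨δ, hδ, hδc⟩ := Metric.continuousAt_iff.1 (hw.contDiffAt i z hz0).continuousAt (η / 2)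
      (by positivity)
    have hδ' : ∀ x : V, ‖x - z‖ < δ → |w i x - w i z| < η / 2 := fun x hx => by
      have := hδc (x := x) (by rwa [dist_eq_norm])
      rwa [Real.dist_eq] at this
    refine ⟨min δ (s / 2), lt_min hδ (by linarith), fun y hy hy' x hx => ?_⟩
    have hn : ‖planeRefl e s y - z‖ = ‖y‖ := by
      rw [hz, ← norm_planeRefl he, planeRefl_planeRefl he]
    have h1 := hle (planeRefl e s y) (norm_sub_pos_iff.1 (by rw [hn]; exact norm_pos_iff.2 hy))
      (by rw [hn]; exact (hy'.trans_le (min_le_right _ _)).le)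
    rw [planeRefl_planeRefl he] at h1
    have h2 := abs_lt.1 (hδ' _ (by rw [hn]; exact hy'.trans_le (min_le_left _ _)))
    have h3 := abs_lt.1 (hδ' x (hx.trans_le (min_le_left _ _)))
    linarith [h2.1, h3.2]
  choose δ hδ hδle using hball
  set ρ := min (δ 0) (δ 1) / 2 with hρ
  have hρ0 : 0 < ρ := half_pos (lt_min (hδ 0) (hδ 1))
  have hρδ : ∀ i, 2 * ρ ≤ δ i := fun i => by
    rw [hρ, mul_div_cancel₀ _ two_ne_zero]
    fin_cases i
    · exact min_le_left _ _
    · exact min_le_right _ _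
  have hc : Continuous fun s' : ℝ => ‖(2 * s') • e - z‖ := by fun_prop
  refine ⟨ρ, hρ0, ?_⟩
  filter_upwards [(isOpen_lt hc continuous_const).mem_nhds
    (show ‖(2 * s) • e - z‖ < ρ by rw [hz, sub_self, norm_zero]; exact hρ0)] with s' hs' i x _ hx hxρ
  have hs'' : ‖(2 * s') • e - z‖ < ρ := hs'
  refine hδle i _ (planeRefl_ne_zero he hx) ?_ x ?_
  · rw [norm_planeRefl he]; linarith [hρδ i]
  · have h1 : ‖x - z‖ ≤ ‖x - (2 * s') • e‖ + ‖(2 * s') • e - z‖ := by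
      have := norm_add_le (x - (2 * s') • e) ((2 * s') • e - z)
      rwa [sub_add_sub_cancel] at this
    linarith [hρδ i]

theorem CoupledParams.IsSol.eventually_good (hw : P.IsSol w) (hv : P.Vanishing w) (he : ‖e‖ = 1)
    {s : ℝ} (hs : 0 < s) (hgood : PlaneGood w e s) : ∀ᶠ s' in 𝓝 s, PlaneGood w e s' := by
  obtain ⟨R₀, hR₀pos, hR₀⟩ := hw.slope_decay hv (pow_pos P.l_pos 2)
  obtain ⟨M, hM⟩ := hw.slope_bounded_annulus (r := s / 2) (R := R₀) (by linarith)
  obtain ⟨ρ, hρ, hdom⟩ := hw.exists_uniform_dominated he hs hgood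
  obtain ⟨k, hk, hkM⟩ : ∃ k : ℝ, 0 < k ∧ M < k ^ 2 * exp (-1) / 2 := by
    have h1 : Tendsto (fun k : ℝ => k ^ 2 * exp (-1) / 2) atTop atTop :=
      ((tendsto_pow_atTop two_ne_zero).atTop_mul_const (exp_pos _)).atTop_div_const two_pos
    obtain ⟨k, h2, h3⟩ := ((eventually_gt_atTop 0).and (h1.eventually_gt_atTop M)).exists
    exact ⟨k, h2, h3⟩
  have hci : Continuous fun x : V => inner ℝ x e := by fun_prop
  have hcn : Continuous fun x : V => ‖x - (2 * s) • e‖ := by fun_prop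
  set K : Set V := {x | ‖x‖ ≤ R₀ ∧ s + 1 / (2 * k) ≤ inner ℝ x e ∧ ρ / 2 ≤ ‖x - (2 * s) • e‖}
    with hKdef
  have hK : IsCompact K :=
    (isCompact_closedBall (0 : V) R₀).of_isClosed_subset
      ((isClosed_le continuous_norm continuous_const).inter
        ((isClosed_le continuous_const hci).inter (isClosed_le continuous_const hcn)))
      fun x hx => mem_closedBall_zero_iff.2 hx.1
  have hKlt : ∀ᶠ s' in 𝓝 s, ∀ x ∈ K, ∀ i, w i x < w i (planeRefl e s' x) := by
    refine hK.eventually_forall_of_forall_eventually fun x hx => eventually_all.2 fun i => ?_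
    have hk' : 0 < 1 / (2 * k) := by positivity
    have hxs : s < inner ℝ x e := by linarith [hx.2.1]
    have hxz : x ≠ (2 * s) • e := norm_sub_pos_iff.1 (by linarith [hx.2.2])
    have h1 := hw.continuousAt_planeRefl he i hxz
    have h2 : ContinuousAt (fun z : ℝ × V => w i z.2) (s, x) :=
      ContinuousAt.comp (f := fun z : ℝ × V => z.2) (g := w i) (x := (s, x))
        (hw.contDiffAt i x (ne_zero_of_inner_pos hs hxs.le)).continuousAt continuousAt_snd
    exact h2.eventually_lt h1 (hw.lt_planeRefl he hs hgood i hxs hxz).2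
  have hc : Continuous fun s' : ℝ => ‖(2 * s') • e - (2 * s) • e‖ := by fun_prop
  have hk2 : 0 < 1 / (2 * k) := by positivity
  filter_upwards [hdom, hKlt, (isOpen_lt hc continuous_const).mem_nhds
    (show ‖(2 * s) • e - (2 * s) • e‖ < ρ / 2 by rw [sub_self, norm_zero]; positivity),
    Ioi_mem_nhds (show s / 2 < s by linarith),
    Ioi_mem_nhds (show s - 1 / (2 * k) < s by linarith)] with s' h1 h2 h3 h4 h5
  have h3' : ‖(2 * s') • e - (2 * s) • e‖ < ρ / 2 := h3
  have h4' : s / 2 < s' := h4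
  have h5' : s - 1 / (2 * k) < s' := h5
  by_contra hbad
  obtain ⟨i, x, hx, hxρ, hxR, hlt, hsl⟩ :=
    hw.exists_slope_lower_of_not_good hv he (by linarith) hk hρ hR₀ h1 hbad
  have hxn := inner_le_norm_of_unit he x
  have h6 := hM i x (by linarith) hxR.le
  have h7 : exp (-k * (inner ℝ x e - s')) < exp (-1) := by
    have : 0 < k ^ 2 := by positivity
    by_contra! hcon
    have : k ^ 2 * exp (-1) / 2 ≤ k ^ 2 * exp (-k * (inner ℝ x e - s')) / 2 := by gcongr
    linarith
  have h8 : 1 / k < inner ℝ x e - s' := by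
    rw [exp_lt_exp] at h7
    rw [div_lt_iff₀ hk]; linarith
  have h9 : 1 / k = 1 / (2 * k) + 1 / (2 * k) := by field_simp; norm_num
  have h10 : ‖x - (2 * s') • e‖ ≤ ‖x - (2 * s) • e‖ + ‖(2 * s') • e - (2 * s) • e‖ := by
    have := norm_sub_le (x - (2 * s) • e) ((2 * s') • e - (2 * s) • e)
    rwa [sub_sub_sub_cancel_right] at this
  have := h2 x ⟨hxR.le, by linarith, by linarith⟩ i
  linarith

theorem CoupledParams.IsSol.good_of_pos (hw : P.IsSol w) (hv : P.Vanishing w) (he : ‖e‖ = 1)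
    {s : ℝ} (hs : 0 < s) : PlaneGood w e s := by
  by_contra hbad
  obtain ⟨S, hS⟩ := hw.exists_forall_good hv he
  set B : Set ℝ := {s | 0 < s ∧ ¬ PlaneGood w e s} with hB
  have hne : B.Nonempty := ⟨s, hs, hbad⟩
  have hbdd : BddAbove B := ⟨S, fun s' hs' => le_of_lt (not_le.1 fun h => hs'.2 (hS s' h))⟩
  have hpos : 0 < sSup B := hs.trans_le (le_csSup hbdd ⟨hs, hbad⟩)
  have hgood : PlaneGood w e (sSup B) := hw.good_of_forall_gt he fun s' hs' => by
    by_contra h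
    exact absurd (le_csSup hbdd ⟨hpos.trans hs', h⟩) (not_le.2 hs')
  obtain ⟨δ, hδ, hball⟩ := Metric.eventually_nhds_iff.1 (hw.eventually_good hv he hpos hgood)
  obtain ⟨s', hs'B, hs'⟩ := exists_lt_of_lt_csSup hne (show sSup B - δ < sSup B by linarith)
  refine hs'B.2 (hball ?_)
  rw [Real.dist_eq, abs_sub_lt_iff]
  constructor <;> linarith [le_csSup hbdd hs'B]

/-- Vanishing positive solutions are radial. -/
theorem CoupledParams.IsSol.eq_of_norm_eq (hw : P.IsSol w) (hv : P.Vanishing w) (i : Fin 2)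
    {x y : V} (hx : x ≠ 0) (hxy : ‖x‖ = ‖y‖) : w i x = w i y := by
  have key : ∀ x y : V, x ≠ 0 → ‖x‖ = ‖y‖ → w i x ≤ w i y := by
    intro x y hx hxy
    rcases eq_or_ne x y with rfl | hne
    · exact le_rfl
    have hn : 0 < ‖x - y‖ := norm_sub_pos_iff.2 hne
    set e : V := ‖x - y‖⁻¹ • (x - y) with hedef
    have he : ‖e‖ = 1 := by
      rw [hedef, norm_smul, norm_inv, norm_norm, inv_mul_cancel₀ hn.ne']
    have hsq : ‖x - y‖ ^ 2 = 2 * inner ℝ x (x - y) := by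
      rw [norm_sub_sq_real, inner_sub_right, real_inner_self_eq_norm_sq, hxy]; ring
    have hie : inner ℝ x e = ‖x - y‖ / 2 := by
      rw [hedef, real_inner_smul_right]
      field_simp; linarith
    have hR : planeRefl e 0 x = y := by
      rw [planeRefl, hie, hedef, smul_smul]
      have : 2 * (‖x - y‖ / 2 - 0) * ‖x - y‖⁻¹ = 1 := by field_simp; ring
      rw [this]; module
    refine hR ▸ hw.good_of_forall_gt he (s := 0) (fun s hs => hw.good_of_pos hv he hs) i x ?_ ?_
    · rw [hie]; positivity
    · rwa [mul_zero, zero_smul]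
  have hy : y ≠ 0 := norm_pos_iff.1 (hxy ▸ norm_pos_iff.2 hx)
  exact le_antisymm (key x y hx hxy) (key y x hy hxy.symm)

end MovingPlaneDescent

section RadialProfile

theorem tendsto_deriv_zero_of_tendsto {f f' f'' : ℝ → ℝ} {L : Filter ℝ}
    (hL : ∀ p : ℝ → Prop, (∀ᶠ t in L, p t) → ∀ᶠ t in L, ∀ τ ∈ Set.Icc t (t + 1), p τ)
    (hf : ∀ t, HasDerivAt f (f' t) t) (hf' : ∀ t, HasDerivAt f' (f'' t) t)
    (h0 : Tendsto f L (𝓝 0)) (h2 : Tendsto f'' L (𝓝 0)) : Tendsto f' L (𝓝 0) := by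
  rw [Metric.tendsto_nhds] at h0 h2 ⊢
  intro ε hε
  filter_upwards [hL _ (h0 (ε / 3) (by positivity)), hL _ (h2 (ε / 3) (by positivity))] with t h1 h3
  obtain ⟨τ, hτ, hτe⟩ := exists_hasDerivAt_eq_slope f f' (show t < t + 1 by linarith)
    (fun x _ => (hf x).continuousAt.continuousWithinAt) fun x _ => hf x
  obtain ⟨ξ, hξ, hξe⟩ := exists_hasDerivAt_eq_slope f' f'' hτ.1
    (fun x _ => (hf' x).continuousAt.continuousWithinAt) fun x _ => hf' x
  have e1 := h1 t ⟨le_rfl, by linarith⟩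
  have e2 := h1 (t + 1) ⟨by linarith, le_rfl⟩
  have e3 := h3 ξ ⟨hξ.1.le, by linarith [hξ.2, hτ.2]⟩
  rw [Real.dist_eq, sub_zero] at e1 e2 e3 ⊢
  rw [add_sub_cancel_left, div_one] at hτe
  have hτt : 0 < τ - t := sub_pos.2 hτ.1
  rw [eq_div_iff hτt.ne'] at hξe
  have e4 : |f' τ - f' t| ≤ ε / 3 := by
    rw [← hξe, abs_mul, abs_of_pos hτt]
    have : τ - t ≤ 1 := by linarith [hτ.2]
    calc |f'' ξ| * (τ - t) ≤ ε / 3 * 1 := by gcongr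
      _ = _ := mul_one _
  have e5 : f' t = f (t + 1) - f t - (f' τ - f' t) := by rw [← hτe]; ring
  rw [e5]
  calc _ ≤ |f (t + 1) - f t| + |f' τ - f' t| := abs_sub _ _
    _ ≤ (|f (t + 1)| + |f t|) + |f' τ - f' t| := by gcongr; exact abs_sub _ _
    _ < ε := by linarith

theorem eventually_forall_Icc_atTop (p : ℝ → Prop) (h : ∀ᶠ t in atTop, p t) :
    ∀ᶠ t in atTop, ∀ τ ∈ Set.Icc t (t + 1), p τ := by
  obtain ⟨T, hT⟩ := eventually_atTop.1 h
  filter_upwards [eventually_ge_atTop T] with t ht τ hτ using hT τ (ht.trans hτ.1)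

theorem eventually_forall_Icc_atBot (p : ℝ → Prop) (h : ∀ᶠ t in atBot, p t) :
    ∀ᶠ t in atBot, ∀ τ ∈ Set.Icc t (t + 1), p τ := by
  obtain ⟨T, hT⟩ := eventually_atBot.1 h
  filter_upwards [eventually_le_atBot (T - 1)] with t ht τ hτ using hT τ (by linarith [hτ.2])

/-- A nondecreasing function vanishing at both ends is zero. -/
theorem eq_zero_of_monotone_of_tendsto {H : ℝ → ℝ} (hH : Monotone H) (hb : Tendsto H atBot (𝓝 0))
    (ht : Tendsto H atTop (𝓝 0)) (t : ℝ) : H t = 0 :=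
  le_antisymm (hH.ge_of_tendsto ht t) (hH.le_of_tendsto hb t)

variable {V : Type*} [NormedAddCommGroup V] [InnerProductSpace ℝ V] {P : CoupledParams V}

namespace CoupledParams

/-- Positive solutions of the radial system in logarithmic coordinates, decaying at both ends. -/
structure IsProfile (P : CoupledParams V) (y y' : Fin 2 → ℝ → ℝ) : Prop where
  pos : ∀ i t, 0 < y i t
  hasDerivAt : ∀ i t, HasDerivAt (y i) (y' i t) t
  hasDerivAt' : ∀ i t, HasDerivAt (y' i) (P.l ^ 2 * y i t - P.nonlin (fun j => y j t) i) t
  tendsto_atTop : ∀ i, Tendsto (y i) atTop (𝓝 0)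
  tendsto_atBot : ∀ i, Tendsto (y i) atBot (𝓝 0)

variable {y y' : Fin 2 → ℝ → ℝ}

theorem tendsto_nonlin_zero {L : Filter ℝ}
    (h : ∀ i, Tendsto (y i) L (𝓝 0)) (i : Fin 2) :
    Tendsto (fun t => P.nonlin (fun j => y j t) i) L (𝓝 0) := by
  unfold nonlin
  rw [show (0 : ℝ) = ∑ j : Fin 2, P.κ i j * 0 * 0 by simp]
  have key : ∀ j {γ : ℝ}, 0 < γ → Tendsto (fun t => y j t ^ γ) L (𝓝 0) := fun j γ hγ => by
    have := (h j).rpow_const (p := γ) (Or.inr hγ.le)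
    rwa [zero_rpow hγ.ne'] at this
  refine tendsto_finsetSum _ fun j _ => ((key i ?_).const_mul _).mul (key j ?_)
  · linarith [P.one_lt_α i j]
  · linarith [P.one_lt_β i j]

theorem IsProfile.tendsto_deriv (hy : P.IsProfile y y') {L : Filter ℝ}
    (hL : ∀ p : ℝ → Prop, (∀ᶠ t in L, p t) → ∀ᶠ t in L, ∀ τ ∈ Set.Icc t (t + 1), p τ)
    (h : ∀ i, Tendsto (y i) L (𝓝 0)) (i : Fin 2) : Tendsto (y' i) L (𝓝 0) := by
  refine tendsto_deriv_zero_of_tendsto hL (hy.hasDerivAt i) (hy.hasDerivAt' i) (h i) ?_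
  have := ((h i).const_mul (P.l ^ 2)).sub (tendsto_nonlin_zero (P := P) h i)
  rwa [mul_zero, sub_zero] at this

theorem IsProfile.add_pos (hy : P.IsProfile y y') (i : Fin 2) (t : ℝ) :
    0 < y' i t + P.l * y i t := by
  have hd : ∀ t, HasDerivAt (fun t => exp (-P.l * t) * (y' i t + P.l * y i t))
      (-(exp (-P.l * t) * P.nonlin (fun j => y j t) i)) t := fun t => by
    have h := (((hasDerivAt_id t).const_mul (-P.l)).exp).mul
      ((hy.hasDerivAt' i t).add ((hy.hasDerivAt i t).const_mul P.l))
    refine h.congr_deriv ?_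
    simp only [id, Pi.add_apply]; ring
  have hanti : StrictAnti fun t => exp (-P.l * t) * (y' i t + P.l * y i t) :=
    strictAnti_of_deriv_neg fun t => by
      rw [(hd t).deriv]
      exact neg_neg_of_pos (mul_pos (exp_pos _) (P.nonlin_pos (fun j => hy.pos j t) i))
  have hlim : Tendsto (fun t => exp (-P.l * t) * (y' i t + P.l * y i t)) atTop (𝓝 0) := by
    have h1 : Tendsto (fun t : ℝ => exp (-P.l * t)) atTop (𝓝 0) :=
      tendsto_exp_atBot.comp (tendsto_id.const_mul_atTop_of_neg (neg_neg_of_pos P.l_pos))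
    have h2 := h1.mul ((hy.tendsto_deriv eventually_forall_Icc_atTop hy.tendsto_atTop i).add
      ((hy.tendsto_atTop i).const_mul P.l))
    simpa using h2
  have h1 := hanti.antitone.le_of_tendsto hlim (t + 1)
  have h2 := hanti (show t < t + 1 by linarith)
  exact (mul_pos_iff_of_pos_left (exp_pos _)).1 (h1.trans_lt h2)

theorem IsProfile.sub_pos (hy : P.IsProfile y y') (i : Fin 2) (t : ℝ) :
    0 < P.l * y i t - y' i t := by
  have hd : ∀ t, HasDerivAt (fun t => exp (P.l * t) * (P.l * y i t - y' i t))
      (exp (P.l * t) * P.nonlin (fun j => y j t) i) t := fun t => by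
    have h := (((hasDerivAt_id t).const_mul P.l).exp).mul
      (((hy.hasDerivAt i t).const_mul P.l).sub (hy.hasDerivAt' i t))
    refine h.congr_deriv ?_
    simp only [id, Pi.sub_apply]; ring
  have hmono : StrictMono fun t => exp (P.l * t) * (P.l * y i t - y' i t) :=
    strictMono_of_deriv_pos fun t => by
      rw [(hd t).deriv]
      exact mul_pos (exp_pos _) (P.nonlin_pos (fun j => hy.pos j t) i)
  have hlim : Tendsto (fun t => exp (P.l * t) * (P.l * y i t - y' i t)) atBot (𝓝 0) := by
    have h1 : Tendsto (fun t : ℝ => exp (P.l * t)) atBot (𝓝 0) :=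
      tendsto_exp_atBot.comp (tendsto_id.const_mul_atBot P.l_pos)
    have h2 := h1.mul (((hy.tendsto_atBot i).const_mul P.l).sub
      (hy.tendsto_deriv eventually_forall_Icc_atBot hy.tendsto_atBot i))
    simpa using h2
  have h1 := hmono.monotone.le_of_tendsto hlim (t - 1)
  have h2 := hmono (show t - 1 < t by linarith)
  exact (mul_pos_iff_of_pos_left (exp_pos _)).1 (h1.trans_lt h2)

theorem IsProfile.hasDerivAt_nonlin (hy : P.IsProfile y y') (i : Fin 2) (t : ℝ) :
    ∃ D, HasDerivAt (fun t => P.nonlin (fun j => y j t) i) D t ∧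
      y i t * D = (P.p - 1) * y' i t * P.nonlin (fun j => y j t) i +
        ∑ j, P.κ i j * P.β i j * y i t ^ (P.α i j - 1) * y j t ^ (P.β i j - 1) *
          (y i t * y' j t - y j t * y' i t) := by
  refine ⟨_, HasDerivAt.fun_sum (u := Finset.univ) fun j _ =>
    (((hy.hasDerivAt i t).rpow_const (p := P.α i j - 1) (Or.inl (hy.pos i t).ne')).const_mul
      (P.κ i j)).mul ((hy.hasDerivAt j t).rpow_const (p := P.β i j) (Or.inl (hy.pos j t).ne')), ?_⟩
  unfold nonlin
  rw [Finset.mul_sum, Finset.mul_sum, ← Finset.sum_add_distrib]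
  refine Finset.sum_congr rfl fun j _ => ?_
  have hi := (hy.pos i t).ne'
  have hj := (hy.pos j t).ne'
  have e1 : y i t ^ (P.α i j - 1) = y i t ^ (P.α i j - 1 - 1) * y i t := by
    rw [← rpow_add_one hi]; ring_nf
  have e2 : y j t ^ (P.β i j) = y j t ^ (P.β i j - 1) * y j t := by
    rw [← rpow_add_one hj]; ring_nf
  rw [e1, e2, ← P.α_add_β i j]
  ring

end CoupledParams
end RadialProfile

section ProfileClassification

/-- A two-component monotone flow whose speeds decay at both ends is stationary. -/
theorem stationary_of_antisymmetric {q W : Fin 2 → ℝ → ℝ} {M : ℝ → ℝ} {N : Fin 2 → ℝ → ℝ}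
    (hM : ∀ t, 0 < M t) (hN : ∀ i t, 0 < N i t) (hq : ∀ i t, 0 < q i t)
    (hq' : ∀ i t, HasDerivAt (q i) (N i t * W i t) t)
    (h0 : ∀ t, HasDerivAt (W 0) (M t * (q 0 t - q 1 t)) t)
    (h1 : ∀ t, HasDerivAt (W 1) (-(M t * (q 0 t - q 1 t))) t)
    (hb : ∀ i, Tendsto (W i) atBot (𝓝 0)) (ht : ∀ i, Tendsto (W i) atTop (𝓝 0)) (t : ℝ) :
    (∀ i, W i t = 0) ∧ q 0 t = q 1 t := by
  set H : ℝ → ℝ := fun t => W 0 t * (q 0 t / (1 + q 0 t)) + W 1 t * (q 1 t / (1 + q 1 t))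
  have hfrac : ∀ i t, HasDerivAt (fun t => q i t / (1 + q i t))
      (N i t * W i t / (1 + q i t) ^ 2) t := fun i t => by
    have hne : 1 + q i t ≠ 0 := by linarith [hq i t]
    refine ((hq' i t).div ((hq' i t).const_add 1) hne).congr_deriv ?_
    field_simp
    ring
  have hd : ∀ t, HasDerivAt H (M t * (q 0 t - q 1 t) ^ 2 / ((1 + q 0 t) * (1 + q 1 t)) +
      (N 0 t * (W 0 t / (1 + q 0 t)) ^ 2 + N 1 t * (W 1 t / (1 + q 1 t)) ^ 2)) t := fun t => by
    refine (((h0 t).mul (hfrac 0 t)).add ((h1 t).mul (hfrac 1 t))).congr_deriv ?_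
    have hn0 : 1 + q 0 t ≠ 0 := by linarith [hq 0 t]
    have hn1 : 1 + q 1 t ≠ 0 := by linarith [hq 1 t]
    field_simp
    ring
  have p0 : ∀ t, 0 ≤ M t * (q 0 t - q 1 t) ^ 2 / ((1 + q 0 t) * (1 + q 1 t)) := fun t => by
    have := hM t
    have := hq 0 t
    have := hq 1 t
    positivity
  have p1 : ∀ i t, 0 ≤ N i t * (W i t / (1 + q i t)) ^ 2 := fun i t => by
    have := hN i t
    positivity
  have hmono : Monotone H := monotone_of_deriv_nonneg (fun t => (hd t).differentiableAt) fun t => by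
    rw [(hd t).deriv]
    linarith [p0 t, p1 0 t, p1 1 t]
  have hlim : ∀ {L : Filter ℝ}, (∀ i, Tendsto (W i) L (𝓝 0)) → Tendsto H L (𝓝 0) := fun {L} h => by
    have h' : ∀ i, Tendsto (fun t => W i t * (q i t / (1 + q i t))) L (𝓝 0) := fun i => by
      refine squeeze_zero_norm (a := fun t => ‖W i t‖) (fun t => ?_) (by simpa using (h i).norm)
      rw [norm_mul, Real.norm_of_nonneg (by have := hq i t; positivity : 0 ≤ q i t / (1 + q i t))]
      refine mul_le_of_le_one_right (norm_nonneg _) ?_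
      rw [div_le_one (by linarith [hq i t])]
      linarith
    simpa using (h' 0).add (h' 1)
  have hH := eq_zero_of_monotone_of_tendsto hmono (hlim hb) (hlim ht)
  have hz := (hd t).unique ((hasDerivAt_const t (0 : ℝ)).congr_of_eventuallyEq
    (Eventually.of_forall hH))
  have z0 : M t * (q 0 t - q 1 t) ^ 2 / ((1 + q 0 t) * (1 + q 1 t)) = 0 := by
    linarith [p0 t, p1 0 t, p1 1 t]
  have z1 : ∀ i, N i t * (W i t / (1 + q i t)) ^ 2 = 0 := by
    intro i
    fin_cases i
    · change N 0 t * (W 0 t / (1 + q 0 t)) ^ 2 = 0; linarith [p0 t, p1 0 t, p1 1 t]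
    · change N 1 t * (W 1 t / (1 + q 1 t)) ^ 2 = 0; linarith [p0 t, p1 0 t, p1 1 t]
  refine ⟨fun i => ?_, ?_⟩
  · have hne : 1 + q i t ≠ 0 := by linarith [hq i t]
    simpa [(hN i t).ne', hne] using z1 i
  · have hn0 : 1 + q 0 t ≠ 0 := by linarith [hq 0 t]
    have hn1 : 1 + q 1 t ≠ 0 := by linarith [hq 1 t]
    have : q 0 t - q 1 t = 0 := by simpa [(hM t).ne', hn0, hn1] using z0
    linarith

variable {V : Type*} [NormedAddCommGroup V] [InnerProductSpace ℝ V] {P : CoupledParams V}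

namespace CoupledParams

variable {y y' : Fin 2 → ℝ → ℝ}

/-- The quantity measuring the failure of a profile to be a bubble. -/
def defect (P : CoupledParams V) (y y' : Fin 2 → ℝ → ℝ) (i : Fin 2) (t : ℝ) : ℝ :=
  2 * P.l * y i t * P.nonlin (fun j => y j t) i -
    P.l * P.p * (P.l ^ 2 * y i t ^ 2 - y' i t ^ 2)

/-- The normalized ratio of the incoming and outgoing parts of a profile, constant on bubbles. -/
def ratio (P : CoupledParams V) (y y' : Fin 2 → ℝ → ℝ) (i : Fin 2) (t : ℝ) : ℝ :=
  exp (-(P.l * (P.p - 2)) * t) * ((P.l * y i t - y' i t) / (y' i t + P.l * y i t))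

theorem IsProfile.ratio_pos (hy : P.IsProfile y y') (i : Fin 2) (t : ℝ) :
    0 < P.ratio y y' i t :=
  mul_pos (exp_pos _) (div_pos (hy.sub_pos i t) (hy.add_pos i t))

theorem IsProfile.hasDerivAt_ratio (hy : P.IsProfile y y') (i : Fin 2) (t : ℝ) :
    HasDerivAt (P.ratio y y' i) (exp (-(P.l * (P.p - 2)) * t) / (y' i t + P.l * y i t) ^ 2 *
      P.defect y y' i t) t := by
  have h1 := hy.hasDerivAt i t
  have h2 := hy.hasDerivAt' i t
  have hne := (hy.add_pos i t).ne'
  have h := (((hasDerivAt_id t).const_mul (-(P.l * (P.p - 2)))).exp).mul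
    (((h1.const_mul P.l).sub h2).div (h2.add (h1.const_mul P.l)) hne)
  refine h.congr_deriv ?_
  simp only [id, Pi.add_apply, Pi.sub_apply, Pi.div_apply, defect]
  field_simp
  ring

theorem IsProfile.hasDerivAt_defect (hy : P.IsProfile y y') (i : Fin 2) (t : ℝ) :
    HasDerivAt (P.defect y y' i) (2 * P.l * ∑ j, P.κ i j * P.β i j * y i t ^ (P.α i j - 1) *
      y j t ^ (P.β i j - 1) * (y i t * y' j t - y j t * y' i t)) t := by
  obtain ⟨D, hD, hDe⟩ := hy.hasDerivAt_nonlin i t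
  have h1 := hy.hasDerivAt i t
  have h2 := hy.hasDerivAt' i t
  have h := ((h1.const_mul (2 * P.l)).mul hD).sub
    ((((h1.pow 2).const_mul (P.l ^ 2)).sub (h2.pow 2)).const_mul (P.l * P.p))
  refine h.congr_deriv ?_
  rw [← sub_eq_iff_eq_add'] at hDe
  rw [← hDe]
  push_cast
  ring

theorem IsProfile.wronskian (hy : P.IsProfile y y') (i j : Fin 2) (t : ℝ) :
    2 * P.l * (y i t * y' j t - y j t * y' i t) = exp (P.l * (P.p - 2) * t) *
      ((y' i t + P.l * y i t) * (y' j t + P.l * y j t)) *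
        (P.ratio y y' i t - P.ratio y y' j t) := by
  have hi := (hy.add_pos i t).ne'
  have hj := (hy.add_pos j t).ne'
  unfold ratio
  rw [neg_mul, exp_neg]
  have := (exp_pos (P.l * (P.p - 2) * t)).ne'
  field_simp
  ring

theorem IsProfile.tendsto_defect (hy : P.IsProfile y y') {L : Filter ℝ}
    (hL : ∀ p : ℝ → Prop, (∀ᶠ t in L, p t) → ∀ᶠ t in L, ∀ τ ∈ Set.Icc t (t + 1), p τ)
    (h : ∀ i, Tendsto (y i) L (𝓝 0)) (i : Fin 2) : Tendsto (P.defect y y' i) L (𝓝 0) := by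
  have : Tendsto (P.defect y y' i) L (𝓝 _) := (((h i).const_mul (2 * P.l)).mul (tendsto_nonlin_zero (P := P) h i)).sub
    (((((h i).pow 2).const_mul (P.l ^ 2)).sub ((hy.tendsto_deriv hL h i).pow 2)).const_mul
      (P.l * P.p))
  simpa using this

theorem IsProfile.exists_ratio_eq (hy : P.IsProfile y y') (hα : P.α 0 1 = P.β 1 0)
    (hβ : P.β 0 1 = P.α 1 0) (hκ : P.κ 0 1 / P.κ 1 0 = P.α 0 1 / P.β 0 1) :
    ∃ C, 0 < C ∧ ∀ i t, P.ratio y y' i t = C ∧ P.defect y y' i t = 0 := by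
  have hκβ : P.κ 1 0 * P.β 1 0 = P.κ 0 1 * P.β 0 1 := by
    rw [div_eq_div_iff (P.κ_pos 1 0).ne' (by linarith [P.one_lt_β 0 1])] at hκ
    rw [hκ, hα]; ring
  have hst := stationary_of_antisymmetric (q := P.ratio y y') (W := P.defect y y')
    (M := fun t => P.κ 0 1 * P.β 0 1 * y 0 t ^ (P.α 0 1 - 1) * y 1 t ^ (P.β 0 1 - 1) *
      (exp (P.l * (P.p - 2) * t) * ((y' 0 t + P.l * y 0 t) * (y' 1 t + P.l * y 1 t))))
    (N := fun i t => exp (-(P.l * (P.p - 2)) * t) / (y' i t + P.l * y i t) ^ 2)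
    (fun t => by
      have := P.κ_pos 0 1
      have := (zero_lt_one.trans (P.one_lt_β 0 1))
      have := hy.pos 0 t
      have := hy.pos 1 t
      have := hy.add_pos 0 t
      have := hy.add_pos 1 t
      positivity)
    (fun i t => div_pos (exp_pos _) (pow_pos (hy.add_pos i t) 2)) hy.ratio_pos hy.hasDerivAt_ratio
    (fun t => (hy.hasDerivAt_defect 0 t).congr_deriv (by
      rw [Fin.sum_univ_two]
      linear_combination (P.κ 0 1 * P.β 0 1 * y 0 t ^ (P.α 0 1 - 1) * y 1 t ^ (P.β 0 1 - 1)) *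
        hy.wronskian 0 1 t))
    (fun t => (hy.hasDerivAt_defect 1 t).congr_deriv (by
      rw [Fin.sum_univ_two, hκβ, ← hβ, ← hα]
      linear_combination -(P.κ 0 1 * P.β 0 1 * y 0 t ^ (P.α 0 1 - 1) * y 1 t ^ (P.β 0 1 - 1)) *
        hy.wronskian 0 1 t))
    (hy.tendsto_defect eventually_forall_Icc_atBot hy.tendsto_atBot)
    (hy.tendsto_defect eventually_forall_Icc_atTop hy.tendsto_atTop)
  have hconst : ∀ i t, P.ratio y y' i t = P.ratio y y' i 0 := fun i t =>
    is_const_of_deriv_eq_zero (fun t => (hy.hasDerivAt_ratio i t).differentiableAt) (fun t => by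
      rw [(hy.hasDerivAt_ratio i t).deriv, (hst t).1 i, mul_zero]) t 0
  refine ⟨P.ratio y y' 0 0, hy.ratio_pos 0 0, fun i t => ⟨?_, (hst t).1 i⟩⟩
  rw [hconst]
  fin_cases i
  · rfl
  · exact (hst 0).2.symm

/-- Decaying radial profiles of the symmetric system are synchronized bubbles. -/
theorem IsProfile.exists_eq (hy : P.IsProfile y y') (hα : P.α 0 1 = P.β 1 0)
    (hβ : P.β 0 1 = P.α 1 0) (hκ : P.κ 0 1 / P.κ 1 0 = P.α 0 1 / P.β 0 1) :
    ∃ (C : ℝ) (a : Fin 2 → ℝ), 0 < C ∧ (∀ i, 0 < a i) ∧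
      (∀ i t, y i t = a i * (exp (P.l * t) *
        (1 + C * exp (P.l * (P.p - 2) * t)) ^ (-(2 / (P.p - 2))))) ∧
      ∀ i, P.nonlin a i = 2 * P.l ^ 2 * P.p * C * a i := by
  obtain ⟨C, hC, hq⟩ := hy.exists_ratio_eq hα hβ hκ
  set E : ℝ → ℝ := fun t => exp (P.l * (P.p - 2) * t)
  set Y : ℝ → ℝ := fun t => exp (P.l * t) * (1 + C * E t) ^ (-(2 / (P.p - 2)))
  have hp := P.two_lt_p
  have hE : ∀ t, 0 < E t := fun t => exp_pos _
  have h1E : ∀ t, 0 < 1 + C * E t := fun t => by have := hE t; positivity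
  have hY : ∀ t, 0 < Y t := fun t => mul_pos (exp_pos _) (rpow_pos_of_pos (h1E t) _)
  have hY' : ∀ t, HasDerivAt Y (P.l * (1 - C * E t) / (1 + C * E t) * Y t) t := fun t => by
    have hE' : HasDerivAt E (P.l * (P.p - 2) * E t) t := by
      refine (((hasDerivAt_id t).const_mul (P.l * (P.p - 2))).exp).congr_deriv ?_
      simp only [id, E]; ring
    have h := (((hasDerivAt_id t).const_mul P.l).exp).mul
      (((hE'.const_mul C).const_add 1).rpow_const (p := -(2 / (P.p - 2))) (Or.inl (h1E t).ne'))
    refine h.congr_deriv ?_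
    rw [rpow_sub_one (h1E t).ne']
    simp only [id, Y]
    have h3 := (h1E t).ne'
    have h4 : P.p - 2 ≠ 0 := by linarith
    field_simp
    ring
  have hy' : ∀ i t, y' i t = P.l * (1 - C * E t) / (1 + C * E t) * y i t := fun i t => by
    have h := (hq i t).1
    have hA := (hy.add_pos i t).ne'
    have h3 := (h1E t).ne'
    unfold ratio at h
    rw [neg_mul, exp_neg, inv_mul_eq_iff_eq_mul₀ (hE t).ne', div_eq_iff hA] at h
    change _ = E t * C * _ at h
    field_simp
    linear_combination -h
  have hquot : ∀ i t, y i t / Y t = y i 0 / Y 0 := fun i t =>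
    is_const_of_deriv_eq_zero
      (fun t => ((hy.hasDerivAt i t).div (hY' t) (hY t).ne').differentiableAt) (fun t => by
        refine ((hy.hasDerivAt i t).div (hY' t) (hY t).ne').deriv.trans ?_
        rw [hy' i t, div_eq_zero_iff]
        left; ring) t 0
  have hyY : ∀ i t, y i t = y i 0 / Y 0 * Y t := fun i t => by
    rw [← hquot i t, div_mul_cancel₀ _ (hY t).ne']
  refine ⟨C, fun i => y i 0 / Y 0, hC, fun i => div_pos (hy.pos i 0) (hY 0), hyY, fun i => ?_⟩
  have hnl : P.nonlin (fun j => y j 0) i = Y 0 ^ (P.p - 1) * P.nonlin (fun j => y j 0 / Y 0) i := by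
    rw [← P.nonlin_smul (hY 0) fun j => div_pos (hy.pos j 0) (hY 0)]
    congr 1; ext j; rw [mul_div_cancel₀ _ (hY 0).ne']
  have hE0 : E 0 = 1 := by simp [E]
  have hYp : Y 0 ^ (P.p - 1) = Y 0 * (1 + C)⁻¹ ^ 2 := by
    rw [show P.p - 1 = 1 + (P.p - 2) by ring, rpow_add (hY 0), rpow_one]
    congr 1
    have : Y 0 = (1 + C) ^ (-(2 / (P.p - 2))) := by simp [Y, E]
    rw [this, ← rpow_mul (by positivity), neg_mul, div_mul_cancel₀ _ (by linarith), rpow_neg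
      (by positivity), rpow_two, inv_pow]
  have hdef := (hq i 0).2
  unfold defect at hdef
  rw [hy' i 0, hE0, mul_one, hnl, hYp] at hdef
  have hY0 := (hY 0).ne'
  have hyi := (hy.pos i 0).ne'
  have hl := P.l_pos.ne'
  have hC1 : 1 + C ≠ 0 := by positivity
  have key : 2 * P.l * y i 0 * (1 + C)⁻¹ ^ 2 * Y 0 * (P.nonlin (fun j => y j 0 / Y 0) i -
      2 * P.l ^ 2 * P.p * C * (y i 0 / Y 0)) = 0 := by
    refine Eq.trans ?_ hdef
    generalize P.nonlin (fun j => y j 0 / Y 0) i = F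
    field_simp
    ring
  have hne : 2 * P.l * y i 0 * (1 + C)⁻¹ ^ 2 * Y 0 ≠ 0 := by positivity
  exact sub_eq_zero.1 ((mul_eq_zero.1 key).resolve_left hne)

end CoupledParams
end ProfileClassification

section RadialReduction

variable {V : Type*} [NormedAddCommGroup V] [InnerProductSpace ℝ V] [FiniteDimensional ℝ V]

theorem hasLap_log_norm {x : V} (hx : x ≠ 0) :
    HasLap (fun y => log ‖y‖) x ((‖x‖ ^ 2)⁻¹ • x) ((Module.finrank ℝ V - 2) / ‖x‖ ^ 2) := by
  have hpos : 0 < ‖x‖ := norm_pos_iff.2 hx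
  have hsq : 0 < ‖x‖ ^ 2 := by positivity
  have h := (hasLap_norm_sq x).comp (φ := fun s => 1 / 2 * log s) (φ' := fun s => 1 / 2 * s⁻¹)
    (φ'' := 1 / 2 * -((‖x‖ ^ 2) ^ 2)⁻¹)
    ((eventually_gt_nhds hsq).mono fun s hs => (hasDerivAt_log hs.ne').const_mul _)
    ((hasDerivAt_inv hsq.ne').const_mul _)
    (contDiffAt_const.mul (contDiffAt_log.2 hsq.ne'))
  have e1 : (1 / 2 * (‖x‖ ^ 2)⁻¹) • (2 : ℝ) • x = (‖x‖ ^ 2)⁻¹ • x := by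
    rw [smul_smul]; congr 1; ring
  have e2 : 1 / 2 * -((‖x‖ ^ 2) ^ 2)⁻¹ * ‖(2 : ℝ) • x‖ ^ 2 +
      1 / 2 * (‖x‖ ^ 2)⁻¹ * (2 * Module.finrank ℝ V) =
        ((Module.finrank ℝ V : ℝ) - 2) / ‖x‖ ^ 2 := by
    rw [norm_smul, Real.norm_eq_abs, abs_two]
    field_simp
    ring
  have h2 := h.congr (h := fun y => log ‖y‖) (Eventually.of_forall fun y => by
    beta_reduce
    rw [log_pow]; push_cast; ring)
  rw [e1, e2] at h2
  exact h2

variable {P : CoupledParams V} {w u : Fin 2 → V → ℝ} {e : V}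

namespace CoupledParams

theorem IsSol.isProfile (hw : P.IsSol w) (hv : P.Vanishing w) (he : ‖e‖ = 1) :
    ∃ y', P.IsProfile (fun i t => exp (P.m * t) * w i (exp t • e)) y' := by
  have hnorm : ∀ t : ℝ, ‖exp t • e‖ = exp t := fun t => by
    rw [norm_smul, he, mul_one, norm_of_nonneg (exp_pos t).le]
  have hne : ∀ t : ℝ, exp t • e ≠ 0 := fun t => norm_pos_iff.1 (by rw [hnorm]; exact exp_pos t)
  set φ : Fin 2 → ℝ → ℝ := fun i t => w i (exp t • e)
  have hφc : ∀ i, ContDiff ℝ 2 (φ i) := fun i => contDiff_iff_contDiffAt.2 fun t =>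
    (hw.contDiffAt i _ (hne t)).comp t (contDiff_exp.contDiffAt.smul contDiffAt_const)
  have h1 : ∀ i t, HasDerivAt (φ i) (deriv (φ i) t) t := fun i t =>
    ((hφc i).differentiable (by simp) t).hasDerivAt
  have h2 : ∀ i t, HasDerivAt (deriv (φ i)) (deriv (deriv (φ i)) t) t := fun i t =>
    ((hφc i).differentiable_deriv_two t).hasDerivAt
  have hlap : ∀ i t, deriv (deriv (φ i)) t + 2 * P.m * deriv (φ i) t =
      -((P.m ^ 2 - P.l ^ 2) * φ i t) -
        exp ((2 - P.σ) * t) * P.nonlin (fun j => φ j t) i := fun i t => by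
    have hlog : log ‖exp t • e‖ = t := by rw [hnorm, log_exp]
    have hL := (hasLap_log_norm (hne t)).comp (φ := φ i) (φ' := deriv (φ i))
      (φ'' := deriv (deriv (φ i)) t) (Eventually.of_forall (h1 i)) (by rw [hlog]; exact h2 i t)
      (hφc i).contDiffAt
    have hL' : HasLap (w i) (exp t • e) _ _ := hL.congr (by
      filter_upwards [isOpen_compl_singleton.mem_nhds (hne t)] with z hz
      have hz0 : z ≠ 0 := hz
      refine hw.eq_of_norm_eq hv i hz0 ?_
      rw [hnorm, exp_log (norm_pos_iff.2 hz0)])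
    have hE := hL'.laplacian_eq
    rw [hw.laplacian_eq i _ (hne t), hlog, hnorm, norm_smul, hnorm, norm_inv, norm_pow,
      norm_of_nonneg (exp_pos t).le, ← P.two_mul_m, ← exp_mul] at hE
    have hexp : exp ((2 - P.σ) * t) = exp t ^ 2 * exp (t * -P.σ) := by
      rw [← exp_nat_mul, ← exp_add]; congr 1; push_cast; ring
    rw [hexp]
    change -((P.m ^ 2 - P.l ^ 2) / exp t ^ 2 * φ i t) -
      exp (t * -P.σ) * P.nonlin (fun j => φ j t) i = _ at hE
    have hx := (exp_pos t).ne'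
    generalize exp (t * -P.σ) = s, P.nonlin (fun j => φ j t) i = F at hE ⊢
    field_simp at hE
    linear_combination -hE
  refine ⟨fun i t => exp (P.m * t) * (deriv (φ i) t + P.m * φ i t), ?_, ?_, ?_, ?_, ?_⟩
  · exact fun i t => mul_pos (exp_pos _) (hw.pos i _ (hne t))
  · intro i t
    refine ((((hasDerivAt_id t).const_mul P.m).exp).mul (h1 i t)).congr_deriv ?_
    simp only [id]; ring
  · intro i t
    refine ((((hasDerivAt_id t).const_mul P.m).exp).mul
      ((h2 i t).add ((h1 i t).const_mul P.m))).congr_deriv ?_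
    rw [P.nonlin_smul (exp_pos _) fun j => hw.pos j _ (hne t), ← exp_mul,
      show P.m * t * (P.p - 1) = P.m * t + (2 - P.σ) * t by
        rw [← P.m_mul_p_sub_two]; ring, exp_add]
    simp only [id, Pi.add_apply]
    linear_combination exp (P.m * t) * hlap i t
  · intro i
    rw [Metric.tendsto_nhds]
    intro ε hε
    obtain ⟨R, hR, h⟩ := hv.infty (ε / 2) (by positivity)
    filter_upwards [tendsto_exp_atTop.eventually_ge_atTop R] with t ht
    have := h i (exp t • e) (by rwa [hnorm])
    rw [hnorm, ← exp_mul, mul_comm t] at this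
    rw [Real.dist_eq, sub_zero, abs_of_pos (mul_pos (exp_pos _) (hw.pos i _ (hne t)))]
    linarith
  · intro i
    rw [Metric.tendsto_nhds]
    intro ε hε
    obtain ⟨r, hr, h⟩ := hv.zero (ε / 2) (by positivity)
    filter_upwards [tendsto_exp_atBot.eventually_le_const hr] with t ht
    have := h i (exp t • e) (hne t) (by rwa [hnorm])
    rw [hnorm, ← exp_mul, mul_comm t] at this
    rw [Real.dist_eq, sub_zero, abs_of_pos (mul_pos (exp_pos _) (hw.pos i _ (hne t)))]
    linarith

/-- Positive finite-energy solutions of the symmetric system are synchronized bubbles. -/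
theorem IsHenonSol.exists_eq [MeasurableSpace V] [BorelSpace V] (hu : P.IsHenonSol u)
    (hE : ∀ i, Integrable fun x => ‖x‖ ^ (-(2 * (P.m - P.l))) * ‖∇ (u i) x‖ ^ 2)
    (hα : P.α 0 1 = P.β 1 0) (hβ : P.β 0 1 = P.α 1 0)
    (hκ : P.κ 0 1 / P.κ 1 0 = P.α 0 1 / P.β 0 1) (he : ‖e‖ = 1) :
    ∃ (C : ℝ) (a : Fin 2 → ℝ), 0 < C ∧ (∀ i, 0 < a i) ∧
      (∀ i x, x ≠ 0 → u i x = a i * (1 + C * ‖x‖ ^ (P.l * (P.p - 2))) ^ (-(2 / (P.p - 2)))) ∧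
      ∀ i, P.nonlin a i = 2 * P.l ^ 2 * P.p * C * a i := by
  obtain ⟨y', hy⟩ := hu.isSol.isProfile (hu.vanishing hE) he
  obtain ⟨C, a, hC, ha, hya, hnl⟩ := hy.exists_eq hα hβ hκ
  refine ⟨C, a, hC, ha, fun i x hx => ?_, hnl⟩
  have hn := norm_pos_iff.2 hx
  have h := hya i (log ‖x‖)
  have hx' : ‖x‖ = ‖exp (log ‖x‖) • e‖ := by
    rw [exp_log hn, norm_smul, he, mul_one, norm_norm]
  have hr := hu.isSol.eq_of_norm_eq (hu.vanishing hE) i hx hx'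
  beta_reduce at h hr
  rw [← hr, mul_comm P.m, mul_comm P.l, mul_comm (_ * _) (log _), exp_mul, exp_mul, exp_mul,
    exp_log hn, ← mul_assoc, ← rpow_add hn, add_sub_cancel, mul_left_comm] at h
  exact mul_left_cancel₀ (rpow_pos_of_pos hn P.l).ne' h

end CoupledParams
end RadialReduction

section Assembly

variable {n : ℕ}

theorem ContDiffAt.lapl_eq {w : EuclideanSpace ℝ (Fin n) → ℝ} {x : EuclideanSpace ℝ (Fin n)}
    (hw : ContDiffAt ℝ 2 w x) : lapl w x = Δ w x := by
  rw [hw.laplacian_eq_sum (EuclideanSpace.basisFun (Fin n) ℝ)]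
  simp only [EuclideanSpace.basisFun_apply, lapl]

theorem bubble_eq {a b p : ℝ} (hD : 0 < (n : ℝ) - 2 + 2 * (b - a)) (hba : b < a + 1)
    (hp : p = 2 * (n : ℝ) / ((n : ℝ) - 2 + 2 * (b - a))) (x : EuclideanSpace ℝ (Fin n)) :
    bubble n a b x = (2 * (((n : ℝ) - 2) / 2 - a) ^ 2 * p) ^ (1 / (p - 2)) *
      (1 + ‖x‖ ^ ((((n : ℝ) - 2) / 2 - a) * (p - 2))) ^ (-(2 / (p - 2))) := by
  have hs : 1 + a - b ≠ 0 := by linarith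
  have hD' : (n : ℝ) - 2 + 2 * (b - a) ≠ 0 := hD.ne'
  have hDe : (n : ℝ) - 2 * (1 + a - b) = (n : ℝ) - 2 + 2 * (b - a) := by ring
  have hp2 : p - 2 = 4 * (1 + a - b) / ((n : ℝ) - 2 + 2 * (b - a)) := by
    rw [hp]; field_simp; ring
  unfold bubble
  rw [hDe, hp2]
  congr 2
  · rw [hp]; field_simp
  · field_simp
  · congr 2; field_simp; ring
  · field_simp; norm_num

theorem bubbleMu_eq {a b p μ : ℝ} (hμ : 0 < μ) (hD : 0 < (n : ℝ) - 2 + 2 * (b - a))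
    (hba : b < a + 1) (hp : p = 2 * (n : ℝ) / ((n : ℝ) - 2 + 2 * (b - a)))
    (x : EuclideanSpace ℝ (Fin n)) :
    bubbleMu n a b μ x = (2 * (((n : ℝ) - 2) / 2 - a) ^ 2 * p) ^ (1 / (p - 2)) /
      μ ^ (((n : ℝ) - 2) / 2 - a) * (1 + μ ^ (-((((n : ℝ) - 2) / 2 - a) * (p - 2))) *
        ‖x‖ ^ ((((n : ℝ) - 2) / 2 - a) * (p - 2))) ^ (-(2 / (p - 2))) := by
  unfold bubbleMu
  rw [bubble_eq hD hba hp, norm_smul, norm_inv, norm_of_nonneg hμ.le,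
    mul_rpow (inv_nonneg.2 hμ.le) (norm_nonneg _), inv_rpow hμ.le, ← rpow_neg hμ.le,
    show -(((n : ℝ) - 2 - 2 * a) / 2) = -(((n : ℝ) - 2) / 2 - a) by ring,
    rpow_neg hμ.le (((n : ℝ) - 2) / 2 - a)]
  ring

/-- The parameters of the coupled Hénon–Sobolev system. -/
def henonParams {a b p : ℝ} (ha0 : 0 ≤ a) (ha : a < ((n : ℝ) - 2) / 2)
    (hb0 : 0 < b) (hab : a ≤ b) (hba : b < a + 1)
    (hp : p = 2 * (n : ℝ) / ((n : ℝ) - 2 + 2 * (b - a))) {κ α β : Fin 2 → Fin 2 → ℝ}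
    (hκ : ∀ i j, 0 < κ i j) (hα : ∀ i j, 1 < α i j) (hβ : ∀ i j, 1 < β i j)
    (hαβ : ∀ i j, α i j + β i j = p) : CoupledParams (EuclideanSpace ℝ (Fin n)) where
  l := ((n : ℝ) - 2) / 2 - a
  m := ((n : ℝ) - 2) / 2
  p := p
  σ := (b - a) * p
  κ := κ
  α := α
  β := β
  two_mul_m := by rw [finrank_euclideanSpace_fin]; ring
  l_pos := by linarith
  l_le_m := by linarith
  σ_nonneg := mul_nonneg (by linarith) (by linarith [hα 0 0, hβ 0 0, hαβ 0 0])
  two_lt_p := by linarith [hα 0 0, hβ 0 0, hαβ 0 0]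
  m_mul_p := by
    have hD : (n : ℝ) - 2 + 2 * (b - a) ≠ 0 := by linarith
    rw [finrank_euclideanSpace_fin, hp]; field_simp
  strict := by
    rcases ha0.eq_or_lt with rfl | h
    · right; exact mul_pos (by linarith) (by linarith [hα 0 0, hβ 0 0, hαβ 0 0])
    · left; linarith
  κ_pos := hκ
  one_lt_α := hα
  one_lt_β := hβ
  α_add_β := hαβ

theorem isHenonSol_of_wdiv {a b p : ℝ} (ha0 : 0 ≤ a) (ha : a < ((n : ℝ) - 2) / 2)
    (hb0 : 0 < b) (hab : a ≤ b) (hba : b < a + 1)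
    (hp : p = 2 * (n : ℝ) / ((n : ℝ) - 2 + 2 * (b - a))) {κ α β : Fin 2 → Fin 2 → ℝ}
    (hκ : ∀ i j, 0 < κ i j) (hα : ∀ i j, 1 < α i j) (hβ : ∀ i j, 1 < β i j)
    (hαβ : ∀ i j, α i j + β i j = p) {u : Fin 2 → EuclideanSpace ℝ (Fin n) → ℝ}
    (hreg : ∀ i, ContDiffOn ℝ 2 (u i) {0}ᶜ)
    (hpos : ∀ i, ∀ x : EuclideanSpace ℝ (Fin n), x ≠ 0 → 0 < u i x)
    (heq : ∀ i, ∀ x : EuclideanSpace ℝ (Fin n), x ≠ 0 →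
      -(wdiv a (u i) x) = ‖x‖ ^ (-(b * p)) *
        ∑ j, κ i j * u i x ^ (α i j - 1) * u j x ^ (β i j)) :
    (henonParams ha0 ha hb0 hab hba hp hκ hα hβ hαβ).IsHenonSol u := by
  have hc : ∀ i x, x ≠ 0 → ContDiffAt ℝ 2 (u i) x := fun i x hx =>
    (hreg i).contDiffAt (isOpen_compl_singleton.mem_nhds hx)
  refine ⟨hc, hpos, fun i x hx => ?_⟩
  have hn := norm_pos_iff.2 hx
  have h := heq i x hx
  change -(Δ (u i) x - 2 * (((n : ℝ) - 2) / 2 - (((n : ℝ) - 2) / 2 - a)) *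
    inner ℝ x (∇ (u i) x) / ‖x‖ ^ 2) = ‖x‖ ^ ((((n : ℝ) - 2) / 2 - a) * (p - 2) - 2) *
      ∑ j, κ i j * u i x ^ (α i j - 1) * u j x ^ (β i j)
  have hexp : (((n : ℝ) - 2) / 2 - a) * (p - 2) - 2 = 2 * a + -(b * p) := by
    have hD : (n : ℝ) - 2 + 2 * (b - a) ≠ 0 := by linarith
    rw [hp]; field_simp; ring
  rw [hexp, rpow_add hn, mul_assoc (‖x‖ ^ (2 * a)), ← h, wdiv, rpow_neg hn.le, (hc i x hx).lapl_eq,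
    sub_sub_cancel]
  have := (rpow_pos_of_pos hn (2 * a)).ne'
  field_simp

end Assembly

end

theorem stmt {n : ℕ} (hn : 3 ≤ n) (a b p : ℝ)
    (ha0 : 0 ≤ a) (ha : a < ((n:ℝ)-2)/2) (hb0 : 0 < b) (hab : a ≤ b) (hba : b < a + 1)
    (hp : p = 2*(n:ℝ)/((n:ℝ)-2+2*(b-a)))
    (κ α β : Fin 2 → Fin 2 → ℝ)
    (hκ : ∀ i j, 0 < κ i j) (hα : ∀ i j, 1 < α i j) (hβ : ∀ i j, 1 < β i j)
    (hαβ : ∀ i j, α i j + β i j = p)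
    (hsym₁ : α 0 1 = β 1 0) (hsym₂ : β 0 1 = α 1 0)
    (hsym₃ : κ 0 1 / κ 1 0 = α 0 1 / β 0 1)
    (u : Fin 2 → EuclideanSpace ℝ (Fin n) → ℝ)
    (hreg : ∀ i, ContDiffOn ℝ 2 (u i) {0}ᶜ)
    (hpos : ∀ i, ∀ x : EuclideanSpace ℝ (Fin n), x ≠ 0 → 0 < u i x)
    (heq : ∀ i, ∀ x : EuclideanSpace ℝ (Fin n), x ≠ 0 →
      -(wdiv a (u i) x) = ‖x‖ ^ (-(b*p)) *
        ∑ j, κ i j * u i x ^ (α i j - 1) * u j x ^ (β i j))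
    (hE : ∀ i, finiteEnergy a (u i)) :
    ∃ μ₀ c₁ c₂ : ℝ, 0 < μ₀ ∧ 0 < c₁ ∧ 0 < c₂ ∧
      (∀ x : EuclideanSpace ℝ (Fin n), x ≠ 0 →
        u 0 x = c₁ * bubbleMu n a b μ₀ x ∧ u 1 x = c₂ * bubbleMu n a b μ₀ x) ∧
      κ 0 0 * c₁ ^ (p-2) + κ 0 1 * c₁ ^ (α 0 1 - 2) * c₂ ^ (β 0 1) = 1 ∧
      κ 1 1 * c₂ ^ (p-2) + κ 1 0 * c₂ ^ (α 1 0 - 2) * c₁ ^ (β 1 0) = 1 := by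
  have hD : 0 < (n : ℝ) - 2 + 2 * (b - a) := by linarith
  have hu := isHenonSol_of_wdiv ha0 ha hb0 hab hba hp hκ hα hβ hαβ hreg hpos heq
  set P := henonParams ha0 ha hb0 hab hba hp hκ hα hβ hαβ
  have hPl : P.l = ((n : ℝ) - 2) / 2 - a := rfl
  have hPp : P.p = p := rfl
  have hE' : ∀ i, Integrable fun x => ‖x‖ ^ (-(2 * (P.m - P.l))) * ‖gradient (u i) x‖ ^ 2 := by
    intro i
    rw [show P.m - P.l = a from sub_sub_cancel _ _]
    exact hE i
  obtain ⟨C, A, hC, hA, hu', hnl⟩ := hu.exists_eq hE' hsym₁ hsym₂ hsym₃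
    (e := EuclideanSpace.single (⟨0, by omega⟩ : Fin n) (1 : ℝ)) (by simp)
  have hp2 : 0 < p - 2 := sub_pos.2 P.two_lt_p
  have hl := P.l_pos
  have hγ : P.l * (p - 2) ≠ 0 := (mul_pos hl hp2).ne'
  have hpp : 0 < p := by linarith
  set μ : ℝ := C ^ (-(P.l * (p - 2))⁻¹)
  have hμ : 0 < μ := rpow_pos_of_pos hC _
  have hμC : μ ^ (-(P.l * (p - 2))) = C := by
    rw [← rpow_mul hC.le, neg_mul_neg, inv_mul_cancel₀ hγ, rpow_one]
  have hK0 : 0 < 2 * P.l ^ 2 * p := by positivity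
  set K : ℝ := (2 * P.l ^ 2 * p) ^ (1 / (p - 2))
  have hK : 0 < K := rpow_pos_of_pos hK0 _
  set t : ℝ := μ ^ P.l / K
  have ht : 0 < t := div_pos (rpow_pos_of_pos hμ _) hK
  have htp : t ^ (p - 2) * (2 * P.l ^ 2 * p * C) = 1 := by
    have h1 : K ^ (p - 2) = 2 * P.l ^ 2 * p := by
      rw [← rpow_mul hK0.le, one_div, inv_mul_cancel₀ hp2.ne', rpow_one]
    have h2 := (rpow_pos_of_pos hμ (P.l * (p - 2))).ne'
    rw [div_rpow (rpow_pos_of_pos hμ _).le hK.le, h1, ← rpow_mul hμ.le, ← hμC, rpow_neg hμ.le]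
    field_simp
  have hc : ∀ i, 0 < t * A i := fun i => mul_pos ht (hA i)
  have hfix : ∀ i, P.nonlin (fun j => t * A j) i = t * A i := fun i => by
    rw [P.nonlin_smul ht hA, hnl, hPp, show p - 1 = (p - 2) + 1 by ring, rpow_add_one ht.ne']
    linear_combination t * A i * htp
  have hval : ∀ i, ∀ x : EuclideanSpace ℝ (Fin n), x ≠ 0 →
      u i x = t * A i * bubbleMu n a b μ x := fun i x hx => by
    rw [hu' i x hx, bubbleMu_eq hμ hD hba hp, ← hPl, hPp, hμC]
    change _ = μ ^ P.l / K * A i * (K / μ ^ P.l * _)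
    have := (rpow_pos_of_pos hμ P.l).ne'
    field_simp
  have hself : ∀ i, κ i i * (t * A i) ^ (α i i - 1) * (t * A i) ^ β i i =
      t * A i * (κ i i * (t * A i) ^ (p - 2)) := fun i => by
    rw [mul_assoc, ← rpow_add (hc i), show α i i - 1 + β i i = (p - 2) + 1 by
      rw [← hαβ i i]; ring, rpow_add_one (hc i).ne']
    ring
  have hcross : ∀ i j, κ i j * (t * A i) ^ (α i j - 1) * (t * A j) ^ β i j =
      t * A i * (κ i j * (t * A i) ^ (α i j - 2) * (t * A j) ^ β i j) := fun i j => by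
    rw [show α i j - 1 = (α i j - 2) + 1 by ring, rpow_add_one (hc i).ne']
    ring
  refine ⟨μ, t * A 0, t * A 1, hμ, hc 0, hc 1, fun x hx => ⟨hval 0 x hx, hval 1 x hx⟩, ?_, ?_⟩
  · have h := hfix 0
    change ∑ j, κ 0 j * (t * A 0) ^ (α 0 j - 1) * (t * A j) ^ β 0 j = _ at h
    rw [Fin.sum_univ_two, hself, hcross, ← mul_add] at h
    exact (mul_eq_left₀ (hc 0).ne').1 h
  · have h := hfix 1
    change ∑ j, κ 1 j * (t * A 1) ^ (α 1 j - 1) * (t * A j) ^ β 1 j = _ at h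
    rw [Fin.sum_univ_two, hself, hcross, ← mul_add, add_comm] at h
    exact (mul_eq_left₀ (hc 1).ne').1 h
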